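/- arXiv:1306.2137 — 3 statements merged into one kernel-verified Lean document; each statement's English description precedes it below -/
import Mathlib

section
/- Let W be a 2-dimensional complex vector space with a fixed basis and let Z : 𝒦(W) → 𝒦(W*) be a continuous, translation invariant, SL(W,ℂ)-contravariant Minkowski valuation given by h(ZK,u) = f_1(K,u) + f_2(K,u) + f_3(K,u), where f_1(K,·) = h(D̃_M K,·) and f_3(K,·) = h(Π_N K,·) for some M, N ∈ 𝒦(ℂ). Then f_2(K,·) ≡ 0 for every convex body K ∈ 𝒦(W) with dim K ≤ 2. -/
open scoped Pointwise
open MeasureTheory Module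

noncomputable section

section CommonDefs

variable {V V' A : Type*}
variable [NormedAddCommGroup V] [NormedSpace ℝ V]
variable [NormedAddCommGroup V'] [NormedSpace ℝ V']
variable [NormedAddCommGroup A] [NormedSpace ℝ A]

/-- The supremum of a (pairing) functional over a convex body; used to express the
support function `h(K, ξ) = sup_{x ∈ K} ⟨ξ, x⟩` for the various pairings `p = ⟨ξ, ·⟩`. -/
def hSupp (K : ConvexBody V) (p : V → ℝ) : ℝ := sSup (p '' (K : Set V))

/-- The translate `x + K` of a convex body. -/
def ConvexBody.translate (K : ConvexBody V) (x : V) : ConvexBody V :=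
  ⟨(fun y => x + y) '' (K : Set V), K.convex.translate x,
    K.isCompact.image (continuous_const.add continuous_id),
    K.nonempty.image _⟩

/-- The image of a convex body under a continuous linear map. -/
def ConvexBody.mapCLM (f : V →L[ℝ] V') (K : ConvexBody V) : ConvexBody V' :=
  ⟨f '' (K : Set V), K.convex.linear_image (f : V →ₗ[ℝ] V'),
    K.isCompact.image f.continuous, K.nonempty.image _⟩

/-- The reflection `-K` of a convex body about the origin. -/
def ConvexBody.neg (K : ConvexBody V) : ConvexBody V :=
  K.mapCLM (-(ContinuousLinearMap.id ℝ V))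

/-- The union of two convex bodies (a convex body provided it is convex). -/
def ConvexBody.union (K L : ConvexBody V) (h : Convex ℝ ((K : Set V) ∪ (L : Set V))) :
    ConvexBody V :=
  ⟨(K : Set V) ∪ (L : Set V), h, K.isCompact.union L.isCompact,
    K.nonempty.mono Set.subset_union_left⟩

/-- The intersection of two convex bodies (a convex body provided it is nonempty). -/
def ConvexBody.inter (K L : ConvexBody V) (h : ((K : Set V) ∩ (L : Set V)).Nonempty) :
    ConvexBody V :=
  ⟨(K : Set V) ∩ (L : Set V), K.convex.inter L.convex,
    K.isCompact.inter_right L.isClosed, h⟩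

/-- A Minkowski valuation: `Z(K ∪ L) + Z(K ∩ L) = Z(K) + Z(L)` (Minkowski addition)
whenever `K, L, K ∪ L` are convex bodies. -/
def IsMinkowskiValuation (Z : ConvexBody V → ConvexBody A) : Prop :=
  ∀ (K L : ConvexBody V) (hU : Convex ℝ ((K : Set V) ∪ (L : Set V)))
    (hI : ((K : Set V) ∩ (L : Set V)).Nonempty),
    Z (K.union L hU) + Z (K.inter L hI) = Z K + Z L

/-- A real-valued valuation: `φ(K ∪ L) + φ(K ∩ L) = φ(K) + φ(L)`
whenever `K, L, K ∪ L` are convex bodies. -/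
def IsValuation (φ : ConvexBody V → ℝ) : Prop :=
  ∀ (K L : ConvexBody V) (hU : Convex ℝ ((K : Set V) ∪ (L : Set V)))
    (hI : ((K : Set V) ∩ (L : Set V)).Nonempty),
    φ (K.union L hU) + φ (K.inter L hI) = φ K + φ L

/-- Translation invariance of a map defined on convex bodies. -/
def IsTranslationInvariant {α : Type*} (Z : ConvexBody V → α) : Prop :=
  ∀ (K : ConvexBody V) (x : V), Z (K.translate x) = Z K

/-- The mixed volume (w.r.t. the Lebesgue (Haar) measure `μ`) of an `n`-tuple of convex
bodies, given by the polarization formula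
`V(K₁, …, Kₙ) = (1/n!) ∑_{S ⊆ {1,…,n}} (-1)^{n - |S|} vol(∑_{i ∈ S} K_i)`. -/
def mixedVol [MeasurableSpace V] (μ : Measure V) {n : ℕ} (K : Fin n → ConvexBody V) : ℝ :=
  (n.factorial : ℝ)⁻¹ *
    ∑ S : Finset (Fin n), (-1 : ℝ) ^ (n - S.card) * (μ (∑ i ∈ S, (K i : Set V))).toReal

/-- The extension `V(K, …, K, f)` (with `n - 1` copies of `K`) of the mixed volume to
continuous positively `1`-homogeneous functions `f` on the dual space, defined via
Aleksandrov's variational formula: `V(K,…,K,f)` is `1/n` times the right derivative at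
`t = 0` of the volume of the Wulff shape (aka Aleksandrov body) of `h_K + t f`.
For `f = h_L` the Wulff shape is `K + t L`, so this indeed extends `L ↦ V(K, …, K, L)`. -/
def mixedVolFn [MeasurableSpace V] (μ : Measure V) (K : ConvexBody V)
    (f : (V →L[ℝ] ℝ) → ℝ) : ℝ :=
  (Module.finrank ℝ V : ℝ)⁻¹ *
    derivWithin (fun t : ℝ =>
        (μ {x : V | ∀ ξ : V →L[ℝ] ℝ, ξ x ≤ hSupp K ξ + t * f ξ}).toReal)
      (Set.Ici 0) 0

/-- The dimension of a convex body: the dimension of (the direction of) its affine hull. -/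
def bodyDim (K : ConvexBody V) : ℕ := Module.finrank ℝ (vectorSpan ℝ (K : Set V))

/-- A convex body contained in a subspace `E`, viewed as a convex body of `E`. -/
def bodyIn (E : Submodule ℝ V) (K : ConvexBody V) (h : (K : Set V) ⊆ (E : Set V)) :
    ConvexBody ↥E :=
  ⟨Subtype.val ⁻¹' (K : Set V),
    K.convex.linear_preimage (E.subtype),
    by
      rw [Topology.IsEmbedding.subtypeVal.isCompact_iff,
        Set.image_preimage_eq_of_subset (by rw [Subtype.range_coe]; exact h)]
      exact K.isCompact,
    by obtain ⟨x, hx⟩ := K.nonempty; exact ⟨⟨x, h hx⟩, hx⟩⟩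

/-- The properties of the components of McMullen's decomposition of (the support function
of) a Minkowski valuation: each `fᵢ(·, u)` is a continuous, translation invariant
valuation, homogeneous of degree `i`, and each `fᵢ(K, ·)` is continuous and positively
`1`-homogeneous. -/
def McMullenProps (f : ℕ → ConvexBody V → V → ℝ) : Prop :=
  (∀ (i : ℕ) (u : V), Continuous fun K : ConvexBody V => f i K u) ∧
  (∀ (i : ℕ) (u : V), IsValuation fun K : ConvexBody V => f i K u) ∧
  (∀ (i : ℕ) (u : V), IsTranslationInvariant fun K : ConvexBody V => f i K u) ∧
  (∀ (i : ℕ) (K : ConvexBody V) (u : V) (t : ℝ), 0 < t → f i (t • K) u = t ^ i * f i K u) ∧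
  (∀ (i : ℕ) (K : ConvexBody V), Continuous fun u : V => f i K u) ∧
  (∀ (i : ℕ) (K : ConvexBody V) (u : V) (t : ℝ), 0 < t → f i K (t • u) = t * f i K u)

end CommonDefs

/-- The surface area measure `S(M, ·)` on `S¹ ⊆ ℂ` of a planar convex body `M`,
characterized (uniquely) by the property that it is a finite measure concentrated on the
unit circle with `∫_{S¹} h(L, α) dσ(α) = 2 V(M, L)` for every planar convex body `L`. -/
def IsSurfaceAreaMeasure (M : ConvexBody ℂ) (σ : Measure ℂ) : Prop :=
  IsFiniteMeasure σ ∧ σ (Metric.sphere (0 : ℂ) 1)ᶜ = 0 ∧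
    ∀ L : ConvexBody ℂ,
      (∫ α, hSupp L (fun c => (c * (starRingEnd ℂ) α).re) ∂σ) = 2 * mixedVol volume ![M, L]

section ComplexDefs

variable {W : Type*} [NormedAddCommGroup W] [NormedSpace ℂ W] [FiniteDimensional ℂ W]

/-- The determinant pairing `det(u, v)` on a 2-dimensional complex vector space,
with respect to a fixed basis `b`. -/
def cdet (b : Basis (Fin 2) ℂ W) (u v : W) : ℂ :=
  b.coord 0 u * b.coord 1 v - b.coord 1 u * b.coord 0 v

/-- `det(·, w) : W → ℂ` as a continuous real-linear map. -/
def cdetCLM (b : Basis (Fin 2) ℂ W) (w : W) : W →L[ℝ] ℂ :=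
  LinearMap.toContinuousLinearMap
    (((b.coord 1 w) • (b.coord 0 : W →ₗ[ℂ] ℂ)
      - (b.coord 0 w) • (b.coord 1 : W →ₗ[ℂ] ℂ)).restrictScalars ℝ)

/-- `det(K, w) = {det(k, w) : k ∈ K} ⊆ ℂ`. -/
def detBody (b : Basis (Fin 2) ℂ W) (K : ConvexBody W) (w : W) : ConvexBody ℂ :=
  K.mapCLM (cdetCLM b w)

/-- `N · w = {c • w : c ∈ N} ⊆ W` for a planar convex body `N ⊆ ℂ`. -/
def dotBody (N : ConvexBody ℂ) (w : W) : ConvexBody W :=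
  N.mapCLM (LinearMap.toContinuousLinearMap ((LinearMap.toSpanSingleton ℂ W w).restrictScalars ℝ))

/-- A complex-linear endomorphism, as a continuous real-linear map. -/
def cReal (g : W →ₗ[ℂ] W) : W →L[ℝ] W :=
  LinearMap.toContinuousLinearMap (g.restrictScalars ℝ)

/-- Precomposition `ξ ↦ ξ ∘ g` on the complex dual `W* = W →L[ℂ] ℂ`,
as a continuous real-linear map. The adjoint of `g` is `precompDual g`, and
`g^{-*} = precompDual g⁻¹`. -/
def precompDual (g : W →L[ℂ] W) : (W →L[ℂ] ℂ) →L[ℝ] (W →L[ℂ] ℂ) :=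
  LinearMap.toContinuousLinearMap
    { toFun := fun ξ => ξ.comp g
      map_add' := fun ξ η => ContinuousLinearMap.add_comp ξ η g
      map_smul' := fun r ξ => ContinuousLinearMap.smul_comp r ξ g }

/-- `Z : 𝒦(W) → 𝒦(W*)` is `SL(W,ℂ)`-contravariant: `Z(gK) = g^{-*} Z(K)` for every
`g ∈ SL(W,ℂ)`. -/
def IsSLContravariant (Z : ConvexBody W → ConvexBody (W →L[ℂ] ℂ)) : Prop :=
  ∀ g : W ≃L[ℂ] W, LinearMap.det ((g : W →L[ℂ] W) : W →ₗ[ℂ] W) = 1 →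
    ∀ K : ConvexBody W,
      Z (K.mapCLM (cReal (g : W →ₗ[ℂ] W))) =
        (Z K).mapCLM (precompDual (g.symm : W →L[ℂ] W))

/-- `Z : 𝒦(W) → 𝒦(W)` is `SL(W,ℂ)`-covariant: `Z(gK) = g Z(K)` for every
`g ∈ SL(W,ℂ)`. -/
def IsSLCovariant (Z : ConvexBody W → ConvexBody W) : Prop :=
  ∀ g : W ≃L[ℂ] W, LinearMap.det ((g : W →L[ℂ] W) : W →ₗ[ℂ] W) = 1 →
    ∀ K : ConvexBody W,
      Z (K.mapCLM (cReal (g : W →ₗ[ℂ] W))) = (Z K).mapCLM (cReal (g : W →ₗ[ℂ] W))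

end ComplexDefs

section SLContravariantFamilies

variable {W : Type*} [NormedAddCommGroup W] [NormedSpace ℂ W]

theorem coe_translate (K : ConvexBody W) (x : W) :
    (K.translate x : Set W) = (fun y => x + y) '' (K : Set W) := rfl

theorem hSupp_add_le (K : ConvexBody (W →L[ℂ] ℂ)) (u v : W) :
    hSupp K (fun ξ => (ξ (u + v)).re)
      ≤ hSupp K (fun ξ => (ξ u).re) + hSupp K (fun ξ => (ξ v).re) := by
  have hbdd : ∀ w : W, BddAbove ((fun ξ : W →L[ℂ] ℂ => (ξ w).re) '' (K : Set (W →L[ℂ] ℂ))) :=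
    fun w => (K.isCompact.image (by fun_prop)).bddAbove
  refine csSup_le (K.nonempty.image _) ?_
  rintro _ ⟨ξ, hξ, rfl⟩
  simp only [map_add, Complex.add_re]
  exact add_le_add (le_csSup (hbdd u) ⟨ξ, hξ, rfl⟩) (le_csSup (hbdd v) ⟨ξ, hξ, rfl⟩)

theorem eq_coord_smul_add (b : Basis (Fin 2) ℂ W) (x : W) :
    x = b.coord 0 x • b 0 + b.coord 1 x • b 1 :=
  (b.sum_repr x).symm.trans (Fin.sum_univ_two _)

theorem coord_diagonal (b : Basis (Fin 2) ℂ W) {a : ℂ} {g : W ≃L[ℂ] W}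
    (h0 : g (b 0) = a • b 0) (h1 : g (b 1) = a⁻¹ • b 1) (x : W) :
    b.coord 0 (g x) = a * b.coord 0 x ∧ b.coord 1 (g x) = a⁻¹ * b.coord 1 x := by
  have hx : g x = (a * b.coord 0 x) • b 0 + (a⁻¹ * b.coord 1 x) • b 1 := by
    conv_lhs => rw [← b.sum_repr x]
    simp only [Fin.sum_univ_two, map_add, map_smul, h0, h1, smul_smul, Basis.coord_apply, mul_comm]
  rw [hx]
  simp

/-- The set of real combinations of `b 0`, `b 1` with coefficients bounded by `R`. -/
def realBox (b : Basis (Fin 2) ℂ W) (R : ℝ) : Set W :=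
  {x | (b.coord 0 x).im = 0 ∧ (b.coord 1 x).im = 0 ∧
    |(b.coord 0 x).re| ≤ R ∧ |(b.coord 1 x).re| ≤ R}

theorem norm_le_of_mem_realBox (b : Basis (Fin 2) ℂ W) {R : ℝ} {x : W} (hx : x ∈ realBox b R) :
    ‖x‖ ≤ R * ‖b 0‖ + R * ‖b 1‖ := by
  obtain ⟨i0, i1, r0, r1⟩ := hx
  have n0 : ‖b.coord 0 x‖ ≤ R := by
    rwa [← Complex.abs_re_eq_norm.2 i0]
  have n1 : ‖b.coord 1 x‖ ≤ R := by
    rwa [← Complex.abs_re_eq_norm.2 i1]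
  calc ‖x‖ = ‖b.coord 0 x • b 0 + b.coord 1 x • b 1‖ := by rw [← eq_coord_smul_add b x]
    _ ≤ ‖b.coord 0 x‖ * ‖b 0‖ + ‖b.coord 1 x‖ * ‖b 1‖ := by
      rw [← norm_smul, ← norm_smul]; exact norm_add_le _ _
    _ ≤ _ := by gcongr

variable [FiniteDimensional ℂ W]

/-- A family `u ↦ F(·, u)` of continuous, translation invariant valuations on `W`, homogeneous
of degree `i`, positively `1`-homogeneous in `u`, and jointly `SL(W,ℂ)`-contravariant. -/
structure IsContravariantFamily (F : ConvexBody W → W → ℝ) (i : ℕ) : Prop where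
  continuous : ∀ u, Continuous fun K => F K u
  valuation : ∀ u, IsValuation fun K => F K u
  translate : ∀ K x u, F (K.translate x) u = F K u
  smul_body : ∀ K u (t : ℝ), 0 < t → F (t • K) u = t ^ i * F K u
  smul_vec : ∀ K u (t : ℝ), 0 < t → F K (t • u) = t * F K u
  map : ∀ g : W ≃L[ℂ] W, LinearMap.det ((g : W →L[ℂ] W) : W →ₗ[ℂ] W) = 1 →
    ∀ K u, F (K.mapCLM (cReal (g : W →ₗ[ℂ] W))) u = F K (g.symm u)

theorem coe_mapCLM_cReal (g : W ≃L[ℂ] W) (K : ConvexBody W) :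
    (K.mapCLM (cReal (g : W →ₗ[ℂ] W)) : Set W) = g '' (K : Set W) := rfl

theorem exists_diagonal (b : Basis (Fin 2) ℂ W) {a : ℂ} (ha : a ≠ 0) :
    ∃ g : W ≃L[ℂ] W, LinearMap.det ((g : W →L[ℂ] W) : W →ₗ[ℂ] W) = 1 ∧
      g (b 0) = a • b 0 ∧ g (b 1) = a⁻¹ • b 1 := by
  have hdet : (Matrix.diagonal ![a, a⁻¹]).det = 1 := by
    simp [Matrix.det_diagonal, ha]
  refine ⟨(Matrix.toLinearEquiv b (Matrix.diagonal ![a, a⁻¹])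
    (by rw [hdet]; exact isUnit_one)).toContinuousLinearEquiv, ?_, ?_, ?_⟩
  · exact (LinearMap.det_toLin b _).trans hdet
  · change Matrix.toLin b b _ (b 0) = _
    rw [Matrix.toLin_self]; simp
  · change Matrix.toLin b b _ (b 1) = _
    rw [Matrix.toLin_self]; simp

namespace IsContravariantFamily

variable {F : ConvexBody W → W → ℝ} {i : ℕ}

theorem map_zero (hF : IsContravariantFamily F i) (K : ConvexBody W) : F K 0 = 0 := by
  have := hF.smul_vec K 0 2 two_pos
  rw [smul_zero] at this
  linarith

theorem zero_body (hF : IsContravariantFamily F i) (hi : 2 ≤ i) (u : W) : F 0 u = 0 := by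
  have h := hF.smul_body 0 u 2 two_pos
  rw [smul_zero] at h
  have : (2 : ℝ) ^ 2 ≤ 2 ^ i := pow_le_pow_right₀ one_le_two hi
  nlinarith [mul_self_nonneg (F 0 u), mul_self_nonneg ((2 : ℝ) ^ i)]

theorem exists_bound (hF : IsContravariantFamily F i) (hi : 2 ≤ i) (u : W) (R : ℝ) :
    ∃ C : ℝ, ∀ K : ConvexBody W, (∀ x ∈ K, ‖x‖ ≤ R) → |F K u| ≤ C := by
  obtain ⟨δ, hδ, h⟩ := Metric.continuous_iff.1 (hF.continuous u) 0 1 one_pos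
  set r : ℝ := δ / (2 * (|R| + 1)) with hr
  have hR : 0 < |R| + 1 := by positivity
  have hr0 : 0 < r := by positivity
  have hrR : r * |R| ≤ δ / 2 := by
    have : r * (|R| + 1) = δ / 2 := by rw [hr]; field_simp
    nlinarith
  refine ⟨(r ^ i)⁻¹, fun K hK => ?_⟩
  have hd : dist (r • K) 0 < δ := by
    refine lt_of_le_of_lt ?_ (half_lt_self hδ)
    rw [← ConvexBody.hausdorffDist_coe, ConvexBody.coe_smul, ConvexBody.coe_zero]
    have hb : ∀ x ∈ (K : Set W), dist (r • x) 0 ≤ δ / 2 := fun x hx => by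
      rw [dist_zero_right, norm_smul, Real.norm_of_nonneg hr0.le]
      exact (mul_le_mul_of_nonneg_left ((hK x hx).trans (le_abs_self R)) hr0.le).trans hrR
    refine Metric.hausdorffDist_le_of_mem_dist (by positivity) ?_ ?_
    · rintro _ ⟨x, hx, rfl⟩
      exact ⟨0, rfl, hb x hx⟩
    · rintro _ rfl
      obtain ⟨x, hx⟩ := K.nonempty
      exact ⟨r • x, ⟨x, hx, rfl⟩, by rw [dist_comm]; exact hb x hx⟩
  have h' := h _ hd
  simp only [hF.zero_body hi, Real.dist_eq, sub_zero, hF.smul_body K u r hr0, abs_mul,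
    abs_of_pos (pow_pos hr0 i)] at h'
  rw [← one_div, le_div_iff₀ (pow_pos hr0 i), mul_comm]
  exact h'.le

/-- On bodies in a complex line `ℂv`, an element of `SL(W,ℂ)` acting as a dilation on `ℂv`
forces `F` to vanish on the two coordinate lines. -/
theorem eq_zero_of_subset_line (hF : IsContravariantFamily F i) (hi : 2 ≤ i)
    (b : Basis (Fin 2) ℂ W) {K : ConvexBody W} (hK : ∀ x ∈ K, b.coord 1 x = 0) (c : ℂ) :
    F K (c • b 0) = 0 ∧ F K (c • b 1) = 0 := by
  obtain ⟨g, hg, h0, h1⟩ := exists_diagonal b (a := 2) two_ne_zero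
  have hgK : K.mapCLM (cReal (g : W →ₗ[ℂ] W)) = (2 : ℝ) • K := by
    apply ConvexBody.ext
    rw [coe_mapCLM_cReal, ConvexBody.coe_smul]
    refine Set.image_congr fun x hx => ?_
    have hx' : x = b.coord 0 x • b 0 := by
      conv_lhs => rw [eq_coord_smul_add b x, hK x hx, zero_smul, add_zero]
    rw [hx', map_smul, h0, smul_comm]
    change _ = (2 : ℝ) • b.coord 0 x • b 0
    rw [two_smul, two_smul]
  have key := fun u => hF.map g hg K u
  simp only [hgK, hF.smul_body K _ 2 two_pos] at key
  have h4 : (2 : ℝ) ^ 2 ≤ 2 ^ i := pow_le_pow_right₀ one_le_two hi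
  have e0 : g.symm ((2 : ℝ) • c • b 0) = c • b 0 := by
    rw [ContinuousLinearEquiv.symm_apply_eq, map_smul, h0, two_smul, two_smul, smul_add]
  have e1 : g.symm (c • b 1) = (2 : ℝ) • c • b 1 := by
    rw [ContinuousLinearEquiv.symm_apply_eq, two_smul, map_add, map_smul, h1, ← smul_add,
      ← add_smul]
    norm_num
  constructor
  · have := key ((2 : ℝ) • c • b 0)
    rw [e0, hF.smul_vec _ _ 2 two_pos] at this
    nlinarith [mul_self_nonneg (F K (c • b 0))]
  · have := key (c • b 1)
    rw [e1, hF.smul_vec _ _ 2 two_pos] at this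
    nlinarith [mul_self_nonneg (F K (c • b 1))]

/-- Stretching a body in a half box by `2` in the direction of `b 1` relates the value of `F` in
the direction of `b 0` to its value on a body in the full box. -/
theorem exists_stretch (hF : IsContravariantFamily F i) (b : Basis (Fin 2) ℂ W) {R : ℝ}
    {K : ConvexBody W} (s : ℝ) (hs : |s| = R)
    (hK : ∀ x ∈ K, x ∈ realBox b R ∧ 0 ≤ s * (b.coord 1 x).re) (c : ℂ) :
    ∃ L : ConvexBody W, (∀ x ∈ L, x ∈ realBox b R) ∧
      F L (c • b 0) = √2 ^ (i + 1) * F K (c • b 0) := by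
  have ht : (0 : ℝ) < √2 := by positivity
  have htt : √2 * √2 = 2 := Real.mul_self_sqrt zero_le_two
  have hC : ((√2 : ℝ) : ℂ) ≠ 0 := by exact_mod_cast ht.ne'
  obtain ⟨g, hg, h0, h1⟩ := exists_diagonal b (inv_ne_zero hC)
  refine ⟨√2 • (K.translate (-(((s / 2 : ℝ) : ℂ) • b 1))).mapCLM (cReal (g : W →ₗ[ℂ] W)), ?_, ?_⟩
  · intro x hx
    rw [← SetLike.mem_coe, ConvexBody.coe_smul, coe_mapCLM_cReal, coe_translate] at hx
    obtain ⟨_, ⟨_, ⟨x, hxK, rfl⟩, rfl⟩, rfl⟩ := hx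
    obtain ⟨⟨i0, i1, r0, r1⟩, hpos⟩ := hK x hxK
    obtain ⟨c0, c1⟩ := coord_diagonal b h0 h1 (-(((s / 2 : ℝ) : ℂ) • b 1) + x)
    have e0 : b.coord 0 (√2 • g (-(((s / 2 : ℝ) : ℂ) • b 1) + x)) = b.coord 0 x := by
      rw [← Complex.coe_smul, map_smul, c0, smul_eq_mul, mul_inv_cancel_left₀ hC]
      simp
    have e1 : b.coord 1 (√2 • g (-(((s / 2 : ℝ) : ℂ) • b 1) + x))
        = ((2 : ℝ) : ℂ) * (b.coord 1 x - ((s / 2 : ℝ) : ℂ)) := by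
      rw [← Complex.coe_smul, map_smul, c1, smul_eq_mul, ← mul_assoc, inv_inv,
        ← Complex.ofReal_mul, htt]
      simp
      ring
    refine ⟨by rw [e0]; exact i0, ?_, by rw [e0]; exact r0, ?_⟩
    · rw [e1, Complex.im_ofReal_mul, Complex.sub_im, Complex.ofReal_im, i1, sub_zero, mul_zero]
    · rw [e1, Complex.re_ofReal_mul, Complex.sub_re, Complex.ofReal_re, ← hs]
      rw [← hs] at r1
      rcases abs_cases s with ⟨h, h'⟩ | ⟨h, h'⟩ <;> rw [h] at r1 ⊢ <;> rw [abs_le] at r1 ⊢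
      · rcases h'.eq_or_lt with rfl | h'
        · constructor <;> linarith
        · have := nonneg_of_mul_nonneg_right hpos h'
          constructor <;> linarith
      · have := nonpos_of_mul_nonneg_right hpos h'
        constructor <;> linarith
  · rw [hF.smul_body _ _ _ ht, hF.map g hg, hF.translate]
    have : g.symm (c • b 0) = √2 • c • b 0 := by
      rw [ContinuousLinearEquiv.symm_apply_eq, ← Complex.coe_smul, map_smul, map_smul, h0,
        smul_comm c, smul_inv_smul₀ hC]
    rw [this, hF.smul_vec _ _ _ ht]
    ring

theorem abs_le_of_half (hF : IsContravariantFamily F i) (b : Basis (Fin 2) ℂ W) {R C : ℝ}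
    {c : ℂ} (hC : ∀ K : ConvexBody W, (∀ x ∈ K, x ∈ realBox b R) → |F K (c • b 0)| ≤ C)
    {K : ConvexBody W} (s : ℝ) (hs : |s| = R)
    (hK : ∀ x ∈ K, x ∈ realBox b R ∧ 0 ≤ s * (b.coord 1 x).re) :
    |F K (c • b 0)| ≤ C / √2 ^ (i + 1) := by
  obtain ⟨L, hL, hLK⟩ := hF.exists_stretch b s hs hK c
  have := hC L hL
  rw [hLK, abs_mul, abs_of_pos (by positivity)] at this
  rwa [le_div_iff₀ (by positivity), mul_comm]

/-- Bisecting a body in the box by the line `ℝ (b 0)` improves any uniform bound. -/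
theorem abs_le_of_bisect (hF : IsContravariantFamily F i) (hi : 2 ≤ i) (b : Basis (Fin 2) ℂ W)
    {R C : ℝ} {c : ℂ}
    (hC : ∀ K : ConvexBody W, (∀ x ∈ K, x ∈ realBox b R) → |F K (c • b 0)| ≤ C)
    (K : ConvexBody W) (hK : ∀ x ∈ K, x ∈ realBox b R) :
    |F K (c • b 0)| ≤ 2 * (C / √2 ^ (i + 1)) := by
  have hC0 : 0 ≤ C / √2 ^ (i + 1) := div_nonneg ((abs_nonneg _).trans (hC K hK)) (by positivity)
  have hR : 0 ≤ R := by
    obtain ⟨x, hx⟩ := K.nonempty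
    exact (abs_nonneg _).trans (hK x hx).2.2.1
  let ℓ : W →L[ℝ] ℝ :=
    Complex.reCLM.comp ((LinearMap.toContinuousLinearMap (b.coord 1)).restrictScalars ℝ)
  have hℓ : ∀ x, ℓ x = (b.coord 1 x).re := fun _ => rfl
  by_cases hpos : ∃ x ∈ (K : Set W), 0 ≤ ℓ x
  swap
  · push Not at hpos
    refine (hF.abs_le_of_half b hC (-R) (by rw [abs_neg, abs_of_nonneg hR])
      fun x hx => ⟨hK x hx, ?_⟩).trans (by linarith)
    have := hpos x hx
    rw [hℓ] at this
    nlinarith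
  by_cases hneg : ∃ x ∈ (K : Set W), ℓ x ≤ 0
  swap
  · push Not at hneg
    refine (hF.abs_le_of_half b hC R (abs_of_nonneg hR)
      fun x hx => ⟨hK x hx, ?_⟩).trans (by linarith)
    exact mul_nonneg hR (hneg x hx).le
  let K₁ : ConvexBody W := ⟨(K : Set W) ∩ {x | 0 ≤ ℓ x},
    K.convex.inter (convex_halfSpace_ge ℓ.isLinear 0),
    K.isCompact.inter_right (isClosed_le continuous_const ℓ.continuous), hpos⟩
  let K₂ : ConvexBody W := ⟨(K : Set W) ∩ {x | ℓ x ≤ 0},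
    K.convex.inter (convex_halfSpace_le ℓ.isLinear 0),
    K.isCompact.inter_right (isClosed_le ℓ.continuous continuous_const), hneg⟩
  have hun : (K₁ : Set W) ∪ K₂ = K := by
    change (K : Set W) ∩ _ ∪ (K : Set W) ∩ _ = K
    rw [← Set.inter_union_distrib_left, Set.inter_eq_left]
    exact fun x _ => le_total 0 (ℓ x)
  have hin : ((K₁ : Set W) ∩ K₂).Nonempty := by
    obtain ⟨x, hx, hx0⟩ := hpos
    obtain ⟨y, hy, hy0⟩ := hneg
    obtain ⟨z, hz, hz0⟩ := K.convex.isPreconnected.intermediate_value hy hx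
      ℓ.continuous.continuousOn ⟨hy0, hx0⟩
    exact ⟨z, ⟨hz, hz0.ge⟩, hz, hz0.le⟩
  have hcv : Convex ℝ ((K₁ : Set W) ∪ K₂) := hun ▸ K.convex
  have hval := hF.valuation (c • b 0) K₁ K₂ hcv hin
  have hK12 : K₁.union K₂ hcv = K := ConvexBody.ext hun
  have hI : F (K₁.inter K₂ hin) (c • b 0) = 0 := by
    refine (hF.eq_zero_of_subset_line hi b (fun x hx => ?_) c).1
    obtain ⟨⟨hxK, hx1⟩, -, hx2⟩ := hx
    exact Complex.ext (le_antisymm hx2 hx1) (hK x hxK).2.1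
  have h1 : |F K₁ (c • b 0)| ≤ C / √2 ^ (i + 1) :=
    hF.abs_le_of_half b hC R (abs_of_nonneg hR)
      fun x hx => ⟨hK x hx.1, mul_nonneg hR hx.2⟩
  have h2 : |F K₂ (c • b 0)| ≤ C / √2 ^ (i + 1) :=
    hF.abs_le_of_half b hC (-R) (by rw [abs_neg, abs_of_nonneg hR])
      fun x hx => ⟨hK x hx.1, mul_nonneg_of_nonpos_of_nonpos (neg_nonpos.2 hR) hx.2⟩
  simp only [hK12, hI, add_zero] at hval
  rw [hval]
  exact (abs_add_le _ _).trans (by linarith)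

theorem eq_zero_of_subset_realBox (hF : IsContravariantFamily F i) (hi : 2 ≤ i)
    (b : Basis (Fin 2) ℂ W) {R : ℝ} {K : ConvexBody W} (hK : ∀ x ∈ K, x ∈ realBox b R) (c : ℂ) :
    F K (c • b 0) = 0 := by
  obtain ⟨C, hC⟩ := hF.exists_bound hi (c • b 0) (R * ‖b 0‖ + R * ‖b 1‖)
  have hq : 2 / √2 ^ (i + 1) < 1 := by
    rw [div_lt_one (by positivity)]
    have h1 : (1 : ℝ) < √2 := Real.lt_sqrt_of_sq_lt (by norm_num)
    calc (2 : ℝ) = √2 ^ 2 := (Real.sq_sqrt zero_le_two).symm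
      _ < √2 ^ (i + 1) := pow_lt_pow_right₀ h1 (by omega)
  have hn : ∀ n : ℕ, ∀ L : ConvexBody W, (∀ x ∈ L, x ∈ realBox b R) →
      |F L (c • b 0)| ≤ (2 / √2 ^ (i + 1)) ^ n * C := by
    intro n
    induction n with
    | zero =>
      intro L hL
      simpa using hC L fun x hx => norm_le_of_mem_realBox b (hL x hx)
    | succ n ih =>
      intro L hL
      refine (hF.abs_le_of_bisect hi b ih L hL).trans_eq ?_
      ring
  have hlim := (tendsto_pow_atTop_nhds_zero_of_lt_one (by positivity) hq).mul_const C
  rw [zero_mul] at hlim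
  exact abs_nonpos_iff.1 (ge_of_tendsto' hlim fun n => hn n K hK)

theorem eq_zero_of_coordinate_lines (hF : IsContravariantFamily F i) {K : ConvexBody W}
    (hsub : ∀ u v, F K (u + v) ≤ F K u + F K v) (b : Basis (Fin 2) ℂ W)
    (h0 : ∀ c : ℂ, F K (c • b 0) = 0) (h1 : ∀ c : ℂ, F K (c • b 1) = 0) (u : W) :
    F K u = 0 := by
  have hle : ∀ v, F K v ≤ 0 := fun v => by
    rw [eq_coord_smul_add b v]
    exact (hsub _ _).trans (by rw [h0, h1, add_zero])
  have := hsub u (-u)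
  rw [add_neg_cancel, hF.map_zero] at this
  linarith [hle u, hle (-u)]

theorem eq_zero_of_bodyDim_le_two (hF : IsContravariantFamily F i) (hi : 2 ≤ i)
    (hW : finrank ℂ W = 2) {K : ConvexBody W} (hdim : bodyDim K ≤ 2)
    (hsub : ∀ u v, F K (u + v) ≤ F K u + F K v) (u : W) : F K u = 0 := by
  obtain ⟨x₀, hx₀⟩ := K.nonempty
  have hmem : ∀ x ∈ K.translate (-x₀), x ∈ vectorSpan ℝ (K : Set W) := by
    rintro _ ⟨y, hy, rfl⟩
    have := vsub_mem_vectorSpan ℝ hy hx₀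
    rwa [vsub_eq_sub, sub_eq_neg_add] at this
  rw [← hF.translate K (-x₀) u]
  have hsub' : ∀ u v, F (K.translate (-x₀)) (u + v)
      ≤ F (K.translate (-x₀)) u + F (K.translate (-x₀)) v := by
    simpa only [hF.translate] using hsub
  unfold bodyDim at hdim
  generalize K.translate (-x₀) = K' at hmem hsub' ⊢
  generalize vectorSpan ℝ (K : Set W) = P at hmem hdim
  have : FiniteDimensional ℝ W := FiniteDimensional.complexToReal W
  have mkBasis : ∀ v w : W, LinearIndependent ℂ ![v, w] →
      ∃ b : Basis (Fin 2) ℂ W, b 0 = v ∧ b 1 = w := fun v w h =>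
    ⟨basisOfLinearIndependentOfCardEqFinrank h (by simp [hW]), by simp, by simp⟩
  by_cases hP : ∃ v ∈ P, ∃ w ∈ P, LinearIndependent ℂ ![v, w]
  · obtain ⟨v, hv, w, hw, hvw⟩ := hP
    have hspan : Submodule.span ℝ {v, w} = P := by
      refine Submodule.eq_of_le_of_finrank_le
        (Submodule.span_le.2 (Set.insert_subset hv (Set.singleton_subset_iff.2 hw))) ?_
      have := finrank_span_eq_card
        (hvw.restrict_scalars (R := ℝ) (by
          intro x y h
          simpa using h))
      rw [Matrix.range_cons, Matrix.range_cons, Matrix.range_empty, Set.union_empty,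
        Fintype.card_fin] at this
      rw [← Set.singleton_union, this]
      exact hdim
    have key : ∀ v w : W, LinearIndependent ℂ ![v, w] → Submodule.span ℝ {v, w} = P →
        ∀ c : ℂ, F K' (c • v) = 0 := by
      intro v w hvw hspan c
      obtain ⟨b, rfl, rfl⟩ := mkBasis v w hvw
      have hcont : ∀ j, Continuous (b.coord j) := fun j =>
        LinearMap.continuous_of_finiteDimensional _
      obtain ⟨R₀, hR₀⟩ := (K'.isCompact.image (hcont 0)).isBounded.exists_norm_le
      obtain ⟨R₁, hR₁⟩ := (K'.isCompact.image (hcont 1)).isBounded.exists_norm_le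
      refine hF.eq_zero_of_subset_realBox hi b (R := max R₀ R₁) (fun x hx => ?_) c
      have hxP := hmem x hx
      rw [← hspan, Submodule.mem_span_pair] at hxP
      obtain ⟨p, q, hpq⟩ := hxP
      refine ⟨?_, ?_, ?_, ?_⟩
      · rw [← hpq, ← Complex.coe_smul, ← Complex.coe_smul]
        simp [-Complex.coe_smul]
      · rw [← hpq, ← Complex.coe_smul, ← Complex.coe_smul]
        simp [-Complex.coe_smul]
      · exact (Complex.abs_re_le_norm _).trans
          ((hR₀ _ (Set.mem_image_of_mem _ hx)).trans (le_max_left _ _))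
      · exact (Complex.abs_re_le_norm _).trans
          ((hR₁ _ (Set.mem_image_of_mem _ hx)).trans (le_max_right _ _))
    obtain ⟨b, rfl, rfl⟩ := mkBasis v w hvw
    exact hF.eq_zero_of_coordinate_lines hsub' b (key _ _ hvw hspan)
      (key _ _ (LinearIndependent.pair_symm_iff.1 hvw) (by rw [Set.pair_comm, hspan])) u
  · push Not at hP
    obtain ⟨v, hv, hvP⟩ : ∃ v : W, v ≠ 0 ∧ ∀ x ∈ P, ∃ c : ℂ, c • v = x := by
      by_cases hP0 : ∃ v ∈ P, v ≠ 0
      · obtain ⟨v, hvP, hv⟩ := hP0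
        refine ⟨v, hv, fun x hx => ?_⟩
        have := hP v hvP x hx
        rw [LinearIndependent.pair_iff' hv] at this
        push Not at this
        exact this
      · push Not at hP0
        have : Nontrivial W := Module.nontrivial_of_finrank_pos (R := ℂ) (by omega)
        obtain ⟨v, hv⟩ := exists_ne (0 : W)
        exact ⟨v, hv, fun x hx => ⟨0, by rw [zero_smul, hP0 x hx]⟩⟩
    obtain ⟨w, hw⟩ := exists_linearIndependent_pair_of_one_lt_finrank (R := ℂ) (by omega) hv
    obtain ⟨b, rfl, rfl⟩ := mkBasis v w hw
    have hline : ∀ x ∈ K', b.coord 1 x = 0 := fun x hx => by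
      obtain ⟨c, rfl⟩ := hvP x (hmem x hx)
      simp
    exact hF.eq_zero_of_coordinate_lines hsub' b
      (fun c => (hF.eq_zero_of_subset_line hi b hline c).1)
      (fun c => (hF.eq_zero_of_subset_line hi b hline c).2) u

end IsContravariantFamily

theorem mapCLM_smul (g : W ≃L[ℂ] W) (K : ConvexBody W) (t : ℝ) :
    (t • K).mapCLM (cReal (g : W →ₗ[ℂ] W)) = t • K.mapCLM (cReal (g : W →ₗ[ℂ] W)) := by
  apply ConvexBody.ext
  rw [ConvexBody.coe_smul, coe_mapCLM_cReal, coe_mapCLM_cReal, ConvexBody.coe_smul]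
  exact Set.image_smul_comm _ _ _ fun x => by
    rw [← Complex.coe_smul, ← Complex.coe_smul, map_smul]

theorem hSupp_mapCLM_precompDual (g : W →L[ℂ] W) (K : ConvexBody (W →L[ℂ] ℂ)) (u : W) :
    hSupp (K.mapCLM (precompDual g)) (fun ξ => (ξ u).re) = hSupp K (fun ξ => (ξ (g u)).re) :=
  congrArg sSup (Set.image_image _ _ _)

end SLContravariantFamilies

theorem cubic_coeff_eq_zero {p q r : ℝ}
    (h : ∀ t : ℝ, 0 < t → t ^ 1 * p + t ^ 2 * q + t ^ 3 * r = 0) : p = 0 ∧ q = 0 ∧ r = 0 := by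
  have h1 := h 1 one_pos
  have h2 := h 2 two_pos
  have h3 := h 3 three_pos
  refine ⟨?_, ?_, ?_⟩ <;> linarith

theorem quadratic_coeff_nonneg {p q r : ℝ} (h : ∀ t : ℝ, 0 < t → 0 ≤ p + t * (q + t * r)) :
    0 ≤ r := by
  by_contra! hr
  have hd : 0 ≤ (|p| + |q|) / -r := div_nonneg (by positivity) (neg_pos.2 hr).le
  have htr : (1 + (|p| + |q|) / -r) * r = r - |p| - |q| := by
    field_simp [hr.ne]
    ring
  have := h (1 + (|p| + |q|) / -r) (by positivity)
  rw [htr] at this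
  nlinarith [le_abs_self p, le_abs_self q, mul_nonneg hd (abs_nonneg p),
    mul_nonneg hd (sub_nonneg.2 (le_abs_self q)), mul_nonneg hd (neg_pos.2 hr).le]

/-- Lemma 3.2 of the paper. Let `W` be a 2-dimensional complex vector
space (with fixed basis `b` and Lebesgue measure `μ`) and let `Z : 𝒦(W) → 𝒦(W*)` be a
continuous, translation invariant, `SL(W,ℂ)`-contravariant Minkowski valuation given by
`h(Z K, u) = f₁(K,u) + f₂(K,u) + f₃(K,u)`, where `f₁(K,·) = h(D̃_M K, ·)` and
`f₃(K,·) = h(Π_N K, ·)` for some `M, N ∈ 𝒦(ℂ)`. Then `f₂(K, ·) ≡ 0` whenever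
`dim K ≤ 2`. -/
theorem degree_two_component_vanishes_dim_le_two
    {W : Type*} [NormedAddCommGroup W] [NormedSpace ℂ W] [FiniteDimensional ℂ W]
    (hW : Module.finrank ℂ W = 2) (b : Basis (Fin 2) ℂ W)
    [MeasurableSpace W] [BorelSpace W] (μ : Measure W) [μ.IsAddHaarMeasure]
    (Z : ConvexBody W → ConvexBody (W →L[ℂ] ℂ))
    (hZc : Continuous Z) (hZt : IsTranslationInvariant Z)
    (hZv : IsMinkowskiValuation Z) (hZg : IsSLContravariant Z)
    (f : ℕ → ConvexBody W → W → ℝ) (hf : McMullenProps f)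
    (M N : ConvexBody ℂ) (σ : Measure ℂ) (hσ : IsSurfaceAreaMeasure M σ)
    (hf1 : ∀ (K : ConvexBody W) (w : W),
      f 1 K w = ∫ α, hSupp (detBody b K w) (fun c => (c * (starRingEnd ℂ) α).re) ∂σ)
    (hf3 : ∀ (K : ConvexBody W) (w : W),
      f 3 K w = mixedVol μ ![K, K, K, dotBody N w])
    (hsum : ∀ (K : ConvexBody W) (u : W),
      hSupp (Z K) (fun ξ => (ξ u).re) = f 1 K u + f 2 K u + f 3 K u) :
    ∀ K : ConvexBody W, bodyDim K ≤ 2 → ∀ u : W, f 2 K u = 0 := by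
  obtain ⟨hcont, hval, htr, hbody, -, hvec⟩ := hf
  have hexp : ∀ (K : ConvexBody W) (u : W) (t : ℝ), 0 < t →
      hSupp (Z (t • K)) (fun ξ => (ξ u).re)
        = t ^ 1 * f 1 K u + t ^ 2 * f 2 K u + t ^ 3 * f 3 K u := fun K u t ht => by
    rw [hsum, hbody _ _ _ _ ht, hbody _ _ _ _ ht, hbody _ _ _ _ ht]
  have hmap : ∀ g : W ≃L[ℂ] W, LinearMap.det ((g : W →L[ℂ] W) : W →ₗ[ℂ] W) = 1 →
      ∀ K u, f 2 (K.mapCLM (cReal (g : W →ₗ[ℂ] W))) u = f 2 K (g.symm u) ∧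
        f 3 (K.mapCLM (cReal (g : W →ₗ[ℂ] W))) u = f 3 K (g.symm u) := by
    intro g hg K u
    have h := cubic_coeff_eq_zero
      (p := f 1 (K.mapCLM (cReal (g : W →ₗ[ℂ] W))) u - f 1 K (g.symm u))
      (q := f 2 (K.mapCLM (cReal (g : W →ₗ[ℂ] W))) u - f 2 K (g.symm u))
      (r := f 3 (K.mapCLM (cReal (g : W →ₗ[ℂ] W))) u - f 3 K (g.symm u)) (fun t ht => by
        have h1 := hexp (K.mapCLM (cReal (g : W →ₗ[ℂ] W))) u t ht
        have h2 := hexp K (g.symm u) t ht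
        rw [← mapCLM_smul, hZg g hg, hSupp_mapCLM_precompDual] at h1
        have h3 := h1.symm.trans h2
        linarith)
    exact ⟨sub_eq_zero.1 h.2.1, sub_eq_zero.1 h.2.2⟩
  have hF2 : IsContravariantFamily (f 2) 2 :=
    ⟨hcont 2, hval 2, fun K x u => htr 2 u K x, hbody 2, hvec 2, fun g hg K u => (hmap g hg K u).1⟩
  have hF3 : IsContravariantFamily (f 3) 3 :=
    ⟨hcont 3, hval 3, fun K x u => htr 3 u K x, hbody 3, hvec 3, fun g hg K u => (hmap g hg K u).2⟩
  intro K hK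
  have hsub : ∀ (u v : W) (t : ℝ), 0 < t →
      0 ≤ t * ((f 1 K u + f 1 K v - f 1 K (u + v)) + t * ((f 2 K u + f 2 K v - f 2 K (u + v))
        + t * (f 3 K u + f 3 K v - f 3 K (u + v)))) := by
    intro u v t ht
    have h := hSupp_add_le (Z (t • K)) u v
    rw [hexp K _ t ht, hexp K _ t ht, hexp K _ t ht] at h
    linarith
  have h3 : ∀ u, f 3 K u = 0 :=
    hF3.eq_zero_of_bodyDim_le_two (by norm_num) hW hK fun u v => sub_nonneg.1 <|
      quadratic_coeff_nonneg fun t ht => nonneg_of_mul_nonneg_right (hsub u v t ht) ht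
  refine hF2.eq_zero_of_bodyDim_le_two le_rfl hW hK fun u v => sub_nonneg.1 ?_
  refine quadratic_coeff_nonneg (p := 0) (q := f 1 K u + f 1 K v - f 1 K (u + v)) fun t ht => ?_
  simpa only [h3, add_zero, sub_zero, mul_zero, zero_add] using hsub u v t ht
end
end

section
/- Let W be a 2-dimensional complex vector space with a fixed basis and let Z : 𝒦(W) → 𝒦(W*) be a continuous, translation invariant, SL(W,ℂ)-contravariant Minkowski valuation given by h(ZK,u) = f_1(K,u) + f_2(K,u) + f_3(K,u), where f_1(K,·) = h(D̃_M K,·) and f_3(K,·) = h(Π_N K,·) for some M, N ∈ 𝒦(ℂ). Then f_2(K,·) ≡ 0 for every convex body K ∈ 𝒦(W) with dim K ≤ 3. -/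
open scoped Pointwise
open MeasureTheory Module

noncomputable section

/-- Nonempty, compact, convex sets. -/
def IsBody {E : Type*} [NormedAddCommGroup E] [NormedSpace ℝ E] (S : Set E) : Prop :=
  Convex ℝ S ∧ IsCompact S ∧ S.Nonempty

/-- Every point of either set is within distance `r` of the other set. -/
def SetsNear {E : Type*} [NormedAddCommGroup E] (r : ℝ) (K L : Set E) : Prop :=
  (∀ x ∈ K, ∃ y ∈ L, dist x y ≤ r) ∧ ∀ y ∈ L, ∃ x ∈ K, dist x y ≤ r

/-- A set functional which is a continuous valuation on convex bodies. -/
structure IsContValuation {E : Type*} [NormedAddCommGroup E] [NormedSpace ℝ E]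
    (χ : Set E → ℝ) : Prop where
  val : ∀ K L : Set E, IsBody K → IsBody L → Convex ℝ (K ∪ L) → (K ∩ L).Nonempty →
    χ (K ∪ L) + χ (K ∩ L) = χ K + χ L
  cont : ∀ K : Set E, IsBody K → ∀ ε > 0, ∃ δ > 0, ∀ L : Set E, IsBody L → SetsNear δ K L →
    |χ K - χ L| < ε

section Bodies

variable {E F : Type*} [NormedAddCommGroup E] [NormedSpace ℝ E]
  [NormedAddCommGroup F] [NormedSpace ℝ F]

theorem IsBody.singleton (x : E) : IsBody ({x} : Set E) :=
  ⟨convex_singleton x, isCompact_singleton, Set.singleton_nonempty x⟩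

theorem IsBody.image {S : Set E} (h : IsBody S) (T : E →L[ℝ] F) : IsBody (T '' S) :=
  ⟨h.1.linear_image (T : E →ₗ[ℝ] F), h.2.1.image T.continuous, h.2.2.image _⟩

theorem IsBody.translate {S : Set E} (h : IsBody S) (p : E) :
    IsBody ((fun x => p + x) '' S) :=
  ⟨h.1.translate p, h.2.1.image (continuous_const.add continuous_id), h.2.2.image _⟩

theorem IsBody.smul {S : Set E} (h : IsBody S) (r : ℝ) : IsBody (r • S) :=
  ⟨h.1.smul r, h.2.1.smul r, h.2.2.smul_set⟩

theorem IsBody.inter {S T : Set E} (hS : IsBody S) (hT : IsBody T) (h : (S ∩ T).Nonempty) :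
    IsBody (S ∩ T) :=
  ⟨hS.1.inter hT.1, hS.2.1.inter_right hT.2.1.isClosed, h⟩

theorem IsBody.union {S T : Set E} (hS : IsBody S) (hT : IsBody T) (h : Convex ℝ (S ∪ T)) :
    IsBody (S ∪ T) :=
  ⟨h, hS.2.1.union hT.2.1, hS.2.2.mono Set.subset_union_left⟩

theorem IsBody.segment (a b : E) : IsBody (segment ℝ a b) := by
  refine ⟨convex_segment a b, ?_, ⟨a, left_mem_segment ℝ a b⟩⟩
  rw [segment_eq_image]
  exact isCompact_Icc.image (by fun_prop)

theorem IsBody.join {S T : Set E} (hS : IsBody S) (hT : IsBody T) :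
    IsBody (convexJoin ℝ S T) := by
  refine ⟨hS.1.convexJoin hT.1, ?_, ?_⟩
  · have : convexJoin ℝ S T =
        (fun q : (E × E) × ℝ => (1 - q.2) • q.1.1 + q.2 • q.1.2) ''
          ((S ×ˢ T) ×ˢ Set.Icc (0 : ℝ) 1) := by
      ext x
      simp only [mem_convexJoin, segment_eq_image, Set.mem_image, Set.mem_prod, Prod.exists]
      constructor
      · rintro ⟨a, ha, b, hb, t, ht, rfl⟩
        exact ⟨a, b, t, ⟨⟨ha, hb⟩, ht⟩, rfl⟩
      · rintro ⟨a, b, t, ⟨⟨ha, hb⟩, ht⟩, rfl⟩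
        exact ⟨a, ha, b, hb, t, ht, rfl⟩
    rw [this]
    exact ((hS.2.1.prod hT.2.1).prod isCompact_Icc).image (by fun_prop)
  · obtain ⟨a, ha⟩ := hS.2.2
    exact ⟨a, subset_convexJoin_left hT.2.2 ha⟩

theorem IsContValuation.comap {χ : Set F → ℝ} (h : IsContValuation χ) (G : Set E → Set F)
    (hb : ∀ S, IsBody S → IsBody (G S))
    (hu : ∀ K L : Set E, IsBody K → IsBody L → Convex ℝ (K ∪ L) → (K ∩ L).Nonempty →
      G (K ∪ L) = G K ∪ G L ∧ G (K ∩ L) = G K ∩ G L)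
    (C : ℝ) (hC : 0 < C)
    (hn : ∀ δ K L, IsBody K → IsBody L → SetsNear δ K L → SetsNear (C * δ) (G K) (G L)) :
    IsContValuation fun S => χ (G S) := by
  refine ⟨fun K L hK hL hc hne => ?_, fun K hK ε hε => ?_⟩
  · obtain ⟨h1, h2⟩ := hu K L hK hL hc hne
    simp only [h1, h2]
    refine h.val _ _ (hb _ hK) (hb _ hL) ?_ ?_
    · rw [← h1]; exact (hb _ (hK.union hL hc)).1
    · rw [← h2]; exact (hb _ (hK.inter hL hne)).2.2
  · obtain ⟨δ, hδ, H⟩ := h.cont _ (hb _ hK) ε hε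
    refine ⟨δ / C, by positivity, fun L hL hKL => H _ (hb _ hL) ?_⟩
    have := hn _ _ _ hK hL hKL
    rwa [mul_div_cancel₀ _ hC.ne'] at this

theorem IsContValuation.comap_clm {χ : Set F → ℝ} (h : IsContValuation χ) (T : E →L[ℝ] F)
    (hT : Function.Injective T) : IsContValuation fun S => χ (T '' S) := by
  refine h.comap (fun S => T '' S) (fun S hS => hS.image T)
    (fun K L _ _ _ _ => ⟨Set.image_union _ _ _, Set.image_inter hT⟩) (‖T‖ + 1) (by positivity) ?_
  have key : ∀ δ (x y : E), dist x y ≤ δ → dist (T x) (T y) ≤ (‖T‖ + 1) * δ := fun δ x y hxy => by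
    have h0 : 0 ≤ δ := dist_nonneg.trans hxy
    have := T.dist_le_opNorm x y
    have h1 : ‖T‖ * dist x y ≤ ‖T‖ * δ := by gcongr
    linarith
  rintro δ K L - - ⟨h1, h2⟩
  constructor
  · rintro _ ⟨x, hx, rfl⟩
    obtain ⟨y, hy, hxy⟩ := h1 x hx
    exact ⟨T y, ⟨y, hy, rfl⟩, key _ _ _ hxy⟩
  · rintro _ ⟨x, hx, rfl⟩
    obtain ⟨y, hy, hxy⟩ := h2 x hx
    exact ⟨T y, ⟨y, hy, rfl⟩, key _ _ _ hxy⟩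

theorem exists_level_point {ℓ : E →L[ℝ] ℝ} {a b x : E} {t : ℝ} (hx : x ∈ segment ℝ a b)
    (ha : ℓ a ≤ t) (hb : t < ℓ b) :
    ∃ c ∈ segment ℝ a b, ℓ c = t ∧ (ℓ x ≤ t → x ∈ segment ℝ a c) ∧
      (t ≤ ℓ x → x ∈ segment ℝ c b) := by
  have hab : 0 < ℓ b - ℓ a := by linarith
  set θ := (t - ℓ a) / (ℓ b - ℓ a) with hθ
  have hθ0 : 0 ≤ θ := div_nonneg (by linarith) hab.le
  have hθ1 : θ < 1 := by rw [hθ, div_lt_one hab]; linarith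
  have hθt : θ * (ℓ b - ℓ a) = t - ℓ a := by rw [hθ]; field_simp
  rw [segment_eq_image] at hx
  obtain ⟨s, ⟨hs0, hs1⟩, rfl⟩ := hx
  have hℓ : ℓ ((1 - s) • a + s • b) = ℓ a + s * (ℓ b - ℓ a) := by
    simp only [map_add, map_smul, smul_eq_mul]; ring
  refine ⟨(1 - θ) • a + θ • b, ?_, ?_, fun h => ?_, fun h => ?_⟩
  · rw [segment_eq_image]; exact ⟨θ, ⟨hθ0, hθ1.le⟩, rfl⟩
  · simp only [map_add, map_smul, smul_eq_mul]; linarith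
  · rw [hℓ] at h
    have hsθ : s ≤ θ := by
      by_contra hcon
      push Not at hcon
      nlinarith
    rcases hθ0.eq_or_lt with h0 | h0
    · have : s = 0 := by linarith
      subst this
      simpa using left_mem_segment ℝ a _
    · rw [segment_eq_image]
      refine ⟨s / θ, ⟨by positivity, by rw [div_le_one h0]; exact hsθ⟩, ?_⟩
      have : s / θ * θ = s := by field_simp
      simp only [smul_add, smul_smul, this]
      rw [← add_assoc, ← add_smul]
      congr 2
      linear_combination (-1 : ℝ) * this
  · rw [hℓ] at h
    have hsθ : θ ≤ s := by
      by_contra hcon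
      push Not at hcon
      nlinarith
    have h1θ : 0 < 1 - θ := by linarith
    rw [segment_eq_image]
    have e : (s - θ) / (1 - θ) * (1 - θ) = s - θ := by field_simp
    refine ⟨(s - θ) / (1 - θ), ⟨div_nonneg (by linarith) h1θ.le, by
      rw [div_le_one h1θ]; linarith⟩, ?_⟩
    simp only [smul_add, smul_smul]
    rw [add_assoc, ← add_smul]
    congr 2
    · linear_combination (-1 : ℝ) * e
    · linear_combination e

/-- A continuous valuation vanishes once it vanishes on bodies of constant height and on convex
joins of two such bodies of different heights. -/
theorem IsContValuation.eq_zero_of_slabs {χ : Set E → ℝ} (h : IsContValuation χ)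
    (ℓ : E →L[ℝ] ℝ)
    (h0 : ∀ S t, IsBody S → (∀ x ∈ S, ℓ x = t) → χ S = 0)
    (h1 : ∀ S T a b, a < b → IsBody S → IsBody T → (∀ x ∈ S, ℓ x = a) → (∀ x ∈ T, ℓ x = b) →
      χ (convexJoin ℝ S T) = 0)
    (K : Set E) (hK : IsBody K) : χ K = 0 := by
  obtain ⟨p, hp, hpmin⟩ := hK.2.1.exists_isMinOn hK.2.2 ℓ.continuous.continuousOn
  obtain ⟨q, hq, hqmax⟩ := hK.2.1.exists_isMaxOn hK.2.2 ℓ.continuous.continuousOn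
  have hpm : ∀ x ∈ K, ℓ p ≤ ℓ x := fun x hx => hpmin hx
  have hqm : ∀ x ∈ K, ℓ x ≤ ℓ q := fun x hx => hqmax hx
  set α := ℓ p with hα
  set β := ℓ q with hβ
  rcases (hpm q hq).eq_or_lt with hαβ | hαβ
  · exact h0 K α hK fun x hx => le_antisymm (hαβ ▸ hqm x hx) (hpm x hx)
  have hd : 0 < β - α := by linarith
  have levels : ∀ t, α ≤ t → t ≤ β → IsBody (K ∩ {x | ℓ x = t}) := fun t h1 h2 => by
    refine ⟨hK.1.inter ((convex_singleton t).linear_preimage (ℓ : E →ₗ[ℝ] ℝ)),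
      hK.2.1.inter_right (isClosed_eq ℓ.continuous continuous_const), ?_⟩
    rcases h2.eq_or_lt with rfl | h2
    · exact ⟨q, hq, rfl⟩
    · obtain ⟨c, hc, hct, -⟩ := exists_level_point (ℓ := ℓ) (left_mem_segment ℝ p q) h1 h2
      exact ⟨c, hK.1.segment_subset hp hq hc, hct⟩
  have approx : ∀ m : ℕ, 0 < m → ∃ Q : Set E, IsBody Q ∧ χ Q = 0 ∧ Q ⊆ K ∧
      ∀ k : ℕ, k ≤ m → K ∩ {x | ℓ x = α + (β - α) * (k / m)} ⊆ Q := by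
    intro m hm
    have hm' : (0 : ℝ) < m := by exact_mod_cast hm
    have ht : ∀ k : ℕ, k ≤ m → α ≤ α + (β - α) * (k / m) ∧ α + (β - α) * (k / m) ≤ β := by
      intro k hk
      have a0 : (0 : ℝ) ≤ k / m := by positivity
      have a1 : (k / m : ℝ) ≤ 1 := by rw [div_le_one hm']; exact_mod_cast hk
      constructor <;> nlinarith
    suffices H : ∀ n : ℕ, n ≤ m → ∃ Q : Set E, IsBody Q ∧ χ Q = 0 ∧ Q ⊆ K ∧
        (∀ x ∈ Q, ℓ x ≤ α + (β - α) * (n / m)) ∧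
        ∀ k : ℕ, k ≤ n → K ∩ {x | ℓ x = α + (β - α) * (k / m)} ⊆ Q by
      obtain ⟨Q, a, b, c, -, d⟩ := H m le_rfl
      exact ⟨Q, a, b, c, d⟩
    intro n
    induction n with
    | zero =>
      intro _
      have := levels _ (ht 0 (Nat.zero_le _)).1 (ht 0 (Nat.zero_le _)).2
      refine ⟨_, this, h0 _ _ this fun x hx => hx.2, Set.inter_subset_left,
        fun x hx => hx.2.le, fun k hk => ?_⟩
      rw [Nat.le_zero.1 hk]
    | succ n ih =>
      intro hn
      obtain ⟨Q, hQ, hQ0, hQK, hQt, hQl⟩ := ih (by omega)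
      have hlt : α + (β - α) * (n / m) < α + (β - α) * ((n + 1 : ℕ) / m) := by
        have : (n / m : ℝ) < ((n + 1 : ℕ) / m : ℝ) := by
          push_cast; gcongr; linarith
        nlinarith
      have hP := levels _ (ht n (by omega)).1 (ht n (by omega)).2
      have hP' := levels _ (ht (n + 1) hn).1 (ht (n + 1) hn).2
      set u := α + (β - α) * (n / m) with hu
      set v := α + (β - α) * ((n + 1 : ℕ) / m) with hv
      set P := K ∩ {x | ℓ x = u} with hPdef
      set P' := K ∩ {x | ℓ x = v} with hP'def
      have hPQ : P ⊆ Q := hQl n le_rfl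
      have hJ : IsBody (convexJoin ℝ P P') := hP.join hP'
      have hJK : convexJoin ℝ P P' ⊆ K :=
        convexJoin_subset Set.inter_subset_left Set.inter_subset_left hK.1
      have hJt : ∀ x ∈ convexJoin ℝ P P', u ≤ ℓ x := by
        intro x hx
        have hsub : convexJoin ℝ P P' ⊆ {x | u ≤ ℓ x} :=
          convexJoin_subset (fun y hy => hy.2.ge) (fun y hy => hlt.le.trans hy.2.ge)
            (convex_halfSpace_ge (ℓ : E →ₗ[ℝ] ℝ).isLinear u)
        exact hsub hx
      have hU : Q ∪ convexJoin ℝ P P' = convexJoin ℝ Q P' := by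
        apply Set.Subset.antisymm
        · exact Set.union_subset (subset_convexJoin_left hP'.2.2) (convexJoin_mono_left hPQ)
        · intro x hx
          obtain ⟨a, ha, b, hb, hx⟩ := mem_convexJoin.1 hx
          obtain ⟨c, hc, hcu, hx1, hx2⟩ := exists_level_point (ℓ := ℓ) hx (hQt a ha)
            (hlt.trans_le hb.2.ge)
          have hcP : c ∈ P := ⟨hK.1.segment_subset (hQK ha) hb.1 hc, hcu⟩
          rcases le_total (ℓ x) u with hxu | hxu
          · exact Or.inl (hQ.1.segment_subset ha (hPQ hcP) (hx1 hxu))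
          · exact Or.inr (mem_convexJoin.2 ⟨c, hcP, b, hb, hx2 hxu⟩)
      have hI : Q ∩ convexJoin ℝ P P' = P := by
        apply Set.Subset.antisymm
        · rintro x ⟨hxQ, hxJ⟩
          exact ⟨hQK hxQ, le_antisymm (hQt x hxQ) (hJt x hxJ)⟩
        · exact Set.subset_inter hPQ (subset_convexJoin_left hP'.2.2)
      refine ⟨convexJoin ℝ Q P', hQ.join hP', ?_, ?_, ?_, ?_⟩
      · have := h.val Q (convexJoin ℝ P P') hQ hJ (by rw [hU]; exact (hQ.join hP').1)
          (by rw [hI]; exact hP.2.2)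
        rw [hU, hI, hQ0, h0 P u hP fun x hx => hx.2,
          h1 P P' u v hlt hP hP' (fun x hx => hx.2) fun x hx => hx.2] at this
        linarith
      · exact convexJoin_subset hQK Set.inter_subset_left hK.1
      · intro x hx
        have hsub : convexJoin ℝ Q P' ⊆ {x | ℓ x ≤ v} :=
          convexJoin_subset (fun y hy => (hQt y hy).trans hlt.le) (fun y hy => hy.2.le)
            (convex_halfSpace_le (ℓ : E →ₗ[ℝ] ℝ).isLinear v)
        exact hsub hx
      · intro k hk
        rcases Nat.lt_or_ge n k with hnk | hnk
        · obtain rfl : k = n + 1 := by omega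
          exact subset_convexJoin_right hQ.2.2
        · exact (hQl k hnk).trans (subset_convexJoin_left hP'.2.2)
  by_contra hne
  obtain ⟨δ, hδ, H⟩ := h.cont K hK |χ K| (abs_pos.2 hne)
  obtain ⟨D, hD⟩ := hK.2.1.isBounded.exists_norm_le
  have hD0 : 0 ≤ D := (norm_nonneg p).trans (hD p hp)
  obtain ⟨m, hm⟩ := exists_nat_gt (4 * D / δ)
  have hm' : (0 : ℝ) < m := lt_of_le_of_lt (by positivity) hm
  have hm0 : 0 < m := by exact_mod_cast hm'
  obtain ⟨Q, hQ, hQ0, hQK, hQl⟩ := approx m hm0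
  have near : SetsNear δ K Q := by
    refine ⟨fun x hx => ?_, fun y hy => ⟨y, hQK hy, by simpa using hδ.le⟩⟩
    have move : ∀ r ∈ K, ∀ s : ℝ, 0 ≤ s → s ≤ 2 / m → dist x ((1 - s) • x + s • r) ≤ δ := by
      intro r hr s hs0 hs
      rw [dist_eq_norm, show x - ((1 - s) • x + s • r) = s • (x - r) by module, norm_smul,
        Real.norm_eq_abs, abs_of_nonneg hs0]
      have h2 : ‖x - r‖ ≤ 2 * D := (norm_sub_le _ _).trans (by linarith [hD x hx, hD r hr])
      have h3 : s * ‖x - r‖ ≤ 2 / m * (2 * D) := by gcongr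
      refine h3.trans ?_
      rw [div_lt_iff₀ hδ] at hm
      rw [div_mul_eq_mul_div, div_le_iff₀ hm']
      linarith
    have hxα := hpm x hx
    have hxβ := hqm x hx
    set y := (ℓ x - α) / (β - α) * m with hy
    have hyx : ℓ x = α + (β - α) * (y / m) := by rw [hy]; field_simp; ring
    have hy0 : 0 ≤ y := by
      rw [hy]; exact mul_nonneg (div_nonneg (by linarith) hd.le) hm'.le
    have hym : y ≤ m := by
      rw [hy]
      have : (ℓ x - α) / (β - α) ≤ 1 := by rw [div_le_one hd]; linarith
      nlinarith
    have hline : ∀ (r : E) (s : ℝ), ℓ ((1 - s) • x + s • r) = ℓ x + s * (ℓ r - ℓ x) := by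
      intro r s
      simp only [map_add, map_smul, smul_eq_mul]; ring
    rcases le_total (2 * y) m with hhalf | hhalf
    · have hk := Nat.le_ceil y
      have hk1 := Nat.ceil_lt_add_one hy0
      have hkm : ⌈y⌉₊ ≤ m := Nat.ceil_le.2 hym
      set k := ⌈y⌉₊
      have hmy : 0 < m - y := by linarith
      set s := (k - y) / (m - y) with hs
      have hs0 : 0 ≤ s := div_nonneg (by linarith) hmy.le
      have hs2 : s ≤ 2 / m := by
        rw [hs, div_le_div_iff₀ hmy hm']
        nlinarith
      have hs1 : s ≤ 1 := by
        rw [hs, div_le_one hmy]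
        have : (k : ℝ) ≤ m := by exact_mod_cast hkm
        linarith
      refine ⟨(1 - s) • x + s • q, hQl k hkm ⟨?_, ?_⟩, move q hq s hs0 hs2⟩
      · exact hK.1 hx hq (by linarith) hs0 (by ring)
      · change ℓ _ = _
        rw [hline, ← hβ, hyx]
        have e : s * (m - y) = k - y := by rw [hs]; field_simp
        field_simp
        linear_combination (β - α) * e
    · have hk := Nat.floor_le hy0
      have hk1 := Nat.lt_floor_add_one y
      have hkm : ⌊y⌋₊ ≤ m := by
        have : (⌊y⌋₊ : ℝ) ≤ m := hk.trans hym
        exact_mod_cast this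
      set k := ⌊y⌋₊
      have hmy : 0 < y := by linarith
      set s := (y - k) / y with hs
      have hs0 : 0 ≤ s := div_nonneg (by linarith) hmy.le
      have hs2 : s ≤ 2 / m := by
        rw [hs, div_le_div_iff₀ hmy hm']
        nlinarith
      have hs1 : s ≤ 1 := by
        rw [hs, div_le_one hmy]
        have : (0 : ℝ) ≤ k := by positivity
        linarith
      refine ⟨(1 - s) • x + s • p, hQl k hkm ⟨?_, ?_⟩, move p hp s hs0 hs2⟩
      · exact hK.1 hx hp (by linarith) hs0 (by ring)
      · change ℓ _ = _
        rw [hline, ← hα, hyx]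
        have e : s * y = y - k := by rw [hs]; field_simp
        field_simp
        linear_combination -(β - α) * e
  have := H Q hQ near
  rw [hQ0, sub_zero] at this
  exact lt_irrefl _ this

end Bodies

section PlanarFamilies

theorem IsContValuation.cut {E : Type*} [NormedAddCommGroup E] [NormedSpace ℝ E]
    {χ : Set E → ℝ} (h : IsContValuation χ) {K A B C : Set E} (hK : Convex ℝ K)
    (hA : IsBody A) (hB : IsBody B) (hU : A ∪ B = K) (hI : A ∩ B = C) (hC : C.Nonempty) :
    χ K + χ C = χ A + χ B := by
  subst hU hI
  exact h.val A B hA hB hK hC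

/-- The standard triangle in the plane. -/
def stdTriangle : Set (ℝ × ℝ) := {z | 0 ≤ z.1 ∧ 0 ≤ z.2 ∧ z.1 + z.2 ≤ 1}

theorem IsBody.rect {a b c d : ℝ} (h1 : a ≤ b) (h2 : c ≤ d) :
    IsBody (Set.Icc a b ×ˢ Set.Icc c d) :=
  ⟨(convex_Icc a b).prod (convex_Icc c d), isCompact_Icc.prod isCompact_Icc,
    (Set.nonempty_Icc.2 h1).prod (Set.nonempty_Icc.2 h2)⟩

theorem IsBody.of_subset {E : Type*} [NormedAddCommGroup E] [NormedSpace ℝ E] {S T : Set E}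
    (hT : IsBody T) (h1 : Convex ℝ S) (h2 : IsClosed S) (h3 : S ⊆ T) (h4 : S.Nonempty) :
    IsBody S :=
  ⟨h1, hT.2.1.of_isClosed_subset h2 h3, h4⟩

theorem convex_triangle (a b c : ℝ) :
    Convex ℝ {z : ℝ × ℝ | a ≤ z.1 ∧ b ≤ z.2 ∧ z.1 + z.2 ≤ c} := by
  rintro ⟨x, y⟩ ⟨h1, h2, h3⟩ ⟨x', y'⟩ ⟨h1', h2', h3'⟩ s t hs ht hst
  simp only [Set.mem_ofPred_eq, Prod.fst_add, Prod.snd_add, Prod.smul_fst, Prod.smul_snd,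
    smul_eq_mul] at *
  obtain rfl : t = 1 - s := by linarith
  refine ⟨?_, ?_, ?_⟩ <;> nlinarith

theorem isBody_stdTriangle : IsBody stdTriangle := by
  refine (IsBody.rect (a := 0) (b := 1) (c := 0) (d := 1) zero_le_one zero_le_one).of_subset
    (convex_triangle 0 0 1) ?_ ?_ ⟨(0, 0), by simp [stdTriangle]⟩
  · exact (isClosed_le continuous_const continuous_fst).inter
      ((isClosed_le continuous_const continuous_snd).inter
        (isClosed_le (continuous_fst.add continuous_snd) continuous_const))
  · rintro ⟨x, y⟩ ⟨h1, h2, h3⟩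
    simp only [Set.mem_prod, Set.mem_Icc] at *
    refine ⟨⟨?_, ?_⟩, ?_, ?_⟩ <;> linarith

/-- A translation invariant family of continuous valuations in which no simultaneous scaling
behaviour of degree `0`, `1` or `2` under doubling is possible, except for zero. -/
structure NoIntegralScaling {ι : Type*} (χ : ι → Set (ℝ × ℝ) → ℝ) : Prop where
  val : ∀ i, IsContValuation (χ i)
  trans : ∀ i x S, IsBody S → χ i ((fun y => x + y) '' S) = χ i S
  rule : ∀ S, IsBody S → ∀ μ : ℝ, μ = 1 ∨ μ = 2 ∨ μ = 4 →
    (∀ i, χ i ((2 : ℝ) • S) = μ * χ i S) → ∀ i, χ i S = 0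

/-- The linear map sending the standard basis of the plane to `p`, `q`. -/
def planeMap (p q : ℝ × ℝ) : ℝ × ℝ →L[ℝ] ℝ × ℝ :=
  (ContinuousLinearMap.fst ℝ ℝ ℝ).smulRight p + (ContinuousLinearMap.snd ℝ ℝ ℝ).smulRight q

theorem planeMap_apply (p q z : ℝ × ℝ) : planeMap p q z = z.1 • p + z.2 • q := rfl

theorem planeMap_injective {p q : ℝ × ℝ} (h : p.1 * q.2 - p.2 * q.1 ≠ 0) :
    Function.Injective (planeMap p q) := by
  rw [injective_iff_map_eq_zero]
  rintro ⟨x, y⟩ hz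
  simp only [planeMap_apply, Prod.ext_iff, Prod.fst_add, Prod.snd_add, Prod.smul_fst,
    Prod.smul_snd, smul_eq_mul, Prod.fst_zero, Prod.snd_zero] at *
  obtain ⟨h1, h2⟩ := hz
  constructor
  · refine (mul_eq_zero.1 (?_ : x * (p.1 * q.2 - p.2 * q.1) = 0)).resolve_right h
    linear_combination q.2 * h1 - q.1 * h2
  · refine (mul_eq_zero.1 (?_ : y * (p.1 * q.2 - p.2 * q.1) = 0)).resolve_right h
    linear_combination p.1 * h2 - p.2 * h1

namespace NoIntegralScaling

variable {ι : Type*} {χ : ι → Set (ℝ × ℝ) → ℝ}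

theorem comap (h : NoIntegralScaling χ) (T : ℝ × ℝ →L[ℝ] ℝ × ℝ) (hT : Function.Injective T) :
    NoIntegralScaling fun i S => χ i (T '' S) where
  val i := (h.val i).comap_clm T hT
  trans i x S hS := by
    rw [← h.trans i (T x) _ (hS.image T), Set.image_image, Set.image_image]
    simp only [map_add]
  rule S hS μ hμ hd := by
    refine h.rule _ (hS.image T) μ hμ fun i => ?_
    rw [← hd i]
    congr 1
    exact (Set.image_smul_comm T (2 : ℝ) S fun y => map_smul T 2 y).symm

theorem singleton (h : NoIntegralScaling χ) (i : ι) (v : ℝ × ℝ) : χ i {v} = 0 := by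
  have h0 : χ i {0} = 0 := by
    refine h.rule {0} (IsBody.singleton 0) 1 (Or.inl rfl) (fun i => ?_) i
    simp
  rw [← h0, ← h.trans i v _ (IsBody.singleton 0)]
  simp

theorem horizontal (h : NoIntegralScaling χ) (i : ι) :
    χ i (Set.Icc 0 1 ×ˢ Set.Icc 0 0) = 0 := by
  have hb : IsBody (Set.Icc (0 : ℝ) 1 ×ˢ Set.Icc (0 : ℝ) 0) := IsBody.rect zero_le_one le_rfl
  refine h.rule _ hb 2 (by simp) (fun i => ?_) i
  have := (h.val i).cut (K := (2 : ℝ) • (Set.Icc (0 : ℝ) 1 ×ˢ Set.Icc (0 : ℝ) 0)) (C := {(1, 0)})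
    (hb.smul 2).1 hb (hb.translate (1, 0)) ?_ ?_ (Set.singleton_nonempty _)
  · rw [h.trans i _ _ hb, h.singleton] at this
    linarith
  · ext ⟨x, y⟩
    simp only [Set.mem_union, Set.mem_prod, Set.mem_Icc, Set.image_add_left, Set.mem_preimage,
      Set.mem_smul_set_iff_inv_smul_mem₀ (two_ne_zero : (2 : ℝ) ≠ 0), Prod.smul_mk, smul_eq_mul,
      Prod.neg_mk, Prod.mk_add_mk]
    constructor
    · rintro (h | h) <;> refine ⟨⟨?_, ?_⟩, ?_, ?_⟩ <;> linarith [h.1.1, h.1.2, h.2.1, h.2.2]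
    · rintro h
      rcases le_total x 1 with h' | h'
      · left; refine ⟨⟨?_, ?_⟩, ?_, ?_⟩ <;> linarith [h.1.1, h.1.2, h.2.1, h.2.2]
      · right; refine ⟨⟨?_, ?_⟩, ?_, ?_⟩ <;> linarith [h.1.1, h.1.2, h.2.1, h.2.2]
  · ext ⟨x, y⟩
    simp only [Set.mem_inter_iff, Set.mem_prod, Set.mem_Icc, Set.image_add_left,
      Set.mem_preimage, Prod.neg_mk, Prod.mk_add_mk, Set.mem_singleton_iff, Prod.mk.injEq]
    constructor
    · rintro ⟨h, h'⟩
      constructor <;> linarith [h.1.1, h.1.2, h.2.1, h.2.2, h'.1.1, h'.1.2, h'.2.1, h'.2.2]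
    · rintro ⟨rfl, rfl⟩
      norm_num

theorem segment (h : NoIntegralScaling χ) (i : ι) (v q : ℝ × ℝ) :
    χ i (segment ℝ v (v + q)) = 0 := by
  rcases eq_or_ne q 0 with rfl | hq
  · simpa using h.singleton i v
  have hinj : Function.Injective (planeMap q (-q.2, q.1)) := by
    apply planeMap_injective
    intro h0
    apply hq
    simp only at h0
    have h1 : q.1 = 0 := by nlinarith [sq_nonneg q.1, sq_nonneg q.2]
    have h2 : q.2 = 0 := by nlinarith [sq_nonneg q.1, sq_nonneg q.2]
    exact Prod.ext h1 h2
  rw [← (h.comap _ hinj).horizontal i, ← h.trans i v _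
    (IsBody.image (IsBody.rect zero_le_one le_rfl) _), segment_eq_image']
  congr 1
  ext z
  simp only [Set.mem_image, Set.mem_prod, Set.Icc_self, Set.mem_singleton_iff, Prod.exists,
    planeMap_apply, add_sub_cancel_left]
  constructor
  · rintro ⟨t, ht, rfl⟩
    exact ⟨_, _, ⟨t, 0, ⟨ht, rfl⟩, rfl⟩, by simp; rfl⟩
  · rintro ⟨_, _, ⟨t, s, ⟨ht, rfl⟩, e⟩, rfl⟩
    refine ⟨t, ht, ?_⟩
    rw [← e]; simp

theorem segment' (h : NoIntegralScaling χ) (i : ι) (v w : ℝ × ℝ) :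
    χ i (_root_.segment ℝ v w) = 0 := by
  simpa using h.segment i v (w - v)

theorem thin_rect (h : NoIntegralScaling χ) (i : ι) {a b c d : ℝ} (h1 : a ≤ b) (h2 : c ≤ d)
    (h3 : a = b ∨ c = d) : χ i (Set.Icc a b ×ˢ Set.Icc c d) = 0 := by
  rw [← h.segment' i (a, c) (b, d)]
  congr 1
  rcases h3 with rfl | rfl
  · rw [← Prod.image_mk_segment_right, segment_eq_Icc h2]
    ext ⟨x, y⟩
    simp only [Set.Icc_self, Set.mem_prod, Set.mem_singleton_iff, Set.mem_image, Prod.mk.injEq]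
    grind
  · rw [← Prod.image_mk_segment_left, segment_eq_Icc h1]
    ext ⟨x, y⟩
    simp only [Set.Icc_self, Set.mem_prod, Set.mem_singleton_iff, Set.mem_image, Prod.mk.injEq]
    grind

theorem square (h : NoIntegralScaling χ) (i : ι) :
    χ i (Set.Icc 0 1 ×ˢ Set.Icc 0 1) = 0 := by
  have hb : IsBody (Set.Icc (0 : ℝ) 1 ×ˢ Set.Icc (0 : ℝ) 1) :=
    IsBody.rect zero_le_one zero_le_one
  have hb2 : IsBody (Set.Icc (0 : ℝ) 1 ×ˢ Set.Icc (0 : ℝ) 2) :=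
    IsBody.rect zero_le_one zero_le_two
  refine h.rule _ hb 4 (by simp) (fun i => ?_) i
  have e1 := (h.val i).cut (K := (2 : ℝ) • (Set.Icc (0 : ℝ) 1 ×ˢ Set.Icc (0 : ℝ) 1))
    (C := Set.Icc 1 1 ×ˢ Set.Icc 0 2)
    (hb.smul 2).1 hb2 (hb2.translate (1, 0)) ?_ ?_ (IsBody.rect le_rfl zero_le_two).2.2
  · have e2 := (h.val i).cut (C := Set.Icc 0 1 ×ˢ Set.Icc 1 1)
      hb2.1 hb (hb.translate (0, 1)) ?_ ?_ (IsBody.rect zero_le_one le_rfl).2.2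
    · rw [h.trans i _ _ hb, h.thin_rect i zero_le_one le_rfl (Or.inr rfl)] at e2
      rw [h.trans i _ _ hb2, h.thin_rect i le_rfl zero_le_two (Or.inl rfl)] at e1
      linarith
    · ext ⟨x, y⟩
      simp only [Set.mem_union, Set.mem_prod, Set.mem_Icc, Set.image_add_left, Set.mem_preimage,
        Prod.neg_mk, Prod.mk_add_mk]
      constructor
      · rintro (h | h) <;> refine ⟨⟨?_, ?_⟩, ?_, ?_⟩ <;> linarith [h.1.1, h.1.2, h.2.1, h.2.2]
      · rintro h
        rcases le_total y 1 with h' | h'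
        · left; refine ⟨⟨?_, ?_⟩, ?_, ?_⟩ <;> linarith [h.1.1, h.1.2, h.2.1, h.2.2]
        · right; refine ⟨⟨?_, ?_⟩, ?_, ?_⟩ <;> linarith [h.1.1, h.1.2, h.2.1, h.2.2]
    · ext ⟨x, y⟩
      simp only [Set.mem_inter_iff, Set.mem_prod, Set.mem_Icc, Set.image_add_left,
        Set.mem_preimage, Prod.neg_mk, Prod.mk_add_mk]
      constructor
      · rintro ⟨h, h'⟩
        refine ⟨⟨?_, ?_⟩, ?_, ?_⟩ <;>
          linarith [h.1.1, h.1.2, h.2.1, h.2.2, h'.1.1, h'.1.2, h'.2.1, h'.2.2]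
      · rintro h
        refine ⟨⟨⟨?_, ?_⟩, ?_, ?_⟩, ⟨?_, ?_⟩, ?_, ?_⟩ <;> linarith [h.1.1, h.1.2, h.2.1, h.2.2]
  · ext ⟨x, y⟩
    simp only [Set.mem_union, Set.mem_prod, Set.mem_Icc, Set.image_add_left, Set.mem_preimage,
      Set.mem_smul_set_iff_inv_smul_mem₀ (two_ne_zero : (2 : ℝ) ≠ 0), Prod.smul_mk, smul_eq_mul,
      Prod.neg_mk, Prod.mk_add_mk]
    constructor
    · rintro (h | h) <;> refine ⟨⟨?_, ?_⟩, ?_, ?_⟩ <;> linarith [h.1.1, h.1.2, h.2.1, h.2.2]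
    · rintro h
      rcases le_total x 1 with h' | h'
      · left; refine ⟨⟨?_, ?_⟩, ?_, ?_⟩ <;> linarith [h.1.1, h.1.2, h.2.1, h.2.2]
      · right; refine ⟨⟨?_, ?_⟩, ?_, ?_⟩ <;> linarith [h.1.1, h.1.2, h.2.1, h.2.2]
  · ext ⟨x, y⟩
    simp only [Set.mem_inter_iff, Set.mem_prod, Set.mem_Icc, Set.image_add_left,
      Set.mem_preimage, Prod.neg_mk, Prod.mk_add_mk]
    constructor
    · rintro ⟨h, h'⟩
      refine ⟨⟨?_, ?_⟩, ?_, ?_⟩ <;>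
        linarith [h.1.1, h.1.2, h.2.1, h.2.2, h'.1.1, h'.1.2, h'.2.1, h'.2.2]
    · rintro h
      refine ⟨⟨⟨?_, ?_⟩, ?_, ?_⟩, ⟨?_, ?_⟩, ?_, ?_⟩ <;> linarith [h.1.1, h.1.2, h.2.1, h.2.2]

theorem triangle (h : NoIntegralScaling χ) (i : ι) : χ i stdTriangle = 0 := by
  have hb := isBody_stdTriangle
  have hb2 := hb.smul 2
  have hs : IsBody (Set.Icc (0 : ℝ) 1 ×ˢ Set.Icc (0 : ℝ) 1) :=
    IsBody.rect zero_le_one zero_le_one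
  refine h.rule _ hb 2 (by simp) (fun i => ?_) i
  have e0 : (2 : ℝ) • stdTriangle = {z | 0 ≤ z.1 ∧ 0 ≤ z.2 ∧ z.1 + z.2 ≤ 2} := by
    ext ⟨x, y⟩
    simp only [stdTriangle, Set.mem_smul_set_iff_inv_smul_mem₀ (two_ne_zero : (2 : ℝ) ≠ 0),
      Prod.smul_mk, smul_eq_mul, Set.mem_ofPred_eq]
    constructor <;> rintro ⟨h1, h2, h3⟩ <;> refine ⟨?_, ?_, ?_⟩ <;> linarith
  have hM : Set.Icc (0 : ℝ) 1 ×ˢ Set.Icc (0 : ℝ) 1 ∪ (fun y => (0, 1) + y) '' stdTriangle =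
      (2 : ℝ) • stdTriangle ∩ {z | z.1 ≤ 1} := by
    rw [e0]
    ext ⟨x, y⟩
    simp only [Set.mem_union, Set.mem_prod, Set.mem_Icc, Set.image_add_left, Set.mem_preimage,
      Prod.neg_mk, Prod.mk_add_mk, stdTriangle, Set.mem_inter_iff, Set.mem_ofPred_eq]
    constructor
    · rintro (h | h)
      · refine ⟨⟨?_, ?_, ?_⟩, ?_⟩ <;> linarith [h.1.1, h.1.2, h.2.1, h.2.2]
      · refine ⟨⟨?_, ?_, ?_⟩, ?_⟩ <;> linarith [h.1, h.2.1, h.2.2]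
    · rintro h
      rcases le_total y 1 with h' | h'
      · left; refine ⟨⟨?_, ?_⟩, ?_, ?_⟩ <;> linarith [h.1.1, h.1.2.1, h.1.2.2, h.2]
      · right; refine ⟨?_, ?_, ?_⟩ <;> linarith [h.1.1, h.1.2.1, h.1.2.2, h.2]
  have hMb : IsBody ((2 : ℝ) • stdTriangle ∩ {z | z.1 ≤ 1}) := by
    refine hb2.of_subset (hb2.1.inter
      (convex_halfSpace_le (ContinuousLinearMap.fst ℝ ℝ ℝ : ℝ × ℝ →ₗ[ℝ] ℝ).isLinear 1))
      (hb2.2.1.isClosed.inter (isClosed_le continuous_fst continuous_const))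
      Set.inter_subset_left ?_
    rw [← hM]
    exact hs.2.2.mono Set.subset_union_left
  have e1 := (h.val i).cut (K := (2 : ℝ) • stdTriangle) (C := Set.Icc 1 1 ×ˢ Set.Icc 0 1)
    hb2.1 hMb (hb.translate (1, 0)) ?_ ?_ (IsBody.rect le_rfl zero_le_one).2.2
  · have e2 := (h.val i).cut (C := Set.Icc 0 1 ×ˢ Set.Icc 1 1) hMb.1 hs (hb.translate (0, 1)) hM
      ?_ (IsBody.rect zero_le_one le_rfl).2.2
    · rw [h.trans i _ _ hb, h.thin_rect i zero_le_one le_rfl (Or.inr rfl), h.square] at e2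
      rw [h.trans i _ _ hb, h.thin_rect i le_rfl zero_le_one (Or.inl rfl)] at e1
      linarith
    · ext ⟨x, y⟩
      simp only [Set.mem_inter_iff, Set.mem_prod, Set.mem_Icc, Set.image_add_left,
        Set.mem_preimage, Prod.neg_mk, Prod.mk_add_mk, stdTriangle, Set.mem_ofPred_eq]
      constructor
      · rintro ⟨h, h'⟩
        refine ⟨⟨?_, ?_⟩, ?_, ?_⟩ <;>
          linarith [h.1.1, h.1.2, h.2.1, h.2.2, h'.1, h'.2.1, h'.2.2]
      · rintro h
        refine ⟨⟨⟨?_, ?_⟩, ?_, ?_⟩, ?_, ?_, ?_⟩ <;> linarith [h.1.1, h.1.2, h.2.1, h.2.2]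
  · rw [e0]
    ext ⟨x, y⟩
    simp only [Set.mem_union, Set.image_add_left, Set.mem_preimage, Set.mem_inter_iff,
      Prod.neg_mk, Prod.mk_add_mk, stdTriangle, Set.mem_ofPred_eq]
    constructor
    · rintro (h | h)
      · exact h.1
      · refine ⟨?_, ?_, ?_⟩ <;> linarith [h.1, h.2.1, h.2.2]
    · rintro h
      rcases le_total x 1 with h' | h'
      · exact Or.inl ⟨h, h'⟩
      · right; refine ⟨?_, ?_, ?_⟩ <;> linarith [h.1, h.2.1, h.2.2]
  · rw [e0]
    ext ⟨x, y⟩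
    simp only [Set.mem_inter_iff, Set.mem_prod, Set.mem_Icc, Set.image_add_left,
      Set.mem_preimage, Prod.neg_mk, Prod.mk_add_mk, stdTriangle, Set.mem_ofPred_eq]
    constructor
    · rintro ⟨h, h'⟩
      refine ⟨⟨?_, ?_⟩, ?_, ?_⟩ <;>
        linarith [h.1.1, h.1.2.1, h.1.2.2, h.2, h'.1, h'.2.1, h'.2.2]
    · rintro h
      refine ⟨⟨⟨?_, ?_, ?_⟩, ?_⟩, ?_, ?_, ?_⟩ <;> linarith [h.1.1, h.1.2, h.2.1, h.2.2]

end NoIntegralScaling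

end PlanarFamilies

section PlanarVanishing

theorem exists_eq_interval {S : Set (ℝ × ℝ)} {t : ℝ} (hS : IsBody S) (ht : ∀ x ∈ S, x.2 = t) :
    ∃ c d : ℝ, c ≤ d ∧ S = (fun x => (x, t)) '' Set.Icc c d := by
  obtain ⟨p, hp, hpmin⟩ := hS.2.1.exists_isMinOn hS.2.2 continuous_fst.continuousOn
  obtain ⟨q, hq, hqmax⟩ := hS.2.1.exists_isMaxOn hS.2.2 continuous_fst.continuousOn
  have hpt : (p.1, t) = p := Prod.ext rfl (ht p hp).symm
  have hqt : (q.1, t) = q := Prod.ext rfl (ht q hq).symm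
  have hpq : p.1 ≤ q.1 := hpmin hq
  refine ⟨p.1, q.1, hpq, Set.Subset.antisymm (fun x hx => ?_) ?_⟩
  · exact ⟨x.1, ⟨hpmin hx, hqmax hx⟩, Prod.ext rfl (ht x hx).symm⟩
  · rw [← segment_eq_Icc hpq, Prod.image_mk_segment_left, hpt, hqt]
    exact hS.1.segment_subset hp hq

namespace NoIntegralScaling

variable {ι : Type*} {χ : ι → Set (ℝ × ℝ) → ℝ}

theorem flat_triangle (h : NoIntegralScaling χ) (i : ι) (v q : ℝ × ℝ) (e : ℝ) (hq : q.2 ≠ 0) :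
    χ i ((fun x => v + x) '' (planeMap (e, 0) q '' stdTriangle)) = 0 := by
  rw [h.trans i _ _ (isBody_stdTriangle.image _)]
  rcases eq_or_ne e 0 with rfl | he
  · refine Eq.trans ?_ (h.segment i 0 q)
    congr 1
    ext z
    simp only [zero_add, segment_eq_image', Set.mem_image, planeMap_apply, stdTriangle,
      Set.mem_ofPred_eq, Prod.exists]
    constructor
    · rintro ⟨x, y, ⟨h1, h2, h3⟩, rfl⟩
      exact ⟨y, ⟨h2, by linarith⟩, by ext <;> simp⟩
    · rintro ⟨y, ⟨h1, h2⟩, rfl⟩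
      exact ⟨0, y, ⟨le_rfl, h1, by linarith⟩, by ext <;> simp⟩
  · exact (h.comap _ (planeMap_injective (by simpa using ⟨he, hq⟩))).triangle i

theorem eq_zero (h : NoIntegralScaling χ) (i : ι) (K : Set (ℝ × ℝ)) (hK : IsBody K) :
    χ i K = 0 := by
  refine (h.val i).eq_zero_of_slabs (ContinuousLinearMap.snd ℝ ℝ ℝ) ?_ ?_ K hK
  · intro S t hS ht
    obtain ⟨c, d, hcd, rfl⟩ := exists_eq_interval hS ht
    rw [← segment_eq_Icc hcd, Prod.image_mk_segment_left, h.segment']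
  · intro S T a b hab hS hT ha hb
    have hJ := hS.join hT
    obtain ⟨c₀, d₀, hcd₀, rfl⟩ := exists_eq_interval hS ha
    obtain ⟨c₁, d₁, hcd₁, rfl⟩ := exists_eq_interval hT hb
    have hba : b - a ≠ 0 := by linarith
    have hab' : a - b ≠ 0 := by linarith
    have memA : ∀ x y : ℝ, (x, y) ∈ (fun z => ((c₀, a) : ℝ × ℝ) + z) ''
        (planeMap (d₀ - c₀, 0) (d₁ - c₀, b - a) '' stdTriangle) ↔
        ∃ s, 0 ≤ s ∧ s ≤ 1 ∧ y = a + s * (b - a) ∧ c₀ + s * (d₁ - c₀) ≤ x ∧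
          x ≤ d₀ + s * (d₁ - d₀) := by
      intro x y
      simp only [Set.mem_image, planeMap_apply, stdTriangle, Set.mem_ofPred_eq, Prod.exists,
        Prod.smul_mk, smul_eq_mul, Prod.mk_add_mk, Prod.mk.injEq]
      constructor
      · rintro ⟨_, _, ⟨r, s, ⟨h1, h2, h3⟩, rfl, rfl⟩, rfl, rfl⟩
        refine ⟨s, h2, by linarith, by ring, ?_, ?_⟩ <;> nlinarith
      · rintro ⟨s, hs0, hs1, rfl, h1, h2⟩
        rcases hcd₀.eq_or_lt with rfl | hlt
        · exact ⟨_, _, ⟨0, s, ⟨le_rfl, hs0, by linarith⟩, rfl, rfl⟩, by linarith, by ring⟩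
        · have hpos : 0 < d₀ - c₀ := by linarith
          refine ⟨_, _, ⟨(x - (c₀ + s * (d₁ - c₀))) / (d₀ - c₀), s,
            ⟨div_nonneg (by linarith) hpos.le, hs0, ?_⟩, rfl, rfl⟩, ?_, by ring⟩
          · have : (x - (c₀ + s * (d₁ - c₀))) / (d₀ - c₀) ≤ 1 - s := by
              rw [div_le_iff₀ hpos]; linarith
            linarith
          · field_simp; ring
    have memB : ∀ x y : ℝ, (x, y) ∈ (fun z => ((d₁, b) : ℝ × ℝ) + z) ''
        (planeMap (c₁ - d₁, 0) (c₀ - d₁, a - b) '' stdTriangle) ↔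
        ∃ s, 0 ≤ s ∧ s ≤ 1 ∧ y = a + s * (b - a) ∧ c₀ + s * (c₁ - c₀) ≤ x ∧
          x ≤ c₀ + s * (d₁ - c₀) := by
      intro x y
      simp only [Set.mem_image, planeMap_apply, stdTriangle, Set.mem_ofPred_eq, Prod.exists,
        Prod.smul_mk, smul_eq_mul, Prod.mk_add_mk, Prod.mk.injEq]
      constructor
      · rintro ⟨_, _, ⟨r, s, ⟨h1, h2, h3⟩, rfl, rfl⟩, rfl, rfl⟩
        refine ⟨1 - s, by linarith, by linarith, by ring, ?_, ?_⟩ <;> nlinarith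
      · rintro ⟨s, hs0, hs1, rfl, h1, h2⟩
        rcases hcd₁.eq_or_lt with rfl | hlt
        · exact ⟨_, _, ⟨0, 1 - s, ⟨le_rfl, by linarith, by linarith⟩, rfl, rfl⟩, by linarith,
            by ring⟩
        · have hpos : 0 < d₁ - c₁ := by linarith
          refine ⟨_, _, ⟨(c₀ + s * (d₁ - c₀) - x) / (d₁ - c₁), 1 - s,
            ⟨div_nonneg (by linarith) hpos.le, by linarith, ?_⟩, rfl, rfl⟩, ?_, by ring⟩
          · have : (c₀ + s * (d₁ - c₀) - x) / (d₁ - c₁) ≤ s := by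
              rw [div_le_iff₀ hpos]; linarith
            linarith
          · field_simp; ring
    have memJ : ∀ x y : ℝ, (x, y) ∈ convexJoin ℝ ((fun x => (x, a)) '' Set.Icc c₀ d₀)
        ((fun x => (x, b)) '' Set.Icc c₁ d₁) ↔
        ∃ s, 0 ≤ s ∧ s ≤ 1 ∧ y = a + s * (b - a) ∧ c₀ + s * (c₁ - c₀) ≤ x ∧
          x ≤ d₀ + s * (d₁ - d₀) := by
      intro x y
      simp only [mem_convexJoin, segment_eq_image', Set.mem_image, Prod.exists, Set.mem_Icc,
        Prod.smul_mk, smul_eq_mul, Prod.mk_add_mk, Prod.mk.injEq, Prod.mk_sub_mk]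
      constructor
      · rintro ⟨_, _, ⟨u, ⟨hu1, hu2⟩, rfl, rfl⟩, _, _, ⟨w, ⟨hw1, hw2⟩, rfl, rfl⟩, s, ⟨hs0, hs1⟩,
          rfl, rfl⟩
        refine ⟨s, hs0, hs1, rfl, ?_, ?_⟩ <;> nlinarith
      · rintro ⟨s, hs0, hs1, rfl, h1, h2⟩
        have hw : 0 ≤ (d₀ - c₀) + s * ((d₁ - c₁) - (d₀ - c₀)) := by nlinarith
        obtain ⟨r, hr0, hr1, hr⟩ : ∃ r : ℝ, 0 ≤ r ∧ r ≤ 1 ∧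
            x = c₀ + s * (c₁ - c₀) + r * ((d₀ - c₀) + s * ((d₁ - c₁) - (d₀ - c₀))) := by
          rcases hw.eq_or_lt with h0 | h0
          · exact ⟨0, le_rfl, zero_le_one, by linarith⟩
          · refine ⟨(x - (c₀ + s * (c₁ - c₀))) / ((d₀ - c₀) + s * ((d₁ - c₁) - (d₀ - c₀))),
              div_nonneg (by linarith) hw, ?_, ?_⟩
            · rw [div_le_one h0]; linarith
            · field_simp; ring
        refine ⟨_, _, ⟨c₀ + r * (d₀ - c₀), ⟨?_, ?_⟩, rfl, rfl⟩, _, _,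
          ⟨c₁ + r * (d₁ - c₁), ⟨?_, ?_⟩, rfl, rfl⟩, s, ⟨hs0, hs1⟩, ?_, rfl⟩
        · nlinarith
        · nlinarith
        · nlinarith
        · nlinarith
        · rw [hr]; ring
    have key := (h.val i).cut hJ.1
      ((isBody_stdTriangle.image (planeMap (d₀ - c₀, 0) (d₁ - c₀, b - a))).translate (c₀, a))
      ((isBody_stdTriangle.image (planeMap (c₁ - d₁, 0) (c₀ - d₁, a - b))).translate (d₁, b))
      (C := _root_.segment ℝ (c₀, a) (d₁, b)) ?_ ?_ ⟨_, left_mem_segment ℝ _ _⟩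
    · rw [h.segment', h.flat_triangle i _ _ _ hba, h.flat_triangle i _ _ _ hab'] at key
      linarith
    · ext ⟨x, y⟩
      rw [Set.mem_union, memA, memB, memJ]
      constructor
      · rintro (⟨s, hs0, hs1, hy, h1, h2⟩ | ⟨s, hs0, hs1, hy, h1, h2⟩) <;>
          refine ⟨s, hs0, hs1, hy, ?_, ?_⟩ <;> nlinarith
      · rintro ⟨s, hs0, hs1, hy, h1, h2⟩
        rcases le_total x (c₀ + s * (d₁ - c₀)) with h3 | h3
        · exact Or.inr ⟨s, hs0, hs1, hy, h1, h3⟩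
        · exact Or.inl ⟨s, hs0, hs1, hy, h3, h2⟩
    · ext ⟨x, y⟩
      rw [Set.mem_inter_iff, memA, memB, segment_eq_image']
      simp only [Set.mem_image, Prod.smul_mk, smul_eq_mul, Prod.mk_add_mk, Prod.mk.injEq,
        Prod.mk_sub_mk]
      constructor
      · rintro ⟨⟨s, hs0, hs1, hy, h1, h2⟩, s', hs0', hs1', hy', h1', h2'⟩
        obtain rfl : s' = s := mul_right_cancel₀ hba (by linarith)
        exact ⟨s', ⟨hs0, hs1⟩, by linarith, hy.symm⟩
      · rintro ⟨s, ⟨hs0, hs1⟩, rfl, rfl⟩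
        refine ⟨⟨s, hs0, hs1, rfl, le_rfl, ?_⟩, s, hs0, hs1, rfl, ?_, le_rfl⟩ <;> nlinarith

end NoIntegralScaling

/-- A translation invariant continuous valuation of the plane whose degree of homogeneity is not
an integer vanishes. -/
theorem IsContValuation.eq_zero_of_scaling {χ : Set (ℝ × ℝ) → ℝ} (h : IsContValuation χ)
    (ht : ∀ x S, IsBody S → χ ((fun y => x + y) '' S) = χ S) (κ : ℝ)
    (h1 : κ ≠ 1) (h2 : κ ≠ 2) (h4 : κ ≠ 4)
    (hκ : ∀ S, IsBody S → χ ((2 : ℝ) • S) = κ * χ S) (K : Set (ℝ × ℝ)) (hK : IsBody K) :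
    χ K = 0 := by
  have : NoIntegralScaling fun _ : Unit => χ := by
    refine ⟨fun _ => h, fun _ => ht, fun S hS μ hμ hd _ => ?_⟩
    have e := hd ()
    rw [hκ S hS] at e
    have hne : κ - μ ≠ 0 := by
      rcases hμ with rfl | rfl | rfl <;> rwa [sub_ne_zero]
    exact (mul_eq_zero.1 (by linear_combination e : (κ - μ) * χ S = 0)).resolve_left hne
  exact this.eq_zero () K hK

/-- A translation invariant continuous bivaluation of the plane whose joint degree of homogeneity
is not an integer vanishes. -/
theorem bivaluation_eq_zero {Ψ : Set (ℝ × ℝ) → Set (ℝ × ℝ) → ℝ}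
    (hl : ∀ B, IsBody B → IsContValuation fun A => Ψ A B)
    (hr : ∀ A, IsBody A → IsContValuation (Ψ A))
    (tl : ∀ x A B, IsBody A → IsBody B → Ψ ((fun y => x + y) '' A) B = Ψ A B)
    (tr : ∀ x A B, IsBody A → IsBody B → Ψ A ((fun y => x + y) '' B) = Ψ A B)
    (c : ℝ) (hc : 0 < c) (hc2 : c ^ 2 = 8)
    (hs : ∀ A B, IsBody A → IsBody B → Ψ ((2 : ℝ) • A) ((2 : ℝ) • B) = c * Ψ A B)
    (A B : Set (ℝ × ℝ)) (hA : IsBody A) (hB : IsBody B) : Ψ A B = 0 := by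
  have : NoIntegralScaling fun (B : {B : Set (ℝ × ℝ) // IsBody B}) A => Ψ A B.1 := by
    refine ⟨fun B => hl B.1 B.2, fun B x S hS => tl x S B.1 hS B.2, ?_⟩
    rintro S hS μ hμ hd ⟨B, hB⟩
    have hμ0 : μ ≠ 0 := by rcases hμ with rfl | rfl | rfl <;> norm_num
    refine (hr S hS).eq_zero_of_scaling (fun x B hB => tr x S B hS hB) (c / μ) ?_ ?_ ?_ ?_ B hB
    · intro h
      rw [div_eq_iff hμ0] at h
      rcases hμ with rfl | rfl | rfl <;> subst h <;> norm_num at hc2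
    · intro h
      rw [div_eq_iff hμ0] at h
      rcases hμ with rfl | rfl | rfl <;> subst h <;> norm_num at hc2
    · intro h
      rw [div_eq_iff hμ0] at h
      rcases hμ with rfl | rfl | rfl <;> subst h <;> norm_num at hc2
    · intro T hT
      have e1 := hs S T hS hT
      have e2 := hd ⟨(2 : ℝ) • T, hT.smul 2⟩
      simp only at e2
      rw [e1] at e2
      field_simp
      linarith
  exact this.eq_zero ⟨B, hB⟩ A hA

end PlanarVanishing

section Joins

variable {E F : Type*} [NormedAddCommGroup E] [NormedSpace ℝ E]
  [NormedAddCommGroup F] [NormedSpace ℝ F]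

theorem image_convexJoin (T : E →L[ℝ] F) (v : F) (A B : Set E) :
    (fun x => v + T x) '' convexJoin ℝ A B =
      convexJoin ℝ ((fun x => v + T x) '' A) ((fun x => v + T x) '' B) := by
  have key : ∀ a b : E, (fun x => v + T x) '' segment ℝ a b = segment ℝ (v + T a) (v + T b) := by
    intro a b
    simp only [segment_eq_image', Set.image_image, map_add, map_smul, add_sub_add_left_eq_sub,
      map_sub, add_assoc]
  ext y
  constructor
  · rintro ⟨x, hx, rfl⟩
    obtain ⟨a, ha, b, hb, hx⟩ := mem_convexJoin.1 hx
    refine mem_convexJoin.2 ⟨_, ⟨a, ha, rfl⟩, _, ⟨b, hb, rfl⟩, ?_⟩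
    rw [← key]
    exact ⟨x, hx, rfl⟩
  · intro hy
    obtain ⟨_, ⟨a, ha, rfl⟩, _, ⟨b, hb, rfl⟩, hy⟩ := mem_convexJoin.1 hy
    rw [← key] at hy
    obtain ⟨x, hx, rfl⟩ := hy
    exact ⟨x, mem_convexJoin.2 ⟨a, ha, b, hb, hx⟩, rfl⟩

theorem convexJoin_inter_left {P Q T : Set E} {ℓ : E →L[ℝ] ℝ} {a b : ℝ} (hab : a ≠ b)
    (hP : IsBody P) (hQ : IsBody Q) (hPQ : Convex ℝ (P ∪ Q)) (hT : Convex ℝ T)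
    (hPa : ∀ x ∈ P, ℓ x = a) (hQa : ∀ x ∈ Q, ℓ x = a) (hTb : ∀ x ∈ T, ℓ x = b) :
    convexJoin ℝ (P ∩ Q) T = convexJoin ℝ P T ∩ convexJoin ℝ Q T := by
  apply Set.Subset.antisymm
  · exact Set.subset_inter (convexJoin_mono_left Set.inter_subset_left)
      (convexJoin_mono_left Set.inter_subset_right)
  rintro x ⟨hx1, hx2⟩
  obtain ⟨p, hp, t, ht, hx1⟩ := mem_convexJoin.1 hx1
  obtain ⟨q, hq, t', ht', hx2⟩ := mem_convexJoin.1 hx2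
  rw [segment_eq_image] at hx1 hx2
  obtain ⟨s, ⟨hs0, hs1⟩, rfl⟩ := hx1
  obtain ⟨s', ⟨hs0', hs1'⟩, e⟩ := hx2
  obtain rfl : s' = s := by
    have := congrArg ℓ e
    simp only [map_add, map_smul, smul_eq_mul, hPa p hp, hQa q hq, hTb t ht, hTb t' ht'] at this
    have h0 : b - a ≠ 0 := sub_ne_zero.2 hab.symm
    exact mul_right_cancel₀ h0 (by linarith)
  obtain ⟨r, hr, hrP, hrQ⟩ := isPreconnected_closed_iff.1 (convex_segment p q).isPreconnected P Q
    hP.2.1.isClosed hQ.2.1.isClosed (hPQ.segment_subset (Or.inl hp) (Or.inr hq))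
    ⟨p, left_mem_segment ℝ p q, hp⟩ ⟨q, right_mem_segment ℝ p q, hq⟩
  rw [segment_eq_image] at hr
  obtain ⟨θ, ⟨hθ0, hθ1⟩, rfl⟩ := hr
  refine mem_convexJoin.2 ⟨_, ⟨hrP, hrQ⟩, (1 - θ) • t + θ • t',
    hT ht ht' (by linarith) hθ0 (by ring), ?_⟩
  rw [segment_eq_image]
  refine ⟨s', ⟨hs0, hs1⟩, ?_⟩
  simp only at e
  calc (1 - s') • ((1 - θ) • p + θ • q) + s' • ((1 - θ) • t + θ • t')
      = (1 - θ) • ((1 - s') • p + s' • t) + θ • ((1 - s') • q + s' • t') := by module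
    _ = _ := by rw [e]; module

theorem SetsNear.convexJoin {δ : ℝ} {P Q : Set E} (h : SetsNear δ P Q) (T : Set E) :
    SetsNear δ (convexJoin ℝ P T) (convexJoin ℝ Q T) := by
  have key : ∀ (p q t : E) (s : ℝ), 0 ≤ s → s ≤ 1 → dist p q ≤ δ →
      dist ((1 - s) • p + s • t) ((1 - s) • q + s • t) ≤ δ := by
    intro p q t s hs0 hs1 h
    rw [dist_add_right, dist_smul₀, Real.norm_eq_abs, abs_of_nonneg (by linarith)]
    nlinarith [dist_nonneg (x := p) (y := q)]
  constructor
  · intro x hx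
    obtain ⟨p, hp, t, ht, hx⟩ := mem_convexJoin.1 hx
    rw [segment_eq_image] at hx
    obtain ⟨s, hs, rfl⟩ := hx
    obtain ⟨q, hq, hpq⟩ := h.1 p hp
    refine ⟨_, mem_convexJoin.2 ⟨q, hq, t, ht, ?_⟩, key p q t s hs.1 hs.2 hpq⟩
    rw [segment_eq_image]
    exact ⟨s, hs, rfl⟩
  · intro x hx
    obtain ⟨p, hp, t, ht, hx⟩ := mem_convexJoin.1 hx
    rw [segment_eq_image] at hx
    obtain ⟨s, hs, rfl⟩ := hx
    obtain ⟨q, hq, hpq⟩ := h.2 p hp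
    refine ⟨_, mem_convexJoin.2 ⟨q, hq, t, ht, ?_⟩, key q p t s hs.1 hs.2 hpq⟩
    rw [segment_eq_image]
    exact ⟨s, hs, rfl⟩

theorem IsContValuation.comap_join {χ : Set E → ℝ} (h : IsContValuation χ) {ℓ : E →L[ℝ] ℝ}
    {a b : ℝ} (hab : a ≠ b) {T : Set E} (hT : IsBody T) (hTb : ∀ x ∈ T, ℓ x = b)
    (L : F →L[ℝ] E) (hL : Function.Injective L) (v : E) (ha : ∀ p, ℓ (v + L p) = a) :
    IsContValuation fun A => χ (_root_.convexJoin ℝ ((fun p => v + L p) '' A) T) := by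
  have hb : ∀ A : Set F, IsBody A → IsBody ((fun p => v + L p) '' A) := fun A hA => by
    have := (hA.image L).translate v
    rwa [Set.image_image] at this
  have hla : ∀ A : Set F, ∀ x ∈ (fun p => v + L p) '' A, ℓ x = a := by
    rintro A _ ⟨p, -, rfl⟩
    exact ha p
  refine h.comap (fun A => _root_.convexJoin ℝ ((fun p => v + L p) '' A) T)
    (fun A hA => (hb A hA).join hT) ?_ (‖L‖ + 1) (by positivity) ?_
  · intro A B hA hB hU hI
    refine ⟨by rw [Set.image_union, convexJoin_union_left], ?_⟩
    have hinj : Function.Injective fun p => v + L p := (add_right_injective v).comp hL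
    simp only [Set.image_inter hinj]
    refine convexJoin_inter_left hab (hb A hA) (hb B hB) ?_ hT.1 (hla A) (hla B) hTb
    rw [← Set.image_union]
    exact (hb _ (hA.union hB hU)).1
  · have key : ∀ δ (x y : F), dist x y ≤ δ → dist (v + L x) (v + L y) ≤ (‖L‖ + 1) * δ :=
      fun δ x y hxy => by
        have h0 : 0 ≤ δ := dist_nonneg.trans hxy
        have := L.dist_le_opNorm x y
        have h1 : ‖L‖ * dist x y ≤ ‖L‖ * δ := by gcongr
        rw [dist_add_left]
        linarith
    rintro δ A B - - ⟨h1, h2⟩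
    refine SetsNear.convexJoin ⟨?_, ?_⟩ T
    · rintro _ ⟨x, hx, rfl⟩
      obtain ⟨y, hy, hxy⟩ := h1 x hx
      exact ⟨_, ⟨y, hy, rfl⟩, key _ _ _ hxy⟩
    · rintro _ ⟨x, hx, rfl⟩
      obtain ⟨y, hy, hxy⟩ := h2 x hx
      exact ⟨_, ⟨y, hy, rfl⟩, key _ _ _ hxy⟩

end Joins

section ShearInvariant

/-- The linear map `(z, t) ↦ (lz + tb, t / l)` of `ℂ × ℝ`. -/
def boost (l : ℝ) (b : ℂ) : ℂ × ℝ →L[ℝ] ℂ × ℝ :=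
  (l • ContinuousLinearMap.fst ℝ ℂ ℝ + (ContinuousLinearMap.snd ℝ ℂ ℝ).smulRight b).prod
    (l⁻¹ • ContinuousLinearMap.snd ℝ ℂ ℝ)

theorem boost_apply (l : ℝ) (b : ℂ) (x : ℂ × ℝ) :
    boost l b x = (l • x.1 + x.2 • b, l⁻¹ • x.2) := rfl

/-- The real plane as the horizontal hyperplane of `ℂ × ℝ`. -/
def horizontalEmb : ℝ × ℝ →L[ℝ] ℂ × ℝ :=
  ContinuousLinearMap.inl ℝ ℂ ℝ ∘L (Complex.equivRealProdCLM.symm : ℝ × ℝ →L[ℝ] ℂ)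

theorem horizontalEmb_apply (p : ℝ × ℝ) :
    horizontalEmb p = (Complex.equivRealProdCLM.symm p, 0) := rfl

theorem horizontalEmb_injective : Function.Injective horizontalEmb := by
  intro p q h
  simp only [horizontalEmb_apply, Prod.mk.injEq, and_true] at h
  exact Complex.equivRealProdCLM.symm.injective h

theorem exists_planar_body {S : Set (ℂ × ℝ)} {a : ℝ} (hS : IsBody S) (ha : ∀ x ∈ S, x.2 = a) :
    ∃ A : Set (ℝ × ℝ), IsBody A ∧ S = (fun p => (0, a) + horizontalEmb p) '' A := by
  refine ⟨_, hS.image ((Complex.equivRealProdCLM : ℂ →L[ℝ] ℝ × ℝ) ∘L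
    ContinuousLinearMap.fst ℝ ℂ ℝ), ?_⟩
  rw [Set.image_image]
  conv_lhs => rw [← Set.image_id S]
  refine Set.image_congr fun x hx => ?_
  ext1
  · simpa [horizontalEmb_apply] using (Complex.equivRealProdCLM.symm_apply_apply x.1).symm
  · simp [horizontalEmb_apply, ← ha x hx]

/-- A continuous, translation and shear invariant valuation on `ℂ × ℝ` which vanishes on
horizontal bodies and scales with a non-integral degree under doubling of the horizontal
directions vanishes. -/
theorem IsContValuation.eq_zero_of_shear {χ : Set (ℂ × ℝ) → ℝ} (h : IsContValuation χ)
    (ht : ∀ x S, IsBody S → χ ((fun y => x + y) '' S) = χ S)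
    (hh : ∀ S a, IsBody S → (∀ x ∈ S, x.2 = a) → χ S = 0)
    (hs : ∀ b S, IsBody S → χ (boost 1 b '' S) = χ S)
    (c : ℝ) (hc : 0 < c) (hc2 : c ^ 2 = 8) (D : ℂ × ℝ →L[ℝ] ℂ × ℝ)
    (hD : ∀ x, D x = ((2 : ℝ) • x.1, x.2)) (hχ : ∀ S, IsBody S → χ (D '' S) = c * χ S)
    (K : Set (ℂ × ℝ)) (hK : IsBody K) : χ K = 0 := by
  refine h.eq_zero_of_slabs (ContinuousLinearMap.snd ℝ ℂ ℝ) (fun S t hS hSt => hh S t hS hSt) ?_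
    K hK
  intro S T a b hab hS hT hSa hTb
  obtain ⟨A, hA, rfl⟩ := exists_planar_body hS hSa
  obtain ⟨B, hB, rfl⟩ := exists_planar_body hT hTb
  have lift : ∀ (a : ℝ) (A : Set (ℝ × ℝ)), IsBody A →
      IsBody ((fun p => ((0, a) : ℂ × ℝ) + horizontalEmb p) '' A) := fun a A hA => by
    have := (hA.image horizontalEmb).translate (0, a)
    rwa [Set.image_image] at this
  have level : ∀ (a : ℝ) (p : ℝ × ℝ),
      ContinuousLinearMap.snd ℝ ℂ ℝ (((0, a) : ℂ × ℝ) + horizontalEmb p) = a := by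
    intro a p
    simp [horizontalEmb_apply]
  have level' : ∀ (a : ℝ) (A : Set (ℝ × ℝ)), ∀ x ∈ (fun p => ((0, a) : ℂ × ℝ) + horizontalEmb p)
      '' A, ContinuousLinearMap.snd ℝ ℂ ℝ x = a := by
    rintro a A _ ⟨p, -, rfl⟩
    exact level a p
  have hJ : ∀ A B : Set (ℝ × ℝ), IsBody A → IsBody B →
      IsBody (convexJoin ℝ ((fun p => ((0, a) : ℂ × ℝ) + horizontalEmb p) '' A)
        ((fun p => ((0, b) : ℂ × ℝ) + horizontalEmb p) '' B)) := fun A B hA hB =>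
    (lift a A hA).join (lift b B hB)
  have move : ∀ (x y : ℝ × ℝ) (A B : Set (ℝ × ℝ)), IsBody A → IsBody B →
      χ (convexJoin ℝ ((fun p => ((0, a) : ℂ × ℝ) + horizontalEmb p) '' ((fun y => x + y) '' A))
        ((fun p => ((0, b) : ℂ × ℝ) + horizontalEmb p) '' ((fun z => y + z) '' B))) =
      χ (convexJoin ℝ ((fun p => ((0, a) : ℂ × ℝ) + horizontalEmb p) '' A)
        ((fun p => ((0, b) : ℂ × ℝ) + horizontalEmb p) '' B)) := by
    intro x y A B hA hB
    have hab' : a - b ≠ 0 := by linarith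
    set e := Complex.equivRealProdCLM.symm with he
    set β : ℂ := (a - b)⁻¹ • (e x - e y) with hβ
    have hβ' : a • β - b • β = e x - e y := by
      rw [← sub_smul, hβ, smul_smul, mul_inv_cancel₀ hab', one_smul]
    have := ht (e x - a • β, 0) _ ((hJ A B hA hB).image (boost 1 β))
    rw [hs β _ (hJ A B hA hB), Set.image_image, image_convexJoin] at this
    rw [← this]
    simp only [Set.image_image]
    congr 2
    · refine Set.image_congr fun p _ => ?_
      simp only [boost_apply, horizontalEmb_apply, ← he, Prod.mk_add_mk, map_add]
      ext1
      · simp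
      · simp
    · refine Set.image_congr fun p _ => ?_
      simp only [boost_apply, horizontalEmb_apply, ← he, Prod.mk_add_mk, map_add]
      ext1
      · simp only [one_smul, zero_add, add_zero]
        have : e y = e x - a • β + b • β := by
          linear_combination hβ'
        rw [this]; abel
      · simp
  refine bivaluation_eq_zero (Ψ := fun A B =>
    χ (convexJoin ℝ ((fun p => ((0, a) : ℂ × ℝ) + horizontalEmb p) '' A)
      ((fun p => ((0, b) : ℂ × ℝ) + horizontalEmb p) '' B))) ?_ ?_ ?_ ?_ c hc hc2 ?_ A B hA hB
  · intro B hB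
    exact h.comap_join hab.ne (lift b B hB) (level' b B) _ horizontalEmb_injective _ (level a)
  · intro A hA
    have := h.comap_join hab.ne' (lift a A hA) (level' a A) _ horizontalEmb_injective _ (level b)
    simpa only [convexJoin_comm] using this
  · intro x A B hA hB
    simpa using move x 0 A B hA hB
  · intro x A B hA hB
    simpa using move 0 x A B hA hB
  · intro A B hA hB
    rw [← hχ _ (hJ A B hA hB)]
    have := image_convexJoin D 0 ((fun p => ((0, a) : ℂ × ℝ) + horizontalEmb p) '' A)
        ((fun p => ((0, b) : ℂ × ℝ) + horizontalEmb p) '' B)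
    simp only [zero_add] at this
    rw [this]
    simp only [Set.image_image, ← Set.image_smul, hD]
    simp [horizontalEmb_apply]

end ShearInvariant

section Boost

/-- A family of set functionals on `ℂ × ℝ`, indexed by `ℂ × ℂ`, with the equivariance and
regularity of the degree two component of a contravariant Minkowski valuation. -/
structure BoostCovariant (Φ : ℂ × ℂ → Set (ℂ × ℝ) → ℝ) : Prop where
  val : ∀ u, IsContValuation (Φ u)
  trans : ∀ u x S, IsBody S → Φ u ((fun y => x + y) '' S) = Φ u S
  hom : ∀ u (r : ℝ) S, 0 < r → IsBody S → Φ u (r • S) = r ^ 2 * Φ u S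
  boost : ∀ u (l : ℝ) b S, 0 < l → IsBody S →
    Φ u (boost l b '' S) = Φ (l⁻¹ • u.1 - b * u.2, l • u.2) S
  lip : ∀ (R : ℝ) (u₁ : ℂ), ∃ C : ℝ, 0 ≤ C ∧ ∀ S, IsBody S → S ⊆ Metric.closedBall 0 R →
    ∀ (u₂ : ℂ) (s : ℝ), 0 < s → |Φ (s • u₁, u₂) S - Φ (0, u₂) S| ≤ C * s
  hom_dual : ∀ u (s : ℝ) S, 0 < s → IsBody S → Φ (s • u) S = s * Φ u S

namespace BoostCovariant

variable {Φ : ℂ × ℂ → Set (ℂ × ℝ) → ℝ}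

theorem hom_boost (h : BoostCovariant Φ) (u₁ u₂ b : ℂ) {l : ℝ} (hl : 0 < l)
    {S : Set (ℂ × ℝ)} (hS : IsBody S) :
    Φ (u₁, u₂) (_root_.boost l b '' S) = l * Φ ((l⁻¹ * l⁻¹) • u₁ - (l⁻¹ * b) * u₂, u₂) S := by
  rw [h.boost _ l b S hl hS, ← h.hom_dual _ l S hl hS]
  congr 1
  ext1
  · simp only [Prod.smul_mk, smul_sub, smul_smul]
    congr 1
    · congr 1; field_simp
    · simp only [Complex.real_smul, Complex.ofReal_inv]
      have : (l : ℂ) ≠ 0 := by exact_mod_cast hl.ne'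
      field_simp
  · rfl

theorem flat_zero (h : BoostCovariant Φ) (u : ℂ × ℂ) {S : Set (ℂ × ℝ)} (hS : IsBody S)
    (h0 : ∀ x ∈ S, x.2 = 0) : Φ u S = 0 := by
  obtain ⟨R, hR⟩ := hS.2.1.isBounded.subset_closedBall 0
  obtain ⟨C, hC, H⟩ := h.lip R u.1
  have key : ∀ l : ℝ, 1 ≤ l → l * |Φ u S| ≤ |Φ (0, u.2) S| + C := by
    intro l hl
    have hl0 : 0 < l := by linarith
    have e : _root_.boost l 0 '' S = l • S := by
      rw [← Set.image_smul]
      refine Set.image_congr fun x hx => ?_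
      ext1
      · simp [boost_apply]
      · simp [boost_apply, h0 x hx]
    have e1 := h.hom_boost u.1 u.2 0 hl0 hS
    rw [e, h.hom _ l S hl0 hS, mul_zero, zero_mul, sub_zero] at e1
    have e2 : l * Φ u S = Φ ((l⁻¹ * l⁻¹) • u.1, u.2) S :=
      mul_left_cancel₀ hl0.ne' (by linear_combination e1)
    have e3 := H S hS hR u.2 (l⁻¹ * l⁻¹) (by positivity)
    rw [← e2] at e3
    have hl1 : l⁻¹ ≤ 1 := inv_le_one_of_one_le₀ hl
    have hl2 : l⁻¹ * l⁻¹ ≤ 1 := mul_le_one₀ hl1 (by positivity) hl1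
    have e4 : C * (l⁻¹ * l⁻¹) ≤ C := mul_le_of_le_one_right hC hl2
    calc l * |Φ u S| = |l * Φ u S| := by rw [abs_mul, abs_of_pos hl0]
      _ ≤ |Φ (0, u.2) S| + |l * Φ u S - Φ (0, u.2) S| := by
        have := abs_add_le (Φ (0, u.2) S) (l * Φ u S - Φ (0, u.2) S)
        rwa [add_sub_cancel] at this
      _ ≤ _ := by linarith
  by_contra hne
  have hpos : 0 < |Φ u S| := abs_pos.2 hne
  have := key (1 + (|Φ (0, u.2) S| + C) / |Φ u S|)
    (le_add_of_nonneg_right (by positivity))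
  rw [add_mul, div_mul_cancel₀ _ hpos.ne'] at this
  linarith

theorem horizontal_zero (h : BoostCovariant Φ) (u : ℂ × ℂ) {S : Set (ℂ × ℝ)} {t : ℝ}
    (hS : IsBody S) (ht : ∀ x ∈ S, x.2 = t) : Φ u S = 0 := by
  rw [← h.trans u (0, -t) S hS]
  refine h.flat_zero u (hS.translate _) ?_
  rintro _ ⟨x, hx, rfl⟩
  simp [ht x hx]

/-- The linear map `(z, t) ↦ (z, 2t)`. -/
def stretch : ℂ × ℝ →L[ℝ] ℂ × ℝ :=
  (ContinuousLinearMap.fst ℝ ℂ ℝ).prod ((2 : ℝ) • ContinuousLinearMap.snd ℝ ℂ ℝ)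

theorem stretch_apply (x : ℂ × ℝ) : stretch x = (x.1, (2 : ℝ) • x.2) := rfl

theorem eq_stretch (h : BoostCovariant Φ) (u₁ u₂ : ℂ) {S : Set (ℂ × ℝ)} (hS : IsBody S) :
    2 * Φ (u₁, u₂) S = √2 * Φ ((2⁻¹ : ℝ) • u₁, u₂) (stretch '' S) := by
  have h2 : (0 : ℝ) < √2 := by positivity
  have hsq : √2 * √2 = 2 := Real.mul_self_sqrt zero_le_two
  have e := h.hom_boost u₁ u₂ 0 h2 (hS.image stretch)
  have e1 : _root_.boost (√2) 0 '' (stretch '' S) = √2 • S := by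
    rw [Set.image_image, ← Set.image_smul]
    refine Set.image_congr fun x _ => ?_
    ext1
    · simp [boost_apply, stretch_apply]
    · simp only [boost_apply, stretch_apply, Prod.smul_snd, smul_eq_mul]
      field_simp
      linear_combination (-x.2) * hsq
  rw [e1, h.hom _ _ S h2 hS, ← mul_inv, hsq, mul_zero, zero_mul, sub_zero, pow_two, hsq] at e
  exact e

theorem bound_of_box (h : BoostCovariant Φ) (u₁ u₂ : ℂ) {R B : ℝ} (hB : 0 ≤ B)
    (H : ∀ S, IsBody S → S ⊆ Metric.closedBall 0 R → |Φ (u₁, u₂) S - Φ (0, u₂) S| ≤ B)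
    {S : Set (ℂ × ℝ)} (hS : IsBody S) (hR : S ⊆ Metric.closedBall 0 R) :
    |Φ (u₁, u₂) (stretch '' S) - Φ (0, u₂) (stretch '' S)| ≤ 2 * B := by
  have hS' := hS.image stretch
  have box : ∀ x ∈ stretch '' S, ‖x.1‖ ≤ R ∧ |x.2| ≤ 2 * R := by
    rintro _ ⟨x, hx, rfl⟩
    have := hR hx
    rw [mem_closedBall_zero_iff, Prod.norm_def, max_le_iff, Real.norm_eq_abs] at this
    refine ⟨this.1, ?_⟩
    rw [stretch_apply, smul_eq_mul, abs_mul, abs_two]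
    linarith [this.2]
  set K := stretch '' S with hK
  have shifted : ∀ (P : Set (ℂ × ℝ)) (c : ℝ), IsBody P → P ⊆ K →
      (∀ x ∈ P, |c + x.2| ≤ R) → |Φ (u₁, u₂) P - Φ (0, u₂) P| ≤ B := by
    intro P c hP hPK hc
    rw [← h.trans _ (0, c) P hP, ← h.trans (0, u₂) (0, c) P hP]
    refine H _ (hP.translate _) ?_
    rintro _ ⟨x, hx, rfl⟩
    rw [mem_closedBall_zero_iff, Prod.norm_def, max_le_iff, Real.norm_eq_abs]
    exact ⟨by simpa using (box x (hPK hx)).1, hc x hx⟩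
  have hup : ∀ x ∈ K, 0 ≤ x.2 → |-R + x.2| ≤ R := fun x hx h0 => by
    have := abs_le.1 (box x hx).2
    rw [abs_le]; constructor <;> linarith
  have hdown : ∀ x ∈ K, x.2 ≤ 0 → |R + x.2| ≤ R := fun x hx h0 => by
    have := abs_le.1 (box x hx).2
    rw [abs_le]; constructor <;> linarith
  by_cases h1 : ∀ x ∈ K, 0 ≤ x.2
  · linarith [shifted K (-R) hS' subset_rfl fun x hx => hup x hx (h1 x hx)]
  by_cases h2 : ∀ x ∈ K, x.2 ≤ 0
  · linarith [shifted K R hS' subset_rfl fun x hx => hdown x hx (h2 x hx)]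
  push Not at h1 h2
  obtain ⟨p, hp, hp0⟩ := h1
  obtain ⟨q, hq, hq0⟩ := h2
  obtain ⟨c, hc, hc0, -⟩ := exists_level_point (ℓ := ContinuousLinearMap.snd ℝ ℂ ℝ) (t := 0)
    (left_mem_segment ℝ p q) hp0.le hq0
  have hcK : c ∈ K := hS'.1.segment_subset hp hq hc
  have hA : IsBody (K ∩ {x | x.2 ≤ 0}) := hS'.of_subset
    (hS'.1.inter (convex_halfSpace_le (ContinuousLinearMap.snd ℝ ℂ ℝ : ℂ × ℝ →ₗ[ℝ] ℝ).isLinear 0))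
    (hS'.2.1.isClosed.inter (isClosed_le continuous_snd continuous_const))
    Set.inter_subset_left ⟨p, hp, hp0.le⟩
  have hB' : IsBody (K ∩ {x | 0 ≤ x.2}) := hS'.of_subset
    (hS'.1.inter (convex_halfSpace_ge (ContinuousLinearMap.snd ℝ ℂ ℝ : ℂ × ℝ →ₗ[ℝ] ℝ).isLinear 0))
    (hS'.2.1.isClosed.inter (isClosed_le continuous_const continuous_snd))
    Set.inter_subset_left ⟨q, hq, hq0.le⟩
  have hU : K ∩ {x | x.2 ≤ 0} ∪ K ∩ {x | 0 ≤ x.2} = K := by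
    ext x
    constructor
    · rintro (hx | hx) <;> exact hx.1
    · intro hx
      rcases le_total x.2 0 with h0 | h0
      · exact Or.inl ⟨hx, h0⟩
      · exact Or.inr ⟨hx, h0⟩
  have hne : (K ∩ {x | x.2 ≤ 0} ∩ (K ∩ {x | 0 ≤ x.2})).Nonempty :=
    ⟨c, ⟨hcK, le_of_eq hc0⟩, hcK, ge_of_eq hc0⟩
  have hI := hA.inter hB' hne
  have hI0 : ∀ x ∈ K ∩ {x | x.2 ≤ 0} ∩ (K ∩ {x | 0 ≤ x.2}), x.2 = 0 :=
    fun x hx => le_antisymm hx.1.2 hx.2.2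
  have c1 := (h.val (u₁, u₂)).cut hS'.1 hA hB' hU rfl hne
  have c2 := (h.val (0, u₂)).cut hS'.1 hA hB' hU rfl hne
  rw [h.flat_zero _ hI hI0, add_zero] at c1 c2
  have b1 := shifted _ R hA Set.inter_subset_left fun x hx => hdown x hx.1 hx.2
  have b2 := shifted _ (-R) hB' Set.inter_subset_left fun x hx => hup x hx.1 hx.2
  rw [c1, c2, abs_le]
  rw [abs_le] at b1 b2
  constructor <;> linarith [b1.1, b1.2, b2.1, b2.2]

theorem fst_indep (h : BoostCovariant Φ) (u₁ u₂ : ℂ) {S : Set (ℂ × ℝ)} (hS : IsBody S) :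
    Φ (u₁, u₂) S = Φ (0, u₂) S := by
  obtain ⟨R, hR⟩ := hS.2.1.isBounded.subset_closedBall 0
  obtain ⟨C, hC, H⟩ := h.lip R u₁
  have key : ∀ (k : ℕ) (s : ℝ), 0 < s → ∀ S, IsBody S → S ⊆ Metric.closedBall 0 R →
      |Φ (s • u₁, u₂) S - Φ (0, u₂) S| ≤ C * s * (√2 / 2) ^ k := by
    intro k
    induction k with
    | zero =>
      intro s hs S hS hSR
      simpa using H S hS hSR u₂ s hs
    | succ k ih =>
      intro s hs S hS hSR
      have b := h.bound_of_box ((2⁻¹ * s) • u₁) u₂ (R := R)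
        (B := C * (2⁻¹ * s) * (√2 / 2) ^ k) (by positivity) (ih (2⁻¹ * s) (by positivity)) hS hSR
      have e1 := h.eq_stretch (s • u₁) u₂ hS
      have e2 := h.eq_stretch 0 u₂ hS
      rw [smul_smul] at e1
      rw [smul_zero] at e2
      have e3 : Φ (s • u₁, u₂) S - Φ (0, u₂) S = √2 / 2 * (Φ ((2⁻¹ * s) • u₁, u₂) (stretch '' S)
          - Φ (0, u₂) (stretch '' S)) := by linarith
      rw [e3, abs_mul, abs_of_pos (by positivity : (0 : ℝ) < √2 / 2)]
      calc √2 / 2 * _ ≤ √2 / 2 * (2 * (C * (2⁻¹ * s) * (√2 / 2) ^ k)) := by gcongr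
        _ = _ := by ring
  have hlt : √2 / 2 < 1 := by
    rw [div_lt_one two_pos, Real.sqrt_lt' two_pos]
    norm_num
  have lim := (tendsto_pow_atTop_nhds_zero_of_lt_one (by positivity) hlt).const_mul C
  rw [mul_zero] at lim
  have := ge_of_tendsto' lim fun k => by simpa using key k 1 one_pos S hS hR
  exact sub_eq_zero.1 (abs_eq_zero.1 (le_antisymm this (abs_nonneg _)))

theorem eq_zero (h : BoostCovariant Φ) (u : ℂ × ℂ) {S : Set (ℂ × ℝ)} (hS : IsBody S) :
    Φ u S = 0 := by
  have hsq : √2 * √2 = 2 := Real.mul_self_sqrt zero_le_two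
  have h2 : (0 : ℝ) < √2 := by positivity
  have hb : ∀ (l : ℝ) b S, 0 < l → IsBody S →
      Φ (0, u.2) (_root_.boost l b '' S) = l * Φ (0, u.2) S := by
    intro l b S hl hS
    rw [h.hom_boost _ _ _ hl hS, h.fst_indep _ _ hS]
  rw [show u = (u.1, u.2) from rfl, h.fst_indep _ _ hS]
  refine (h.val (0, u.2)).eq_zero_of_shear (h.trans _) (fun S a hS ha => h.horizontal_zero _ hS ha)
    (fun b S hS => by rw [hb 1 b S one_pos hS, one_mul]) (2 * √2) (by positivity)
    (by rw [mul_pow, pow_two √2, hsq]; norm_num)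
    (((2 : ℝ) • ContinuousLinearMap.fst ℝ ℂ ℝ).prod (ContinuousLinearMap.snd ℝ ℂ ℝ))
    (fun x => rfl) (fun S hS => ?_) S hS
  have e : (((2 : ℝ) • ContinuousLinearMap.fst ℝ ℂ ℝ).prod (ContinuousLinearMap.snd ℝ ℂ ℝ)) '' S
      = √2 • (_root_.boost (√2) 0 '' S) := by
    rw [← Set.image_smul, Set.image_image]
    refine Set.image_congr fun x _ => ?_
    ext1
    · simp only [boost_apply, Prod.smul_fst, smul_zero, add_zero, smul_smul, hsq]
      rfl
    · simp only [boost_apply, Prod.smul_snd, smul_smul, mul_inv_cancel₀ h2.ne', one_smul]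
      rfl
  rw [e, h.hom _ _ _ h2 (hS.image _), hb _ _ _ h2 hS, pow_two, hsq]
  ring

end BoostCovariant

end Boost

section Extension

variable {V : Type*} [NormedAddCommGroup V] [NormedSpace ℝ V]

open Classical in
/-- The extension by zero to all sets of a function on convex bodies. -/
def bodyExt (φ : ConvexBody V → ℝ) (S : Set V) : ℝ :=
  if h : IsBody S then φ ⟨S, h.1, h.2.1, h.2.2⟩ else 0

theorem ConvexBody.isBody (K : ConvexBody V) : IsBody (K : Set V) :=
  ⟨K.convex, K.isCompact, K.nonempty⟩

theorem bodyExt_of_isBody (φ : ConvexBody V → ℝ) {S : Set V} (h : IsBody S) :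
    bodyExt φ S = φ ⟨S, h.1, h.2.1, h.2.2⟩ :=
  dif_pos h

theorem bodyExt_coe (φ : ConvexBody V → ℝ) (K : ConvexBody V) : bodyExt φ K = φ K :=
  bodyExt_of_isBody φ K.isBody

theorem dist_le_of_setsNear {K L : ConvexBody V} {δ : ℝ} (hδ : 0 ≤ δ)
    (h : SetsNear δ (K : Set V) L) : dist K L ≤ δ := by
  refine Metric.hausdorffDist_le_of_mem_dist hδ h.1 fun y hy => ?_
  obtain ⟨x, hx, hxy⟩ := h.2 y hy
  exact ⟨x, hx, by rwa [dist_comm]⟩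

theorem isContValuation_bodyExt {φ : ConvexBody V → ℝ} (hc : Continuous φ)
    (hv : IsValuation φ) : IsContValuation (bodyExt φ) := by
  refine ⟨fun K L hK hL hU hI => ?_, fun K hK ε hε => ?_⟩
  · rw [bodyExt_of_isBody φ hK, bodyExt_of_isBody φ hL, bodyExt_of_isBody φ (hK.union hL hU),
      bodyExt_of_isBody φ (hK.inter hL hI)]
    exact hv ⟨K, hK.1, hK.2.1, hK.2.2⟩ ⟨L, hL.1, hL.2.1, hL.2.2⟩ hU hI
  · obtain ⟨δ, hδ, H⟩ := Metric.continuous_iff.1 hc ⟨K, hK.1, hK.2.1, hK.2.2⟩ ε hε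
    refine ⟨δ / 2, by positivity, fun L hL hKL => ?_⟩
    rw [bodyExt_of_isBody φ hK, bodyExt_of_isBody φ hL, abs_sub_comm, ← Real.dist_eq]
    refine H _ (lt_of_le_of_lt ?_ (half_lt_self hδ))
    rw [dist_comm]
    exact dist_le_of_setsNear (by positivity) hKL

theorem bodyExt_translate {φ : ConvexBody V → ℝ} (ht : IsTranslationInvariant φ) (x : V)
    {S : Set V} (hS : IsBody S) : bodyExt φ ((fun y => x + y) '' S) = bodyExt φ S := by
  rw [bodyExt_of_isBody φ hS, bodyExt_of_isBody φ (hS.translate x)]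
  exact ht ⟨S, hS.1, hS.2.1, hS.2.2⟩ x

theorem isClosed_setOfPred_convex :
    IsClosed {L : TopologicalSpace.NonemptyCompacts V | Convex ℝ (L : Set V)} := by
  refine isClosed_of_closure_subset fun L hL => ?_
  intro x hx y hy a b ha hb hab
  have fin : ∀ A B : TopologicalSpace.NonemptyCompacts V,
      Metric.hausdorffEDist (A : Set V) B ≠ ⊤ := fun A B =>
    Metric.hausdorffEDist_ne_top_of_nonempty_of_bounded A.nonempty B.nonempty
      A.isCompact.isBounded B.isCompact.isBounded
  refine L.isCompact.isClosed.closure_subset (Metric.mem_closure_iff.2 fun ε hε => ?_)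
  obtain ⟨K, hK, hKL⟩ := Metric.mem_closure_iff.1 hL (ε / 2) (by positivity)
  rw [Metric.NonemptyCompacts.dist_eq] at hKL
  obtain ⟨x', hx', hxx⟩ := Metric.exists_dist_lt_of_hausdorffDist_lt hx hKL (fin L K)
  obtain ⟨y', hy', hyy⟩ := Metric.exists_dist_lt_of_hausdorffDist_lt hy hKL (fin L K)
  obtain ⟨z, hz, hzz⟩ := Metric.exists_dist_lt_of_hausdorffDist_lt' (hK hx' hy' ha hb hab) hKL
    (fin L K)
  refine ⟨z, hz, ?_⟩
  have : dist (a • x + b • y) (a • x' + b • y') ≤ ε / 2 := by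
    calc dist (a • x + b • y) (a • x' + b • y') ≤ dist (a • x) (a • x') + dist (b • y) (b • y') :=
          dist_add_add_le _ _ _ _
      _ = a * dist x x' + b * dist y y' := by
        rw [dist_smul₀, dist_smul₀, Real.norm_of_nonneg ha, Real.norm_of_nonneg hb]
      _ ≤ a * (ε / 2) + b * (ε / 2) := by gcongr
      _ = ε / 2 := by rw [← add_mul, hab, one_mul]
  rw [dist_comm] at hzz
  linarith [dist_triangle (a • x + b • y) (a • x' + b • y') z]

/-- By Blaschke's selection theorem, a continuous function is bounded on the convex bodies in a
ball. -/
theorem exists_bound_of_subset_closedBall [ProperSpace V] {φ : ConvexBody V → ℝ}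
    (hc : Continuous φ) (R : ℝ) :
    ∃ C, ∀ K : ConvexBody V, (K : Set V) ⊆ Metric.closedBall 0 R → |φ K| ≤ C := by
  have hcomp := (TopologicalSpace.NonemptyCompacts.isCompact_subsets_of_isCompact
    (isCompact_closedBall (0 : V) R)).inter_right isClosed_setOfPred_convex
  have hcont : ContinuousOn
      (fun L : TopologicalSpace.NonemptyCompacts V => bodyExt φ (L : Set V))
      ({L | (L : Set V) ⊆ Metric.closedBall 0 R} ∩ {L | Convex ℝ (L : Set V)}) := by
    refine Metric.continuousOn_iff.2 fun L hL ε hε => ?_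
    obtain ⟨δ, hδ, H⟩ := Metric.continuous_iff.1 hc ⟨L, hL.2, L.isCompact, L.nonempty⟩ ε hε
    refine ⟨δ, hδ, fun K hK hKL => ?_⟩
    rw [bodyExt_of_isBody φ ⟨hL.2, L.isCompact, L.nonempty⟩,
      bodyExt_of_isBody φ ⟨hK.2, K.isCompact, K.nonempty⟩]
    exact H ⟨K, hK.2, K.isCompact, K.nonempty⟩ hKL
  obtain ⟨C, hC⟩ := hcomp.exists_bound_of_continuousOn hcont
  refine ⟨C, fun K hK => ?_⟩
  have := hC ⟨⟨K, K.isCompact⟩, K.nonempty⟩ ⟨hK, K.convex⟩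
  rwa [Real.norm_eq_abs, show ((⟨⟨K, K.isCompact⟩, K.nonempty⟩ :
    TopologicalSpace.NonemptyCompacts V) : Set V) = K from rfl, bodyExt_coe] at this

end Extension

section Sublinear

theorem nonneg_of_quadratic_nonneg {a b c : ℝ} (h : ∀ t : ℝ, 0 < t → 0 ≤ a + b * t + c * t ^ 2) :
    0 ≤ a := by
  have hc : Continuous fun t : ℝ => a + b * t + c * t ^ 2 := by fun_prop
  have lim := (hc.tendsto 0).mono_left (nhdsWithin_le_nhds (s := Set.Ioi 0))
  simp only [mul_zero, add_zero, ne_eq, OfNat.ofNat_ne_zero, not_false_eq_true, zero_pow] at lim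
  exact ge_of_tendsto lim (eventually_mem_nhdsWithin.mono fun t ht => h t ht)

theorem abs_sub_le_of_sublinear {V : Type*} [AddCommGroup V] [Module ℝ V] {p : V → ℝ}
    (hadd : ∀ u v, p (u + v) ≤ p u + p v) (hsmul : ∀ u (t : ℝ), 0 < t → p (t • u) = t * p u)
    (u v : V) {s : ℝ} (hs : 0 < s) : |p (u + s • v) - p u| ≤ s * (|p v| + |p (-v)|) := by
  have h1 := hadd u (s • v)
  have h2 := hadd (u + s • v) (s • -v)
  rw [show u + s • v + s • -v = u by module] at h2
  rw [hsmul _ s hs] at h1 h2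
  have h3 : s * p v ≤ s * |p v| := by gcongr; exact le_abs_self _
  have h4 : s * p (-v) ≤ s * |p (-v)| := by gcongr; exact le_abs_self _
  have h5 : 0 ≤ s * |p v| := by positivity
  have h6 : 0 ≤ s * |p (-v)| := by positivity
  rw [abs_le, mul_add]
  constructor <;> linarith

theorem hSupp_add_le_s11 {V : Type*} [NormedAddCommGroup V] [NormedSpace ℝ V] (K : ConvexBody V)
    {p q : V → ℝ} (hp : Continuous p) (hq : Continuous q) :
    hSupp K (fun x => p x + q x) ≤ hSupp K p + hSupp K q := by
  refine csSup_le (K.nonempty.image _) ?_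
  rintro _ ⟨x, hx, rfl⟩
  exact add_le_add
    (le_csSup (K.isCompact.image hp).bddAbove ⟨x, hx, rfl⟩)
    (le_csSup (K.isCompact.image hq).bddAbove ⟨x, hx, rfl⟩)

end Sublinear

section Components

variable {W : Type*} [NormedAddCommGroup W] [NormedSpace ℂ W]
  {Z : ConvexBody W → ConvexBody (W →L[ℂ] ℂ)} {f : ℕ → ConvexBody W → W → ℝ}

theorem component_add_le (hf : McMullenProps f)
    (hsum : ∀ (K : ConvexBody W) (u : W),
      hSupp (Z K) (fun ξ => (ξ u).re) = f 1 K u + f 2 K u + f 3 K u)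
    (K : ConvexBody W) (u v : W) :
    f 1 K (u + v) ≤ f 1 K u + f 1 K v ∧ f 3 K (u + v) ≤ f 3 K u + f 3 K v := by
  obtain ⟨-, -, -, hom, -, -⟩ := hf
  have hcont : ∀ w : W, Continuous fun ξ : W →L[ℂ] ℂ => (ξ w).re := fun w =>
    Complex.continuous_re.comp (ContinuousLinearMap.apply ℂ ℂ w).continuous
  have hsub : ∀ K : ConvexBody W, f 1 K (u + v) + f 2 K (u + v) + f 3 K (u + v) ≤
      (f 1 K u + f 2 K u + f 3 K u) + (f 1 K v + f 2 K v + f 3 K v) := by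
    intro K
    rw [← hsum, ← hsum, ← hsum]
    simp only [map_add, Complex.add_re]
    exact hSupp_add_le_s11 _ (hcont u) (hcont v)
  have key : ∀ t : ℝ, 0 < t → 0 ≤ (f 1 K u + f 1 K v - f 1 K (u + v)) +
      (f 2 K u + f 2 K v - f 2 K (u + v)) * t + (f 3 K u + f 3 K v - f 3 K (u + v)) * t ^ 2 := by
    intro t ht
    have := hsub (t • K)
    simp only [hom _ _ _ t ht] at this
    refine nonneg_of_mul_nonneg_right (a := t) ?_ ht
    nlinarith
  constructor
  · linarith [nonneg_of_quadratic_nonneg key]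
  · refine sub_nonneg.1 (nonneg_of_quadratic_nonneg
      (b := f 2 K u + f 2 K v - f 2 K (u + v)) (c := f 1 K u + f 1 K v - f 1 K (u + v))
      fun t ht => ?_)
    have := mul_nonneg (sq_nonneg t) (key t⁻¹ (by positivity))
    have e : t ^ 2 * (f 1 K u + f 1 K v - f 1 K (u + v) +
        (f 2 K u + f 2 K v - f 2 K (u + v)) * t⁻¹ +
        (f 3 K u + f 3 K v - f 3 K (u + v)) * t⁻¹ ^ 2) = f 3 K u + f 3 K v - f 3 K (u + v) +
        (f 2 K u + f 2 K v - f 2 K (u + v)) * t +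
        (f 1 K u + f 1 K v - f 1 K (u + v)) * t ^ 2 := by
      field_simp
      ring
    rwa [e] at this

theorem exists_component_two_lipschitz [FiniteDimensional ℂ W] (hf : McMullenProps f)
    (hsum : ∀ (K : ConvexBody W) (u : W),
      hSupp (Z K) (fun ξ => (ξ u).re) = f 1 K u + f 2 K u + f 3 K u)
    (R : ℝ) (v : W) :
    ∃ C : ℝ, 0 ≤ C ∧ ∀ K : ConvexBody W, (K : Set W) ⊆ Metric.closedBall 0 R →
      ∀ (u : W) (s : ℝ), 0 < s → |f 2 K (u + s • v) - f 2 K u| ≤ C * s := by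
  have : ProperSpace W := FiniteDimensional.proper ℂ W
  obtain ⟨cont, -, -, -, -, homd⟩ := id hf
  have b : ∀ i w, ∃ C, ∀ K : ConvexBody W, (K : Set W) ⊆ Metric.closedBall 0 R → |f i K w| ≤ C :=
    fun i w => exists_bound_of_subset_closedBall (cont i w) R
  choose B hB using b
  have hcont : ∀ w : W, Continuous fun ξ : W →L[ℂ] ℂ => (ξ w).re := fun w =>
    Complex.continuous_re.comp (ContinuousLinearMap.apply ℂ ℂ w).continuous
  set C := 2 * (B 1 v + B 1 (-v)) + (B 2 v + B 2 (-v)) + 2 * (B 3 v + B 3 (-v)) with hC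
  refine ⟨|C|, abs_nonneg C, fun K hK u s hs => ?_⟩
  have p1 := abs_sub_le_of_sublinear (fun u v => (component_add_le hf hsum K u v).1)
    (homd 1 K) u v hs
  have p3 := abs_sub_le_of_sublinear (fun u v => (component_add_le hf hsum K u v).2)
    (homd 3 K) u v hs
  have pH := abs_sub_le_of_sublinear (p := fun u => f 1 K u + f 2 K u + f 3 K u)
    (fun u v => by
      simp only [← hsum, map_add, Complex.add_re]
      exact hSupp_add_le_s11 _ (hcont u) (hcont v))
    (fun u t ht => by simp only [homd _ _ _ t ht]; ring) u v hs
  have q : ∀ w, |f 1 K w + f 2 K w + f 3 K w| ≤ B 1 w + B 2 w + B 3 w := fun w =>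
    (abs_add_three _ _ _).trans (by linarith [hB 1 w K hK, hB 2 w K hK, hB 3 w K hK])
  have r1 : s * (|f 1 K v| + |f 1 K (-v)|) ≤ s * (B 1 v + B 1 (-v)) := by
    gcongr <;> exact hB _ _ K hK
  have r3 : s * (|f 3 K v| + |f 3 K (-v)|) ≤ s * (B 3 v + B 3 (-v)) := by
    gcongr <;> exact hB _ _ K hK
  have rH : s * (|f 1 K v + f 2 K v + f 3 K v| + |f 1 K (-v) + f 2 K (-v) + f 3 K (-v)|) ≤
      s * ((B 1 v + B 2 v + B 3 v) + (B 1 (-v) + B 2 (-v) + B 3 (-v))) := by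
    gcongr <;> exact q _
  have hCs : C * s ≤ |C| * s := by gcongr; exact le_abs_self C
  refine le_trans ?_ hCs
  rw [abs_le] at *
  rw [hC]
  constructor <;> linarith [p1.1, p1.2, p3.1, p3.2, pH.1, pH.2]

theorem component_two_equivariant [FiniteDimensional ℂ W] (hZg : IsSLContravariant Z)
    (hf : McMullenProps f)
    (hsum : ∀ (K : ConvexBody W) (u : W),
      hSupp (Z K) (fun ξ => (ξ u).re) = f 1 K u + f 2 K u + f 3 K u)
    (g : W ≃L[ℂ] W) (hg : LinearMap.det ((g : W →L[ℂ] W) : W →ₗ[ℂ] W) = 1)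
    (K : ConvexBody W) (u : W) :
    f 2 (K.mapCLM (cReal (g : W →ₗ[ℂ] W))) u = f 2 K (g.symm u) := by
  obtain ⟨-, -, -, hom, -, -⟩ := hf
  have key : ∀ t : ℝ, 0 < t →
      t ^ 1 * f 1 (K.mapCLM (cReal (g : W →ₗ[ℂ] W))) u +
        t ^ 2 * f 2 (K.mapCLM (cReal (g : W →ₗ[ℂ] W))) u +
        t ^ 3 * f 3 (K.mapCLM (cReal (g : W →ₗ[ℂ] W))) u =
      t ^ 1 * f 1 K (g.symm u) + t ^ 2 * f 2 K (g.symm u) + t ^ 3 * f 3 K (g.symm u) := by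
    intro t ht
    have e : (t • K).mapCLM (cReal (g : W →ₗ[ℂ] W)) =
        t • K.mapCLM (cReal (g : W →ₗ[ℂ] W)) := by
      apply ConvexBody.ext
      exact Set.image_smul_comm _ t _ fun y => map_smul _ t y
    simp only [← hom _ _ _ t ht]
    rw [← e, ← hsum, ← hsum, hZg g hg]
    simp only [hSupp, ConvexBody.mapCLM, ConvexBody.coe_mk, Set.image_image]
    rfl
  have k1 := key 1 one_pos
  have k2 := key 2 two_pos
  have k3 := key 3 three_pos
  linarith

end Components

section Hyperplane

variable {W : Type*} [NormedAddCommGroup W] [NormedSpace ℂ W]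

/-- The parametrization of the real hyperplane `ℂ c₀ + ℝ c₁`. -/
def hyperplaneEmbedding (c : Basis (Fin 2) ℂ W) : ℂ × ℝ →L[ℝ] W :=
  (ContinuousLinearMap.fst ℝ ℂ ℝ).smulRight (c 0) + (ContinuousLinearMap.snd ℝ ℂ ℝ).smulRight (c 1)

theorem hyperplaneEmbedding_apply (c : Basis (Fin 2) ℂ W) (x : ℂ × ℝ) :
    hyperplaneEmbedding c x = x.1 • c 0 + (x.2 : ℂ) • c 1 := by
  simp [hyperplaneEmbedding]

theorem Module.Basis.coord_pair (c : Basis (Fin 2) ℂ W) (z w : ℂ) :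
    c.coord 0 (z • c 0 + w • c 1) = z ∧ c.coord 1 (z • c 0 + w • c 1) = w := by
  simp

theorem Module.Basis.pair_expansion (c : Basis (Fin 2) ℂ W) (x : W) :
    c.coord 0 x • c 0 + c.coord 1 x • c 1 = x := by
  rw [← Fin.sum_univ_two fun i => c.coord i x • c i]
  exact c.sum_repr x

theorem hyperplaneEmbedding_injective (c : Basis (Fin 2) ℂ W) :
    Function.Injective (hyperplaneEmbedding c) := by
  intro x y hxy
  rw [hyperplaneEmbedding_apply, hyperplaneEmbedding_apply] at hxy
  have h0 := congrArg (c.coord 0) hxy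
  have h1 := congrArg (c.coord 1) hxy
  rw [(c.coord_pair _ _).1, (c.coord_pair _ _).1] at h0
  rw [(c.coord_pair _ _).2, (c.coord_pair _ _).2] at h1
  exact Prod.ext h0 (Complex.ofReal_injective h1)

variable [FiniteDimensional ℂ W]

/-- The unimodular map `c₀ ↦ l c₀`, `c₁ ↦ b c₀ + l⁻¹ c₁`. -/
theorem exists_boost_equiv (c : Basis (Fin 2) ℂ W) {l : ℝ} (hl : 0 < l) (b : ℂ) :
    ∃ g : W ≃L[ℂ] W, LinearMap.det ((g : W →L[ℂ] W) : W →ₗ[ℂ] W) = 1 ∧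
      (∀ z w : ℂ, g (z • c 0 + w • c 1) = (l • z + w * b) • c 0 + (l⁻¹ • w) • c 1) ∧
      ∀ z w : ℂ, g.symm (z • c 0 + w • c 1) = (l⁻¹ • z - b * w) • c 0 + (l • w) • c 1 := by
  have hl' : (l : ℂ) ≠ 0 := by exact_mod_cast hl.ne'
  set A : Matrix (Fin 2) (Fin 2) ℂ := !![(l : ℂ), b; 0, (l : ℂ)⁻¹] with hA
  set B : Matrix (Fin 2) (Fin 2) ℂ := !![(l : ℂ)⁻¹, -b; 0, (l : ℂ)] with hB
  have hAB : A * B = 1 := by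
    ext i j
    fin_cases i <;> fin_cases j <;> simp [hA, hB, Matrix.mul_apply, hl', mul_comm]
  have hBA : B * A = 1 := by
    ext i j
    fin_cases i <;> fin_cases j <;> simp [hA, hB, Matrix.mul_apply, hl', mul_comm]
  let g₀ : W ≃ₗ[ℂ] W := LinearEquiv.ofLinearMap (Matrix.toLin c c A) (Matrix.toLin c c B)
    (by rw [← Matrix.toLin_mul, hAB, Matrix.toLin_one])
    (by rw [← Matrix.toLin_mul, hBA, Matrix.toLin_one])
  have hg (z w : ℂ) : Matrix.toLin c c A (z • c 0 + w • c 1) =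
      (l • z + w * b) • c 0 + (l⁻¹ • w) • c 1 := by
    rw [map_add, map_smul, map_smul, Matrix.toLin_self, Matrix.toLin_self]
    simp only [Fin.sum_univ_two, hA, Matrix.of_apply, Matrix.cons_val_zero, Matrix.cons_val_one,
      Matrix.cons_val', Complex.real_smul, Complex.ofReal_inv]
    module
  have hgs (z w : ℂ) : Matrix.toLin c c B (z • c 0 + w • c 1) =
      (l⁻¹ • z - b * w) • c 0 + (l • w) • c 1 := by
    rw [map_add, map_smul, map_smul, Matrix.toLin_self, Matrix.toLin_self]
    simp only [Fin.sum_univ_two, hB, Matrix.of_apply, Matrix.cons_val_zero, Matrix.cons_val_one,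
      Matrix.cons_val', Complex.real_smul, Complex.ofReal_inv]
    module
  refine ⟨g₀.toContinuousLinearEquiv, ?_, hg, hgs⟩
  change LinearMap.det (Matrix.toLin c c A) = 1
  rw [LinearMap.det_toLin, hA, Matrix.det_fin_two_of]
  simp [hl']

/-- The restriction of a functional on convex bodies to a real hyperplane. -/
def hyperplaneFunctional (φ : ConvexBody W → W → ℝ) (c : Basis (Fin 2) ℂ W) (u : ℂ × ℂ)
    (S : Set (ℂ × ℝ)) : ℝ :=
  bodyExt (fun K => φ K (u.1 • c 0 + u.2 • c 1)) (hyperplaneEmbedding c '' S)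

theorem boostCovariant_hyperplaneFunctional
    {Z : ConvexBody W → ConvexBody (W →L[ℂ] ℂ)} {f : ℕ → ConvexBody W → W → ℝ}
    (hZg : IsSLContravariant Z) (hf : McMullenProps f)
    (hsum : ∀ (K : ConvexBody W) (u : W),
      hSupp (Z K) (fun ξ => (ξ u).re) = f 1 K u + f 2 K u + f 3 K u)
    (c : Basis (Fin 2) ℂ W) : BoostCovariant (hyperplaneFunctional (f 2) c) := by
  obtain ⟨cont, val, tra, hom, -, homd⟩ := id hf
  refine ⟨fun u => ?_, fun u x S hS => ?_, fun u r S hr hS => ?_, fun u l b S hl hS => ?_,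
    fun R u₁ => ?_, fun u s S hs hS => ?_⟩
  · exact (isContValuation_bodyExt (cont 2 _) (val 2 _)).comap_clm _
      (hyperplaneEmbedding_injective c)
  · rw [hyperplaneFunctional, hyperplaneFunctional,
      ← bodyExt_translate (tra 2 _) (hyperplaneEmbedding c x) (hS.image _)]
    simp only [Set.image_image, map_add]
  · have e : hyperplaneEmbedding c '' (r • S) = r • hyperplaneEmbedding c '' S :=
      Set.image_smul_comm _ r S fun y => map_smul _ r y
    have hS' := hS.image (hyperplaneEmbedding c)
    rw [hyperplaneFunctional, hyperplaneFunctional, e, bodyExt_of_isBody _ hS',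
      bodyExt_of_isBody _ (hS'.smul r), ← hom 2 _ _ r hr]
    rfl
  · obtain ⟨g, hdet, hg, hgs⟩ := exists_boost_equiv c hl b
    have hS' := hS.image (hyperplaneEmbedding c)
    have e : hyperplaneEmbedding c '' (boost l b '' S) =
        cReal (g : W →ₗ[ℂ] W) '' (hyperplaneEmbedding c '' S) := by
      rw [Set.image_image, Set.image_image]
      refine Set.image_congr fun x _ => ?_
      change _ = g (hyperplaneEmbedding c x)
      rw [hyperplaneEmbedding_apply, hyperplaneEmbedding_apply, hg, boost_apply]
      simp
    rw [hyperplaneFunctional, hyperplaneFunctional, e, bodyExt_of_isBody _ hS',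
      bodyExt_of_isBody _ (hS'.image _), ← hgs]
    exact component_two_equivariant hZg hf hsum g hdet ⟨_, hS'.1, hS'.2.1, hS'.2.2⟩ _
  · obtain ⟨C, hC, H⟩ := exists_component_two_lipschitz hf hsum
      (‖hyperplaneEmbedding c‖ * R) (u₁ • c 0)
    refine ⟨C, hC, fun S hS hSR u₂ s hs => ?_⟩
    have hS' := hS.image (hyperplaneEmbedding c)
    rw [hyperplaneFunctional, hyperplaneFunctional, bodyExt_of_isBody _ hS',
      bodyExt_of_isBody _ hS']
    have := H ⟨_, hS'.1, hS'.2.1, hS'.2.2⟩ ?_ (u₂ • c 1) s hs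
    · convert this using 4
      · simp only [smul_assoc]
        rw [add_comm]
      · simp
    · rintro _ ⟨x, hx, rfl⟩
      rw [mem_closedBall_zero_iff]
      exact (ContinuousLinearMap.le_opNorm _ x).trans
        (by gcongr; exact mem_closedBall_zero_iff.1 (hSR hx))
  · have hS' := hS.image (hyperplaneEmbedding c)
    rw [hyperplaneFunctional, hyperplaneFunctional, bodyExt_of_isBody _ hS',
      bodyExt_of_isBody _ hS', ← homd 2 _ _ s hs]
    congr 1
    simp only [Prod.smul_fst, Prod.smul_snd, smul_assoc, smul_add]

end Hyperplane

section Dimension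

variable {W : Type*} [NormedAddCommGroup W] [NormedSpace ℂ W] [FiniteDimensional ℂ W]

/-- A proper real subspace of a complex plane lies in `ℂ c₀ + ℝ c₁` for some complex basis `c`. -/
theorem exists_basis_coord_im_eq_zero (hW : finrank ℂ W = 2) {E : Submodule ℝ W}
    (hE : finrank ℝ E ≤ 3) :
    ∃ c : Basis (Fin 2) ℂ W, ∀ x ∈ E, (c.coord 1 x).im = 0 := by
  have hlt : E < ⊤ := by
    refine lt_top_iff_ne_top.2 fun h => ?_
    rw [h, finrank_top, finrank_real_of_complex, hW] at hE
    omega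
  obtain ⟨ℓ, hℓ, hEℓ⟩ := Submodule.exists_le_ker_of_lt_top E hlt
  let η : W →ₗ[ℂ] ℂ := Module.Dual.extendRCLike (𝕜 := ℂ) ℓ
  have hη (x : W) : (η x).re = ℓ x :=
    Module.Dual.re_extendRCLike_apply (𝕜 := ℂ) ℓ x
  obtain ⟨x₀, hx₀⟩ : ∃ x, η x ≠ 0 := by
    by_contra! h
    exact hℓ (LinearMap.ext fun x => by simp [← hη, h])
  have hker : finrank ℂ (LinearMap.ker η) ≠ 0 := by
    have := LinearMap.finrank_range_add_finrank_ker η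
    have := (LinearMap.range η).finrank_le
    rw [finrank_self] at this
    omega
  obtain ⟨⟨e, he⟩, he0⟩ := Module.finrank_pos_iff_exists_ne_zero.1 (Nat.pos_of_ne_zero hker)
  replace he0 : e ≠ 0 := fun h => he0 (Subtype.ext h)
  rw [LinearMap.mem_ker] at he
  set y := (Complex.I / η x₀) • x₀ with hy
  have hηy : η y = Complex.I := by rw [hy, map_smul, smul_eq_mul, div_mul_cancel₀ _ hx₀]
  have hli : LinearIndependent ℂ ![e, y] := by
    refine LinearIndependent.pair_iff.2 fun s t hst => ?_
    have h1 := congrArg η hst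
    simp only [map_add, map_smul, he, hηy, smul_eq_mul, mul_zero, zero_add, map_zero,
      mul_eq_zero, Complex.I_ne_zero, or_false] at h1
    subst h1
    simpa [he0] using hst
  let c := basisOfLinearIndependentOfCardEqFinrank hli (by simp [hW])
  have hc : ⇑c = ![e, y] := coe_basisOfLinearIndependentOfCardEqFinrank _ _
  refine ⟨c, fun x hx => ?_⟩
  have hx' : ℓ x = 0 := hEℓ hx
  rw [← hη, ← c.pair_expansion x, hc] at hx'
  simpa [he, hηy] using hx'

theorem eq_zero_of_hyperplaneFunctional_eq_zero {φ : ConvexBody W → W → ℝ}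
    (ht : ∀ u, IsTranslationInvariant fun K => φ K u) {c : Basis (Fin 2) ℂ W}
    (h : ∀ u S, IsBody S → hyperplaneFunctional φ c u S = 0) {K : ConvexBody W}
    (hK : ∀ x ∈ vectorSpan ℝ (K : Set W), (c.coord 1 x).im = 0) (u : W) : φ K u = 0 := by
  obtain ⟨x₀, hx₀⟩ := K.nonempty
  let ρ : W →L[ℝ] ℂ × ℝ := LinearMap.toContinuousLinearMap
    (((c.coord 0).restrictScalars ℝ).prod (Complex.reLm ∘ₗ (c.coord 1).restrictScalars ℝ))
  have hρ (x : W) : ρ x = (c.coord 0 x, (c.coord 1 x).re) := rfl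
  have hS := (K.translate (-x₀)).isBody
  have e : hyperplaneEmbedding c '' (ρ '' (K.translate (-x₀) : Set W)) =
      (K.translate (-x₀) : Set W) := by
    rw [Set.image_image]
    conv_rhs => rw [← Set.image_id (K.translate (-x₀) : Set W)]
    refine Set.image_congr ?_
    rintro _ ⟨x, hx, rfl⟩
    have him := hK (x - x₀) (vsub_mem_vectorSpan ℝ hx hx₀)
    dsimp only
    rw [neg_add_eq_sub, hρ, hyperplaneEmbedding_apply]
    have : (((c.coord 1 (x - x₀)).re : ℝ) : ℂ) = c.coord 1 (x - x₀) :=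
      Complex.ext rfl (by simpa using him.symm)
    rw [this]
    exact c.pair_expansion _
  have := h (c.coord 0 u, c.coord 1 u) _ (hS.image ρ)
  rw [hyperplaneFunctional, e, bodyExt_coe, c.pair_expansion] at this
  rw [← this]
  exact (ht u K (-x₀)).symm

end Dimension

/-- Lemma 3.3 of the paper. Let `W` be a 2-dimensional complex vector
space (with fixed basis `b` and Lebesgue measure `μ`) and let `Z : 𝒦(W) → 𝒦(W*)` be a
continuous, translation invariant, `SL(W,ℂ)`-contravariant Minkowski valuation given by
`h(Z K, u) = f₁(K,u) + f₂(K,u) + f₃(K,u)`, where `f₁(K,·) = h(D̃_M K, ·)` and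
`f₃(K,·) = h(Π_N K, ·)` for some `M, N ∈ 𝒦(ℂ)`. Then `f₂(K, ·) ≡ 0` whenever
`dim K ≤ 3`. -/
theorem degree_two_component_vanishes_dim_le_three
    {W : Type*} [NormedAddCommGroup W] [NormedSpace ℂ W] [FiniteDimensional ℂ W]
    (hW : Module.finrank ℂ W = 2) (b : Basis (Fin 2) ℂ W)
    [MeasurableSpace W] [BorelSpace W] (μ : Measure W) [μ.IsAddHaarMeasure]
    (Z : ConvexBody W → ConvexBody (W →L[ℂ] ℂ))
    (hZc : Continuous Z) (hZt : IsTranslationInvariant Z)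
    (hZv : IsMinkowskiValuation Z) (hZg : IsSLContravariant Z)
    (f : ℕ → ConvexBody W → W → ℝ) (hf : McMullenProps f)
    (M N : ConvexBody ℂ) (σ : Measure ℂ) (hσ : IsSurfaceAreaMeasure M σ)
    (hf1 : ∀ (K : ConvexBody W) (w : W),
      f 1 K w = ∫ α, hSupp (detBody b K w) (fun c => (c * (starRingEnd ℂ) α).re) ∂σ)
    (hf3 : ∀ (K : ConvexBody W) (w : W),
      f 3 K w = mixedVol μ ![K, K, K, dotBody N w])
    (hsum : ∀ (K : ConvexBody W) (u : W),
      hSupp (Z K) (fun ξ => (ξ u).re) = f 1 K u + f 2 K u + f 3 K u) :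
    ∀ K : ConvexBody W, bodyDim K ≤ 3 → ∀ u : W, f 2 K u = 0 := by
  intro K hK u
  obtain ⟨c, hc⟩ := exists_basis_coord_im_eq_zero hW hK
  exact eq_zero_of_hyperplaneFunctional_eq_zero (fun u => hf.2.2.1 2 u)
    (fun u S hS => (boostCovariant_hyperplaneFunctional hZg hf hsum c).eq_zero u hS) hc u
end
end

section
/- Let W be a 2-dimensional complex vector space with a fixed basis and let Z : 𝒦(W) → 𝒦(W*) be a continuous, translation invariant, SL(W,ℂ)-contravariant Minkowski valuation given by h(ZK,u) = f_1(K,u) + f_2(K,u) + f_3(K,u), where f_1(K,·) = h(D̃_M K,·) and f_3(K,·) = h(Π_N K,·) for some M, N ∈ 𝒦(ℂ). Let e_1, e_2 ∈ W be linearly independent over ℂ and let E = span_ℝ{e_1, ie_1, e_2}. Then for every K ∈ 𝒦(E) and all α, β ∈ ℂ one has f_2(K, αe_1 + βe_2) = f_2(K, βe_2). -/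
open scoped Pointwise
open MeasureTheory Module

noncomputable section

section Blaschke

variable {V : Type*} [NormedAddCommGroup V] [NormedSpace ℝ V]

theorem TopologicalSpace.NonemptyCompacts.isClosed_setOf_convex :
    IsClosed {A : TopologicalSpace.NonemptyCompacts V | Convex ℝ (A : Set V)} := by
  have key : {A : TopologicalSpace.NonemptyCompacts V | Convex ℝ (A : Set V)} =
      ⋂ (x : V) (y : V) (a : ℝ) (b : ℝ) (_ : 0 ≤ a) (_ : 0 ≤ b) (_ : a + b = 1),
        {A : TopologicalSpace.NonemptyCompacts V |
          Metric.infDist (a • x + b • y) (A : Set V) ≤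
            a * Metric.infDist x (A : Set V) + b * Metric.infDist y (A : Set V)} := by
    ext A
    simp only [Set.mem_ofPred_eq, Set.mem_iInter]
    constructor
    · intro hA x y a b ha hb hab
      obtain ⟨x', hx', hxd⟩ := A.isCompact.exists_infDist_eq_dist A.nonempty x
      obtain ⟨y', hy', hyd⟩ := A.isCompact.exists_infDist_eq_dist A.nonempty y
      calc Metric.infDist (a • x + b • y) (A : Set V)
          ≤ dist (a • x + b • y) (a • x' + b • y') :=
            Metric.infDist_le_dist_of_mem (hA hx' hy' ha hb hab)
        _ ≤ dist (a • x) (a • x') + dist (b • y) (b • y') := dist_add_add_le _ _ _ _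
        _ = _ := by
          rw [dist_smul₀, dist_smul₀, Real.norm_of_nonneg ha, Real.norm_of_nonneg hb, hxd, hyd]
    · intro h x hx y hy a b ha hb hab
      rw [A.isCompact.isClosed.mem_iff_infDist_zero A.nonempty]
      have := h x y a b ha hb hab
      rw [Metric.infDist_zero_of_mem hx, Metric.infDist_zero_of_mem hy] at this
      exact le_antisymm (by simpa using this) Metric.infDist_nonneg
  rw [key]
  have hc (x : V) : Continuous fun A : TopologicalSpace.NonemptyCompacts V =>
      Metric.infDist x (A : Set V) := (Metric.lipschitz_infDist_set x).continuous
  refine isClosed_iInter fun x => isClosed_iInter fun y => isClosed_iInter fun a =>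
    isClosed_iInter fun b => isClosed_iInter fun _ => isClosed_iInter fun _ =>
    isClosed_iInter fun _ => isClosed_le (hc _) ?_
  exact ((hc x).const_mul a).add ((hc y).const_mul b)

/-- Blaschke's selection theorem: the convex bodies inside a compact set form a compact set. -/
theorem ConvexBody.isCompact_setOf_subset {X : Set V} (hX : IsCompact X) :
    IsCompact {K : ConvexBody V | (K : Set V) ⊆ X} := by
  let ι : ConvexBody V → TopologicalSpace.NonemptyCompacts V :=
    fun K => ⟨⟨K, K.isCompact⟩, K.nonempty⟩
  have hι : Isometry ι := Isometry.of_dist_eq fun _ _ => rfl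
  rw [hι.isUniformInducing.isInducing.isCompact_iff]
  have himg : ι '' {K : ConvexBody V | (K : Set V) ⊆ X} =
      {A : TopologicalSpace.NonemptyCompacts V | (A : Set V) ⊆ X} ∩
        {A : TopologicalSpace.NonemptyCompacts V | Convex ℝ (A : Set V)} := by
    ext A
    constructor
    · rintro ⟨K, hK, rfl⟩
      exact ⟨hK, K.convex⟩
    · rintro ⟨hA, hA'⟩
      exact ⟨⟨A, hA', A.isCompact, A.nonempty⟩, hA, rfl⟩
  rw [himg]
  exact (TopologicalSpace.NonemptyCompacts.isCompact_subsets_of_isCompact hX).inter_right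
    TopologicalSpace.NonemptyCompacts.isClosed_setOf_convex

end Blaschke

section MapCLM

variable {V V' : Type*} [NormedAddCommGroup V] [NormedSpace ℝ V]
variable [NormedAddCommGroup V'] [NormedSpace ℝ V']

theorem ConvexBody.mapCLM_smul_body (L : V →L[ℝ] V') (t : ℝ) (K : ConvexBody V) :
    (t • K).mapCLM L = t • K.mapCLM L := by
  refine ConvexBody.ext ?_
  change L '' ((fun x => t • x) '' (K : Set V)) = (fun x => t • x) '' (L '' (K : Set V))
  simp only [Set.image_image, map_smul]

theorem ConvexBody.mapCLM_smul (L : V →L[ℝ] V') (t : ℝ) (K : ConvexBody V) :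
    K.mapCLM (t • L) = t • K.mapCLM L := by
  refine ConvexBody.ext ?_
  change (fun x => t • L x) '' (K : Set V) = (fun x => t • x) '' (L '' (K : Set V))
  simp only [Set.image_image]

end MapCLM

section SupportFunction

variable {V : Type*} [NormedAddCommGroup V] [NormedSpace ℝ V]

theorem hSupp_le_add (K : ConvexBody V) {p q r : V → ℝ} (hq : Continuous q) (hr : Continuous r)
    (h : ∀ x, p x = q x + r x) : hSupp K p ≤ hSupp K q + hSupp K r := by
  refine csSup_le (K.nonempty.image _) ?_
  rintro _ ⟨x, hx, rfl⟩
  rw [h]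
  exact add_le_add
    (le_csSup (K.isCompact.image hq).bddAbove (Set.mem_image_of_mem _ hx))
    (le_csSup (K.isCompact.image hr).bddAbove (Set.mem_image_of_mem _ hx))

theorem mixedVol_eq_zero_of_subset [FiniteDimensional ℝ V] [MeasurableSpace V] [BorelSpace V]
    (μ : Measure V) [μ.IsAddHaarMeasure] {F : Submodule ℝ V} (hF : F ≠ ⊤) {n : ℕ}
    (K : Fin n → ConvexBody V) (hK : ∀ i, (K i : Set V) ⊆ F) : mixedVol μ K = 0 := by
  have hs (S : Finset (Fin n)) : (∑ i ∈ S, (K i : Set V)) ⊆ F := by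
    refine Finset.sum_induction _ (fun A : Set V => A ⊆ F) ?_ ?_ fun i _ => hK i
    · intro A B hA hB
      rintro _ ⟨a, ha, b, hb, rfl⟩
      exact F.add_mem (hA ha) (hB hb)
    · rintro x hx
      rw [Set.mem_zero.1 hx]
      exact F.zero_mem
  have h0 (S : Finset (Fin n)) : μ (∑ i ∈ S, (K i : Set V)) = 0 :=
    measure_mono_null (hs S) (Measure.addHaar_submodule μ F hF)
  simp [mixedVol, h0]

end SupportFunction

theorem nonpos_of_forall_cubic_nonpos {a b c : ℝ}
    (h : ∀ t : ℝ, 0 < t → t * a + t ^ 2 * b + t ^ 3 * c ≤ 0) : c ≤ 0 := by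
  by_contra! hc
  set t := 1 + (|a| + |b|) / c with ht
  have ht1 : 1 ≤ t := by
    have : 0 ≤ (|a| + |b|) / c := by positivity
    linarith
  have htc : t * c = c + (|a| + |b|) := by rw [ht]; field_simp
  have h1 := h t (by linarith)
  have h2 : t * (a + t * b + t * (c + (|a| + |b|))) ≤ 0 := by rw [← htc]; linarith
  have h3 : a + t * b + t * (c + (|a| + |b|)) ≤ 0 := by
    by_contra! h4
    nlinarith
  have h5 := neg_abs_le a
  have h6 := neg_abs_le b
  nlinarith [abs_nonneg a, abs_nonneg b]

section Stretch

variable {W : Type*} [NormedAddCommGroup W] [NormedSpace ℂ W]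

theorem Module.Basis.eq_coord_smul_add_coord_smul (B : Basis (Fin 2) ℂ W) (x : W) :
    x = B.coord 0 x • B 0 + B.coord 1 x • B 1 := by
  have h := B.sum_repr x
  rw [Fin.sum_univ_two] at h
  exact h.symm

theorem Module.Basis.coord_zero_add_smul (B : Basis (Fin 2) ℂ W) (x : W) (c : ℂ) :
    B.coord 0 (c • B 1 + x) = B.coord 0 x := by
  rw [map_add, map_smul]
  simp

theorem Module.Basis.coord_one_add_smul (B : Basis (Fin 2) ℂ W) (x : W) (c : ℂ) :
    B.coord 1 (c • B 1 + x) = c + B.coord 1 x := by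
  rw [map_add, map_smul]
  simp

theorem Module.Basis.ext_coord (B : Basis (Fin 2) ℂ W) {x y : W}
    (h0 : B.coord 0 x = B.coord 0 y) (h1 : B.coord 1 x = B.coord 1 y) : x = y := by
  rw [B.eq_coord_smul_add_coord_smul x, B.eq_coord_smul_add_coord_smul y, h0, h1]

/-- A cylinder in the real hyperplane on which the second coordinate is real. -/
def coordCylinder (B : Basis (Fin 2) ℂ W) (m : ℝ) : Set W :=
  {x | ‖B.coord 0 x‖ ≤ m ∧ (B.coord 1 x).im = 0 ∧ |(B.coord 1 x).re| ≤ m}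

theorem isCompact_coordCylinder (B : Basis (Fin 2) ℂ W) (m : ℝ) :
    IsCompact (coordCylinder B m) := by
  have himg : coordCylinder B m =
      (fun p : ℂ × ℝ => (p.2 : ℂ) • B 1 + p.1 • B 0) ''
        (Metric.closedBall 0 m ×ˢ Set.Icc (-m) m) := by
    ext x
    constructor
    · rintro ⟨h0, h1, h2⟩
      refine ⟨(B.coord 0 x, (B.coord 1 x).re), ⟨by simpa using h0, abs_le.1 h2⟩, ?_⟩
      have : (((B.coord 1 x).re : ℝ) : ℂ) = B.coord 1 x := Complex.ext rfl (by simpa using h1.symm)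
      simp only [this]
      rw [add_comm]
      exact (B.eq_coord_smul_add_coord_smul x).symm
    · rintro ⟨⟨a, r⟩, ⟨ha, hr⟩, rfl⟩
      simp only [coordCylinder, Set.mem_ofPred_eq, B.coord_zero_add_smul, B.coord_one_add_smul]
      exact ⟨by simpa using ha, by simp, by simpa using abs_le.2 hr⟩
  rw [himg]
  refine ((isCompact_closedBall _ _).prod isCompact_Icc).image ?_
  fun_prop

variable [FiniteDimensional ℂ W]

theorem exists_stretch (B : Basis (Fin 2) ℂ W) :
    ∃ g : W ≃L[ℂ] W, LinearMap.det ((g : W →L[ℂ] W) : W →ₗ[ℂ] W) = 1 ∧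
      (∀ x, B.coord 0 (g x) = ((√2)⁻¹ : ℝ) * B.coord 0 x) ∧
      (∀ x, B.coord 1 (g x) = (√2 : ℝ) * B.coord 1 x) := by
  have h2 : ((√2 : ℝ) : ℂ) ≠ 0 := by simp
  let G : W →ₗ[ℂ] W :=
    Matrix.toLin B B (Matrix.diagonal ![(((√2)⁻¹ : ℝ) : ℂ), ((√2 : ℝ) : ℂ)])
  have hG : LinearMap.det G = 1 := by
    simp [G, LinearMap.det_toLin, Matrix.det_diagonal, h2]
  have hrepr (x : W) (i : Fin 2) :
      B.coord i (G x) = ![(((√2)⁻¹ : ℝ) : ℂ), ((√2 : ℝ) : ℂ)] i * B.coord i x := by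
    have := congrFun (LinearMap.toMatrix_mulVec_repr B B G x) i
    rw [LinearMap.toMatrix_toLin, Matrix.mulVec_diagonal] at this
    exact this.symm
  refine ⟨(LinearMap.equivOfDetNeZero G (by rw [hG]; exact one_ne_zero)).toContinuousLinearEquiv,
    ?_, fun x => hrepr x 0, fun x => hrepr x 1⟩
  exact hG

/-- A translation invariant continuous valuation which grows by more than the factor `2` under
the stretch by `2` in one direction of a real hyperplane vanishes on that hyperplane. -/
theorem eq_zero_of_stretch (B : Basis (Fin 2) ℂ W) (φ : ConvexBody W → ℝ) (hc : Continuous φ)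
    (hv : IsValuation φ) (ht : IsTranslationInvariant φ) (R : W →L[ℝ] W)
    (h0 : ∀ x, B.coord 0 (R x) = B.coord 0 x) (h1 : ∀ x, B.coord 1 (R x) = 2 * B.coord 1 x)
    {k : ℝ} (hk : 2 < k) (hR : ∀ K, φ (K.mapCLM R) = k * φ K) (K : ConvexBody W)
    (hK : ∀ x ∈ (K : Set W), (B.coord 1 x).im = 0) : φ K = 0 := by
  have hflat (D : ConvexBody W) (r : ℂ) (hD : ∀ x ∈ (D : Set W), B.coord 1 x = r) : φ D = 0 := by
    have hDR : D.mapCLM R = D.translate (r • B 1) := by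
      refine ConvexBody.ext ?_
      refine Set.image_congr fun x hx => B.ext_coord ?_ ?_
      · rw [h0]; simp
      · rw [h1, map_add, hD x hx]; simp; ring
    have := hR D
    rw [hDR, ht] at this
    nlinarith
  have hc0 : Continuous (B.coord 0) := LinearMap.continuous_of_finiteDimensional _
  have hc1 : Continuous (B.coord 1) := LinearMap.continuous_of_finiteDimensional _
  obtain ⟨m₀, hm₀⟩ := K.isCompact.exists_bound_of_continuousOn hc0.continuousOn
  obtain ⟨m₁, hm₁⟩ := K.isCompact.exists_bound_of_continuousOn hc1.continuousOn
  set m := max m₀ m₁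
  have hKm : (K : Set W) ⊆ coordCylinder B m := fun x hx =>
    ⟨(hm₀ x hx).trans (le_max_left _ _), hK x hx,
      (Complex.abs_re_le_norm _).trans ((hm₁ x hx).trans (le_max_right _ _))⟩
  obtain ⟨L, hLm, hL⟩ := (ConvexBody.isCompact_setOf_subset
    (isCompact_coordCylinder B m)).exists_isMaxOn ⟨K, hKm⟩ hc.abs.continuousOn
  have hmax (D : ConvexBody W) (hD : (D : Set W) ⊆ coordCylinder B m) : |φ D| ≤ |φ L| := hL hD
  -- a body in a translate of the cylinder obeys the same bound
  have hmax' (D : ConvexBody W) (s : ℝ) (hD : ∀ x ∈ (D : Set W), ‖B.coord 0 x‖ ≤ m ∧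
      (B.coord 1 x).im = 0 ∧ |s + (B.coord 1 x).re| ≤ m) : |φ D| ≤ |φ L| := by
    rw [← ht D ((s : ℂ) • B 1)]
    refine hmax _ ?_
    rintro _ ⟨x, hx, rfl⟩
    obtain ⟨hx0, hx1, hx2⟩ := hD x hx
    simp only [coordCylinder, Set.mem_ofPred_eq, B.coord_zero_add_smul, B.coord_one_add_smul]
    exact ⟨hx0, by simpa using hx1, by simpa using hx2⟩
  set P := L.mapCLM R with hP
  have hPm : ∀ x ∈ (P : Set W), ‖B.coord 0 x‖ ≤ m ∧
      (B.coord 1 x).im = 0 ∧ |(B.coord 1 x).re| ≤ 2 * m := by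
    rintro _ ⟨x, hx, rfl⟩
    obtain ⟨hx0, hx1, hx2⟩ := hLm hx
    rw [h0, h1]
    refine ⟨hx0, by simpa using hx1, ?_⟩
    simpa [abs_mul] using hx2
  let ℓ : W →ₗ[ℝ] ℝ := Complex.reLm ∘ₗ (B.coord 1).restrictScalars ℝ
  have hℓ : Continuous ℓ := Complex.continuous_re.comp hc1
  have hℓm : ∀ x ∈ (P : Set W), ‖B.coord 0 x‖ ≤ m ∧ (B.coord 1 x).im = 0 ∧ |ℓ x| ≤ 2 * m := hPm
  have hbound : |φ P| ≤ 2 * |φ L| := by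
    by_cases hpos : ∃ x ∈ (P : Set W), 0 ≤ ℓ x
    swap
    · push Not at hpos
      have := hmax' P m fun x hx => ⟨(hℓm x hx).1, (hℓm x hx).2.1, by
        have h := abs_le.1 (hℓm x hx).2.2
        have h' := hpos x hx
        change |m + ℓ x| ≤ m
        rw [abs_le]; constructor <;> linarith⟩
      linarith [abs_nonneg (φ L)]
    by_cases hneg : ∃ x ∈ (P : Set W), ℓ x ≤ 0
    swap
    · push Not at hneg
      have := hmax' P (-m) fun x hx => ⟨(hℓm x hx).1, (hℓm x hx).2.1, by
        have h := abs_le.1 (hℓm x hx).2.2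
        have h' := hneg x hx
        change |-m + ℓ x| ≤ m
        rw [abs_le]; constructor <;> linarith⟩
      linarith [abs_nonneg (φ L)]
    obtain ⟨x, hx, hx0⟩ := hpos
    obtain ⟨y, hy, hy0⟩ := hneg
    let U : ConvexBody W := ⟨(P : Set W) ∩ {x | 0 ≤ ℓ x},
      P.convex.inter (convex_halfSpace_ge ℓ.isLinear 0),
      P.isCompact.inter_right (isClosed_le continuous_const hℓ), ⟨x, hx, hx0⟩⟩
    let D : ConvexBody W := ⟨(P : Set W) ∩ {x | ℓ x ≤ 0},
      P.convex.inter (convex_halfSpace_le ℓ.isLinear 0),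
      P.isCompact.inter_right (isClosed_le hℓ continuous_const), ⟨y, hy, hy0⟩⟩
    have hUD : (U : Set W) ∪ (D : Set W) = P := by
      change (P : Set W) ∩ {x | 0 ≤ ℓ x} ∪ (P : Set W) ∩ {x | ℓ x ≤ 0} = P
      rw [← Set.inter_union_distrib_left, Set.inter_eq_left]
      exact fun z _ => le_total 0 (ℓ z)
    have hU : Convex ℝ ((U : Set W) ∪ (D : Set W)) := hUD ▸ P.convex
    have hI : ((U : Set W) ∩ (D : Set W)).Nonempty := by
      obtain ⟨z, hz, hz0⟩ := (P.convex.linear_image ℓ).ordConnected.out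
        (Set.mem_image_of_mem ℓ hy) (Set.mem_image_of_mem ℓ hx) ⟨hy0, hx0⟩
      exact ⟨z, ⟨hz, hz0.ge⟩, ⟨hz, hz0.le⟩⟩
    have hval := hv U D hU hI
    have hPU : U.union D hU = P := ConvexBody.ext hUD
    have hI0 : φ (U.inter D hI) = 0 := by
      refine hflat _ 0 fun z hz => Complex.ext ?_ ?_
      · exact le_antisymm hz.2.2 hz.1.2
      · exact (hℓm z hz.1.1).2.1
    have hUb := hmax' U (-m) fun z hz => ⟨(hℓm z hz.1).1, (hℓm z hz.1).2.1, by
        have h := abs_le.1 (hℓm z hz.1).2.2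
        have h' : 0 ≤ ℓ z := hz.2
        change |-m + ℓ z| ≤ m
        rw [abs_le]; constructor <;> linarith⟩
    have hDb := hmax' D m fun z hz => ⟨(hℓm z hz.1).1, (hℓm z hz.1).2.1, by
        have h := abs_le.1 (hℓm z hz.1).2.2
        have h' : ℓ z ≤ 0 := hz.2
        change |m + ℓ z| ≤ m
        rw [abs_le]; constructor <;> linarith⟩
    simp only [hPU, hI0, add_zero] at hval
    rw [hval]
    linarith [abs_add_le (φ U) (φ D)]
  rw [hR L, abs_mul, abs_of_pos (by linarith : 0 < k)] at hbound
  have hL0 : |φ L| = 0 := by nlinarith [abs_nonneg (φ L)]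
  exact abs_eq_zero.1 (le_antisymm (hL0 ▸ hmax K hKm) (abs_nonneg _))

theorem hSupp_apply_re_of_contravariant {Z : ConvexBody W → ConvexBody (W →L[ℂ] ℂ)}
    (hZ : IsSLContravariant Z) (g : W ≃L[ℂ] W)
    (hg : LinearMap.det ((g : W →L[ℂ] W) : W →ₗ[ℂ] W) = 1) (K : ConvexBody W) (u : W) :
    hSupp (Z (K.mapCLM (cReal (g : W →ₗ[ℂ] W)))) (fun ξ => (ξ (g u)).re) =
      hSupp (Z K) (fun ξ => (ξ u).re) := by
  rw [hZ g hg K, hSupp, hSupp]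
  congr 1
  change _ '' (_ '' _) = _
  rw [Set.image_image]
  refine Set.image_congr fun ξ _ => ?_
  simp [precompDual]

end Stretch

/-- equation (3.2) of the paper. Let `W` be a 2-dimensional complex
vector space (with fixed basis `b` and Lebesgue measure `μ`) and let
`Z : 𝒦(W) → 𝒦(W*)` be a continuous, translation invariant, `SL(W,ℂ)`-contravariant
Minkowski valuation given by `h(Z K, u) = f₁(K,u) + f₂(K,u) + f₃(K,u)`, where
`f₁(K,·) = h(D̃_M K, ·)` and `f₃(K,·) = h(Π_N K, ·)` for some `M, N ∈ 𝒦(ℂ)`. Let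
`e₁, e₂ ∈ W` be linearly independent over `ℂ` and `E = span_ℝ {e₁, i e₁, e₂}`. Then for
every `K ∈ 𝒦(E)` and all `α, β ∈ ℂ` one has `f₂(K, α e₁ + β e₂) = f₂(K, β e₂)`. -/
theorem degree_two_component_partial_linearity
    {W : Type*} [NormedAddCommGroup W] [NormedSpace ℂ W] [FiniteDimensional ℂ W]
    (hW : Module.finrank ℂ W = 2) (b : Basis (Fin 2) ℂ W)
    [MeasurableSpace W] [BorelSpace W] (μ : Measure W) [μ.IsAddHaarMeasure]
    (Z : ConvexBody W → ConvexBody (W →L[ℂ] ℂ))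
    (hZc : Continuous Z) (hZt : IsTranslationInvariant Z)
    (hZv : IsMinkowskiValuation Z) (hZg : IsSLContravariant Z)
    (f : ℕ → ConvexBody W → W → ℝ) (hf : McMullenProps f)
    (M N : ConvexBody ℂ) (σ : Measure ℂ) (hσ : IsSurfaceAreaMeasure M σ)
    (hf1 : ∀ (K : ConvexBody W) (w : W),
      f 1 K w = ∫ α, hSupp (detBody b K w) (fun c => (c * (starRingEnd ℂ) α).re) ∂σ)
    (hf3 : ∀ (K : ConvexBody W) (w : W),
      f 3 K w = mixedVol μ ![K, K, K, dotBody N w])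
    (hsum : ∀ (K : ConvexBody W) (u : W),
      hSupp (Z K) (fun ξ => (ξ u).re) = f 1 K u + f 2 K u + f 3 K u)
    (e₁ e₂ : W) (he : LinearIndependent ℂ ![e₁, e₂]) :
    ∀ K : ConvexBody W,
      (K : Set W) ⊆ (Submodule.span ℝ {e₁, Complex.I • e₁, e₂} : Submodule ℝ W) →
      ∀ α β : ℂ, f 2 K (α • e₁ + β • e₂) = f 2 K (β • e₂) := by
  obtain ⟨hfc, hfv, hft, hfh, -, hfu⟩ := hf
  have hpoly (t : ℝ) (ht : 0 < t) (K : ConvexBody W) (u : W) :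
      hSupp (Z (t • K)) (fun ξ => (ξ u).re) = t * f 1 K u + t ^ 2 * f 2 K u + t ^ 3 * f 3 K u := by
    rw [hsum, hfh 1 K u t ht, hfh 2 K u t ht, hfh 3 K u t ht, pow_one]
  let B : Basis (Fin 2) ℂ W := basisOfLinearIndependentOfCardEqFinrank he (by simp [hW])
  have hB0 : B 0 = e₁ := by simp [B]
  have hB1 : B 1 = e₂ := by simp [B]
  obtain ⟨g, hg, hg0, hg1⟩ := exists_stretch B
  have hs : (0 : ℝ) < √2 := by positivity
  have hss : √2 * √2 = (2 : ℝ) := Real.mul_self_sqrt (by norm_num)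
  have hequiv (K : ConvexBody W) (u : W) :
      f 2 (K.mapCLM (cReal (g : W →ₗ[ℂ] W))) (g u) = f 2 K u := by
    have h (t : ℝ) (ht : 0 < t) := hSupp_apply_re_of_contravariant hZg g hg (t • K) u
    have h1 := h 1 one_pos
    have h2 := h 2 two_pos
    have h3 := h 3 three_pos
    rw [ConvexBody.mapCLM_smul_body, hpoly _ (by norm_num), hpoly _ (by norm_num)] at h1 h2 h3
    linarith
  have hf2_zero (K : ConvexBody W) (hK : ∀ x ∈ (K : Set W), (B.coord 1 x).im = 0) (α : ℂ) :
      f 2 K (α • e₁) = 0 := by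
    have hgα : g (α • e₁) = (√2)⁻¹ • (α • e₁) := by
      refine B.ext_coord ?_ ?_
      · rw [hg0]; simp [← hB0]
      · rw [hg1]; simp [← hB0]
    refine eq_zero_of_stretch B (fun K => f 2 K (α • e₁)) (hfc 2 _) (hfv 2 _) (hft 2 _)
      (√2 • cReal (g : W →ₗ[ℂ] W)) (k := √2 ^ 3) ?_ ?_ ?_ ?_ K hK
    · intro x
      change B.coord 0 (√2 • g x) = _
      rw [← Complex.coe_smul, map_smul, hg0, smul_eq_mul, ← mul_assoc, ← Complex.ofReal_mul,
        mul_inv_cancel₀ hs.ne', Complex.ofReal_one, one_mul]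
    · intro x
      change B.coord 1 (√2 • g x) = _
      rw [← Complex.coe_smul, map_smul, hg1, smul_eq_mul, ← mul_assoc, ← Complex.ofReal_mul, hss,
        Complex.ofReal_ofNat]
    · nlinarith
    · intro K
      have h := hequiv K (α • e₁)
      rw [hgα, hfu 2 _ _ _ (inv_pos.2 hs), inv_mul_eq_iff_eq_mul₀ hs.ne'] at h
      simp only [ConvexBody.mapCLM_smul]
      rw [hfh 2 _ _ _ hs, h]
      ring
  have hf3_zero (K : ConvexBody W) (hK : ∀ x ∈ (K : Set W), (B.coord 1 x).im = 0) (α : ℂ) :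
      f 3 K (α • e₁) = 0 := by
    let F : Submodule ℝ W := LinearMap.ker (Complex.imLm ∘ₗ (B.coord 1).restrictScalars ℝ)
    have hF : F ≠ ⊤ := by
      intro h
      have : Complex.I • B 1 ∈ F := h ▸ Submodule.mem_top
      simp [F] at this
    have : FiniteDimensional ℝ W := FiniteDimensional.complexToReal W
    rw [hf3]
    refine mixedVol_eq_zero_of_subset μ hF _ fun i => ?_
    have hKF : (K : Set W) ⊆ F := hK
    fin_cases i
    · exact hKF
    · exact hKF
    · exact hKF
    · rintro _ ⟨c, -, rfl⟩
      simp [F, ← hB0]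
  have hle (K : ConvexBody W) (hK : ∀ x ∈ (K : Set W), (B.coord 1 x).im = 0) (α : ℂ) (u : W)
      (t : ℝ) (ht : 0 < t) :
      t * (f 1 K (u + α • e₁) - f 1 K u - f 1 K (α • e₁)) +
        t ^ 2 * (f 2 K (u + α • e₁) - f 2 K u) + t ^ 3 * (f 3 K (u + α • e₁) - f 3 K u) ≤ 0 := by
    have h := hSupp_le_add (Z (t • K)) (p := fun ξ => (ξ (u + α • e₁)).re)
      (q := fun ξ => (ξ u).re) (r := fun ξ => (ξ (α • e₁)).re)
      (by fun_prop) (by fun_prop) (fun ξ => by rw [map_add, Complex.add_re])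
    rw [hpoly t ht, hpoly t ht, hpoly t ht, hf2_zero K hK, hf3_zero K hK] at h
    linarith
  have hneg (α : ℂ) (u : W) : u + α • e₁ + (-α) • e₁ = u := by module
  intro K hKE α β
  have hK : ∀ x ∈ (K : Set W), (B.coord 1 x).im = 0 := by
    intro x hx
    have hsub : Submodule.span ℝ {e₁, Complex.I • e₁, e₂} ≤
        LinearMap.ker (Complex.imLm ∘ₗ (B.coord 1).restrictScalars ℝ) := by
      rw [Submodule.span_le]
      rintro _ (rfl | rfl | rfl) <;> simp [← hB0, ← hB1]
    exact hsub (hKE hx)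
  have hle3 (α : ℂ) (u : W) : f 3 K (u + α • e₁) ≤ f 3 K u :=
    sub_nonpos.1 (nonpos_of_forall_cubic_nonpos (hle K hK α u))
  have heq3 (α : ℂ) (u : W) : f 3 K (u + α • e₁) = f 3 K u :=
    le_antisymm (hle3 α u) (by simpa only [hneg] using hle3 (-α) (u + α • e₁))
  have hle2 (α : ℂ) (u : W) : f 2 K (u + α • e₁) ≤ f 2 K u := by
    refine sub_nonpos.1 (nonpos_of_forall_cubic_nonpos (a := 0)
      (b := f 1 K (u + α • e₁) - f 1 K u - f 1 K (α • e₁)) fun t ht => ?_)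
    have h := hle K hK α u t ht
    rw [heq3 α u] at h
    nlinarith
  rw [add_comm]
  exact le_antisymm (hle2 α _) (by simpa only [hneg] using hle2 (-α) (β • e₂ + α • e₁))
end
end
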